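/- arXiv:0905.2650 — 2 statements merged into one kernel-verified Lean document; each statement's English description precedes it below -/
import Mathlib

section
/- Let λ be a rectangular partition of N and T ∈ SYT(λ). Then the cyclic descent set shifts cyclically under promotion: D(p(T)) = {i − 1 (mod N) : i ∈ D(T)}. -/
/-! ### Tableau machinery: fillings as functions `ℕ × ℕ → ℕ` (entry `0` = empty/absent cell) -/

/-- One jeu de taquin slide: starting from an empty box at position `c`, repeatedly swap the
empty box with the smaller of the entries directly to its right and directly below it
(`0` denotes an empty/absent cell), until neither exists.  Returns the resulting filling
together with the final position of the empty box; `fuel` bounds the number of steps. -/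
def jdtSlide : ℕ → ((ℕ × ℕ) → ℕ) → (ℕ × ℕ) → (((ℕ × ℕ) → ℕ) × (ℕ × ℕ))
  | 0, f, c => (f, c)
  | fuel+1, f, c =>
    let a := c.1
    let b := c.2
    let r := f (a, b+1)
    let d := f (a+1, b)
    if r = 0 ∧ d = 0 then (f, c)
    else if d = 0 ∨ (r ≠ 0 ∧ r < d) then
      jdtSlide fuel (Function.update (Function.update f (a, b+1) 0) (a, b) r) (a, b+1)
    else
      jdtSlide fuel (Function.update (Function.update f (a+1, b) 0) (a, b) d) (a+1, b)

/-- Jeu de taquin promotion of a standard filling with `N` boxes: delete the entry `1`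
(in the upper left corner `(0,0)`), decrease every other entry by `1`, slide the empty box
by jeu de taquin, and fill the final empty box with `N`. -/
def promote (N : ℕ) (f : (ℕ × ℕ) → ℕ) : (ℕ × ℕ) → ℕ :=
  let s := jdtSlide N (fun c => f c - 1) (0, 0)
  Function.update s.1 s.2 N

/-- The cells of the (straight-shape) Young diagram of a partition `lam`:
row `a` consists of the cells `(a, b)` with `b < lam a`. -/
def strCell (lam : List ℕ) (c : ℕ × ℕ) : Prop := c.2 < lam.getD c.1 0

/-- The cells of the shifted Young diagram of a strict partition `lam`:
row `a` consists of the cells `(a, b)` with `a ≤ b < a + lam a`. -/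
def shiftCell (lam : List ℕ) (c : ℕ × ℕ) : Prop :=
  c.1 ≤ c.2 ∧ c.2 < c.1 + lam.getD c.1 0

/-- `IsStdFilling cells N f` : `f` is a standard tableau on the cell set `cells` with
entries `1, …, N`: it vanishes off `cells`, restricts to a bijection `cells → {1, …, N}`,
and is strictly increasing along rows and columns. -/
def IsStdFilling (cells : ℕ × ℕ → Prop) (N : ℕ) (f : (ℕ × ℕ) → ℕ) : Prop :=
  (∀ c, ¬ cells c → f c = 0) ∧
  (∀ c, cells c → 1 ≤ f c ∧ f c ≤ N) ∧
  (∀ c c', cells c → cells c' → f c = f c' → c = c') ∧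
  (∀ v, 1 ≤ v → v ≤ N → ∃ c, cells c ∧ f c = v) ∧
  (∀ a b, cells (a, b) → cells (a, b+1) → f (a, b) < f (a, b+1)) ∧
  (∀ a b, cells (a, b) → cells (a+1, b) → f (a, b) < f (a+1, b))

/-- The rectangular partition with `b` rows and `n` columns. -/
def rectShape (b n : ℕ) : List ℕ := List.replicate b n

/-- The square partition with `n` rows and `n` columns. -/
def sqShape (n : ℕ) : List ℕ := List.replicate n n

/-- The doubled staircase strict partition `(2n-1, 2n-3, …, 1)`. -/
def dblStair (n : ℕ) : List ℕ := (List.range n).map (fun i => 2*n - 1 - 2*i)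

/-- The index of the row containing the entry `v` of a filling
(rows numbered `0, 1, 2, …` from the top). -/
noncomputable def rowOf (f : (ℕ × ℕ) → ℕ) (v : ℕ) : ℕ := sInf {a | ∃ b, f (a, b) = v}

/-- The cyclic descent set of a standard filling `f` with `N` boxes: all `i` with
`1 ≤ i ≤ N - 1` such that `i` appears in a row strictly above `i+1` in `f`, together with
`0` if `N-1` appears in a row strictly above `N` in `p(f)`, where `p` is promotion. -/
noncomputable def tabCycDes (N : ℕ) (f : (ℕ × ℕ) → ℕ) : Set ℕ :=
  {i | 1 ≤ i ∧ i < N ∧ rowOf f i < rowOf f (i + 1)} ∪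
  {i | i = 0 ∧ rowOf (promote N f) (N - 1) < rowOf (promote N f) N}

/-- Convenient form of standardness for the `b × n` rectangle. -/
structure RStd (b n : ℕ) (f : ℕ × ℕ → ℕ) : Prop where
  off : ∀ x y, ¬ (x < b ∧ y < n) → f (x, y) = 0
  lo : ∀ x y, x < b → y < n → 1 ≤ f (x, y)
  hi : ∀ x y, x < b → y < n → f (x, y) ≤ b * n
  inj : ∀ x y x' y', x < b → y < n → x' < b → y' < n → f (x, y) = f (x', y') → x = x' ∧ y = y'
  surj : ∀ v, 1 ≤ v → v ≤ b * n → ∃ x y, x < b ∧ y < n ∧ f (x, y) = v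
  row : ∀ x y, x < b → y + 1 < n → f (x, y) < f (x, y + 1)
  col : ∀ x y, x + 1 < b → y < n → f (x, y) < f (x + 1, y)

theorem strCell_rect (b n x y : ℕ) : strCell (rectShape b n) (x, y) ↔ x < b ∧ y < n := by
  unfold strCell rectShape
  by_cases h : x < b
  · simp [List.getD, h]
  · simp [List.getD, h]

theorem rstd_of {b n : ℕ} {f : ℕ × ℕ → ℕ}
    (h : IsStdFilling (strCell (rectShape b n)) (b * n) f) : RStd b n f := by
  obtain ⟨h1, h2, h3, h4, h5, h6⟩ := h
  refine ⟨?_, ?_, ?_, ?_, ?_, ?_, ?_⟩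
  · intro x y hxy
    exact h1 _ (by rwa [strCell_rect])
  · intro x y hx hy
    exact (h2 (x, y) ((strCell_rect _ _ _ _).2 ⟨hx, hy⟩)).1
  · intro x y hx hy
    exact (h2 (x, y) ((strCell_rect _ _ _ _).2 ⟨hx, hy⟩)).2
  · intro x y x' y' hx hy hx' hy' e
    have := h3 _ _ ((strCell_rect _ _ _ _).2 ⟨hx, hy⟩) ((strCell_rect _ _ _ _).2 ⟨hx', hy'⟩) e
    simpa using this
  · intro v hv hv'
    obtain ⟨⟨x, y⟩, hc, e⟩ := h4 v hv hv'
    rw [strCell_rect] at hc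
    exact ⟨x, y, hc.1, hc.2, e⟩
  · intro x y hx hy
    exact h5 x y ((strCell_rect _ _ _ _).2 ⟨hx, by omega⟩) ((strCell_rect _ _ _ _).2 ⟨hx, hy⟩)
  · intro x y hx hy
    exact h6 x y ((strCell_rect _ _ _ _).2 ⟨by omega, hy⟩) ((strCell_rect _ _ _ _).2 ⟨hx, hy⟩)

/-- Next cell on the sliding path. -/
def nxt (f : ℕ × ℕ → ℕ) (c : ℕ × ℕ) : ℕ × ℕ :=
  if f (c.1 + 1, c.2) = 0 ∨ (f (c.1, c.2 + 1) ≠ 0 ∧ f (c.1, c.2 + 1) < f (c.1 + 1, c.2)) then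
    (c.1, c.2 + 1) else (c.1 + 1, c.2)

/-- The sliding path. -/
def pth (f : ℕ × ℕ → ℕ) : ℕ → ℕ × ℕ
  | 0 => (0, 0)
  | k + 1 => nxt f (pth f k)

namespace RStd

variable {b n : ℕ} {f : ℕ × ℕ → ℕ}

theorem mono_row (h : RStd b n f) (x y d : ℕ) (hx : x < b) (hy : y + d < n) :
    f (x, y) + d ≤ f (x, y + d) := by
  induction d with
  | zero => simp
  | succ d ih =>
    have h1 := ih (by omega)
    have h2 := h.row x (y + d) hx (by omega)
    have e : y + (d + 1) = y + d + 1 := by omega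
    rw [e]; omega

theorem mono_col (h : RStd b n f) (x y d : ℕ) (hx : x + d < b) (hy : y < n) :
    f (x, y) + d ≤ f (x + d, y) := by
  induction d with
  | zero => simp
  | succ d ih =>
    have h1 := ih (by omega)
    have h2 := h.col (x + d) y (by omega) hy
    have e : x + (d + 1) = x + d + 1 := by omega
    rw [e]; omega

theorem mono (h : RStd b n f) {x y x' y' : ℕ} (hx : x ≤ x') (hy : y ≤ y') (hx' : x' < b)
    (hy' : y' < n) : f (x, y) + (x' - x) + (y' - y) ≤ f (x', y') := by
  have h1 := h.mono_col x y (x' - x) (by omega) (by omega)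
  have h2 := h.mono_row x' y (y' - y) (by omega) (by omega)
  have e1 : x + (x' - x) = x' := by omega
  have e2 : y + (y' - y) = y' := by omega
  rw [e1] at h1; rw [e2] at h2; omega

theorem nxt_spec (h : RStd b n f) {x y : ℕ} (hx : x < b) (hy : y < n)
    (hc : x + y < b + n - 2) :
    (nxt f (x, y) = (x, y + 1) ∧ y + 1 < n ∧ (x + 1 < b → f (x, y + 1) < f (x + 1, y))) ∨
    (nxt f (x, y) = (x + 1, y) ∧ x + 1 < b ∧ (y + 1 < n → f (x + 1, y) < f (x, y + 1))) := by
  unfold nxt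
  dsimp only
  by_cases h1 : x + 1 < b
  · have l1 := h.lo (x + 1) y h1 hy
    by_cases h2 : y + 1 < n
    · have l2 := h.lo x (y + 1) hx h2
      have ne : f (x, y + 1) ≠ f (x + 1, y) := fun e => by
        have := h.inj _ _ _ _ hx h2 h1 hy e
        omega
      split_ifs with hh
      · left; refine ⟨rfl, h2, fun _ => by omega⟩
      · right; refine ⟨rfl, h1, fun _ => by omega⟩
    · have l2 := h.off x (y + 1) (by omega)
      rw [if_neg (by omega)]
      right; exact ⟨rfl, h1, fun h => absurd h h2⟩
  · have l1 := h.off (x + 1) y (by omega)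
    rw [if_pos (by omega)]
    left; exact ⟨rfl, by omega, fun h => absurd h h1⟩

theorem pth_mem (h : RStd b n f) (hb : 0 < b) (hn : 0 < n) (k : ℕ) (hk : k ≤ b + n - 2) :
    (pth f k).1 < b ∧ (pth f k).2 < n ∧ (pth f k).1 + (pth f k).2 = k := by
  induction k with
  | zero => simp [pth, hb, hn]
  | succ k ih =>
    obtain ⟨h1, h2, h3⟩ := ih (by omega)
    have := h.nxt_spec h1 h2 (by omega)
    simp only [pth]
    rcases this with ⟨e, h4, -⟩ | ⟨e, h4, -⟩ <;> simp only [Prod.mk.eta] at e <;> rw [e] <;>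
      refine ⟨?_, ?_, ?_⟩ <;> dsimp only <;> omega

theorem pth_step (h : RStd b n f) (hb : 0 < b) (hn : 0 < n) (k : ℕ) (hk : k < b + n - 2)
    {x y : ℕ} (e : pth f k = (x, y)) :
    (pth f (k + 1) = (x, y + 1) ∧ y + 1 < n ∧ (x + 1 < b → f (x, y + 1) < f (x + 1, y))) ∨
    (pth f (k + 1) = (x + 1, y) ∧ x + 1 < b ∧ (y + 1 < n → f (x + 1, y) < f (x, y + 1))) := by
  have hm := h.pth_mem hb hn k hk.le
  rw [e] at hm
  simp only [pth, e]
  exact h.nxt_spec hm.1 hm.2.1 (by dsimp only at hm; omega)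

theorem pth_last (h : RStd b n f) (hb : 0 < b) (hn : 0 < n) :
    pth f (b + n - 2) = (b - 1, n - 1) := by
  have := h.pth_mem hb hn _ le_rfl
  ext <;> dsimp only <;> omega

theorem ge_two (h : RStd b n f) (x y : ℕ) (hx : x < b) (hy : y < n) (hxy : 0 < x + y) :
    2 ≤ f (x, y) := by
  have h1 := h.mono (x := 0) (y := 0) (Nat.zero_le x) (Nat.zero_le y) hx hy
  have h2 := h.lo 0 0 (by omega) (by omega)
  omega

theorem corner (h : RStd b n f) (hb : 0 < b) (hn : 0 < n) : f (b - 1, n - 1) = b * n := by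
  obtain ⟨x, y, hx, hy, e⟩ := h.surj (b * n) (Nat.mul_pos hb hn) le_rfl
  have h1 := h.mono (x := x) (y := y) (x' := b - 1) (y' := n - 1) (by omega) (by omega)
    (by omega) (by omega)
  have h2 := h.hi (b - 1) (n - 1) (by omega) (by omega)
  omega

theorem origin (h : RStd b n f) (hb : 0 < b) (hn : 0 < n) : f (0, 0) = 1 := by
  obtain ⟨x, y, hx, hy, e⟩ := h.surj 1 le_rfl (Nat.mul_pos hb hn)
  have h1 := h.mono (x := 0) (y := 0) (Nat.zero_le x) (Nat.zero_le y) hx hy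
  have h2 := h.lo 0 0 (by omega) (by omega)
  omega

end RStd

/-- The partially slid filling after `k` steps. -/
def slid (f : ℕ × ℕ → ℕ) (k : ℕ) (c : ℕ × ℕ) : ℕ :=
  if pth f (c.1 + c.2) = c then
    (if c.1 + c.2 < k then f (pth f (c.1 + c.2 + 1)) - 1
     else if c.1 + c.2 = k then 0 else f c - 1)
  else f c - 1

namespace RStd

variable {b n : ℕ} {f : ℕ × ℕ → ℕ}

theorem slid_succ (h : RStd b n f) (hb : 0 < b) (hn : 0 < n) (k : ℕ) (hk : k < b + n - 2) :
    Function.update (Function.update (slid f k) (pth f (k + 1)) 0) (pth f k)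
      (slid f k (pth f (k + 1))) = slid f (k + 1) := by
  have m1 := (h.pth_mem hb hn k hk.le).2.2
  have m2 := (h.pth_mem hb hn (k + 1) hk).2.2
  funext c
  by_cases c1 : c = pth f k
  · subst c1
    rw [Function.update_self]
    simp [slid, m1, m2]
  · rw [Function.update_of_ne c1]
    by_cases c2 : c = pth f (k + 1)
    · subst c2
      rw [Function.update_self]
      simp [slid, m2]
    · rw [Function.update_of_ne c2]
      unfold slid
      by_cases c3 : pth f (c.1 + c.2) = c
      · have n1 : c.1 + c.2 ≠ k := fun e => c1 (by rw [← c3, e])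
        have n2 : c.1 + c.2 ≠ k + 1 := fun e => c2 (by rw [← c3, e])
        rw [if_pos c3, if_pos c3, if_neg n1, if_neg n2]
        by_cases c4 : c.1 + c.2 < k
        · rw [if_pos c4, if_pos (by omega)]
        · rw [if_neg c4, if_neg (by omega)]
      · rw [if_neg c3, if_neg c3]

theorem slid_later (k : ℕ) (c : ℕ × ℕ) (hc : k < c.1 + c.2) : slid f k c = f c - 1 := by
  unfold slid
  split_ifs <;> first | rfl | omega

theorem jdt_eq (h : RStd b n f) (hb : 0 < b) (hn : 0 < n) (m : ℕ) :
    ∀ k, k ≤ b + n - 2 → b + n - 2 ≤ k + m →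
    jdtSlide m (slid f k) (pth f k) = (slid f (b + n - 2), (b - 1, n - 1)) := by
  induction m with
  | zero =>
    intro k h1 h2
    have : k = b + n - 2 := by omega
    subst this
    simp [jdtSlide, h.pth_last hb hn]
  | succ m ih =>
    intro k h1 h2
    rcases e : pth f k with ⟨x, y⟩
    have hm := h.pth_mem hb hn k h1
    rw [e] at hm
    dsimp only at hm
    obtain ⟨hx, hy, hk⟩ := hm
    have er : slid f k (x, y + 1) = f (x, y + 1) - 1 := slid_later _ _ (by dsimp only; omega)
    have ed : slid f k (x + 1, y) = f (x + 1, y) - 1 := slid_later _ _ (by dsimp only; omega)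
    rw [jdtSlide]
    dsimp only
    by_cases hl : k = b + n - 2
    · have z1 := h.off x (y + 1) (by omega)
      have z2 := h.off (x + 1) y (by omega)
      rw [if_pos (by rw [er, ed, z1, z2]; simp)]
      rw [← e, hl, h.pth_last hb hn]
    · have hk' : k < b + n - 2 := by omega
      have ss := h.slid_succ hb hn k hk'
      have IH := ih (k + 1) hk' (by omega)
      have g1 : f (x, y + 1) = 0 ∨ 2 ≤ f (x, y + 1) := by
        by_cases q : y + 1 < n
        · right; exact h.ge_two _ _ hx q (by omega)
        · left; exact h.off _ _ (by omega)
      have g2 : f (x + 1, y) = 0 ∨ 2 ≤ f (x + 1, y) := by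
        by_cases q : x + 1 < b
        · right; exact h.ge_two _ _ q hy (by omega)
        · left; exact h.off _ _ (by omega)
      have g3 : ¬ (f (x, y + 1) = 0 ∧ f (x + 1, y) = 0) := by
        rintro ⟨q1, q2⟩
        by_cases q : x + 1 < b
        · have := h.lo _ _ q hy; omega
        · have := h.lo x (y + 1) hx (by omega); omega
      rw [if_neg (by omega)]
      have en : pth f (k + 1) = nxt f (x, y) := by rw [pth, e]
      unfold nxt at en
      dsimp only at en
      rw [e] at ss
      by_cases q : f (x + 1, y) = 0 ∨ (f (x, y + 1) ≠ 0 ∧ f (x, y + 1) < f (x + 1, y))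
      · rw [if_pos q] at en
        rw [if_pos (by omega)]
        rw [en] at ss IH
        rw [ss, IH]
      · rw [if_neg q] at en
        rw [if_neg (by omega)]
        rw [en] at ss IH
        rw [ss, IH]

theorem prom_eq (h : RStd b n f) (hb : 0 < b) (hn : 0 < n) :
    promote (b * n) f = Function.update (slid f (b + n - 2)) (b - 1, n - 1) (b * n) := by
  have e : (fun c => f c - 1) = slid f 0 := by
    funext c
    unfold slid
    split_ifs with h1 h2 h3
    · omega
    · have : c = (0, 0) := by ext <;> dsimp only <;> omega
      rw [this, h.origin hb hn]
    · rfl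
    · rfl
  have hL : b + n - 2 ≤ 0 + b * n := by
    obtain ⟨b, rfl⟩ := Nat.exists_eq_succ_of_ne_zero hb.ne'
    obtain ⟨n, rfl⟩ := Nat.exists_eq_succ_of_ne_zero hn.ne'
    have : (b + 1) * (n + 1) = b * n + b + n + 1 := by ring
    simp only [Nat.succ_eq_add_one]
    omega
  have := h.jdt_eq hb hn (b * n) 0 (by omega) hL
  unfold promote
  rw [e]
  rw [pth] at this
  rw [this]

theorem prom_corner (h : RStd b n f) (hb : 0 < b) (hn : 0 < n) :
    promote (b * n) f (b - 1, n - 1) = b * n := by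
  rw [h.prom_eq hb hn, Function.update_self]

theorem prom_path (h : RStd b n f) (hb : 0 < b) (hn : 0 < n) (k : ℕ) (hk : k < b + n - 2) :
    promote (b * n) f (pth f k) = f (pth f (k + 1)) - 1 := by
  have m1 := (h.pth_mem hb hn k hk.le).2.2
  rw [h.prom_eq hb hn, Function.update_of_ne]
  · simp [slid, m1, hk]
  · intro e
    rw [e] at m1
    dsimp only at m1
    omega

theorem prom_off (h : RStd b n f) (hb : 0 < b) (hn : 0 < n) (x y : ℕ)
    (hp : pth f (x + y) ≠ (x, y)) : promote (b * n) f (x, y) = f (x, y) - 1 := by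
  rw [h.prom_eq hb hn, Function.update_of_ne]
  · unfold slid
    rw [if_neg hp]
  · intro e
    apply hp
    rw [e]
    simp only [Prod.mk.injEq] at e
    rw [← h.pth_last hb hn]
    congr 1
    omega

/-- `promote` of cells, in three cases. -/
theorem prom_cases (h : RStd b n f) (hb : 0 < b) (hn : 0 < n) (x y : ℕ) (hx : x < b) (hy : y < n) :
    (x = b - 1 ∧ y = n - 1 ∧ promote (b * n) f (x, y) = b * n) ∨
    (x + y < b + n - 2 ∧ pth f (x + y) = (x, y) ∧ pth f (x + y + 1) = (x, y + 1) ∧ y + 1 < n ∧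
      (x + 1 < b → f (x, y + 1) < f (x + 1, y)) ∧
      promote (b * n) f (x, y) + 1 = f (x, y + 1)) ∨
    (x + y < b + n - 2 ∧ pth f (x + y) = (x, y) ∧ pth f (x + y + 1) = (x + 1, y) ∧ x + 1 < b ∧
      (y + 1 < n → f (x + 1, y) < f (x, y + 1)) ∧
      promote (b * n) f (x, y) + 1 = f (x + 1, y)) ∨
    (x + y < b + n - 2 ∧ pth f (x + y) ≠ (x, y) ∧ 0 < x + y ∧
      promote (b * n) f (x, y) + 1 = f (x, y)) := by
  by_cases hc : x + y = b + n - 2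
  · left
    have e1 : x = b - 1 := by omega
    have e2 : y = n - 1 := by omega
    exact ⟨e1, e2, by rw [e1, e2]; exact h.prom_corner hb hn⟩
  · right
    have hc' : x + y < b + n - 2 := by omega
    by_cases hp : pth f (x + y) = (x, y)
    · have pp := h.prom_path hb hn _ hc'
      rw [hp] at pp
      rcases h.pth_step hb hn _ hc' hp with ⟨e, h1, h2⟩ | ⟨e, h1, h2⟩
      · left
        rw [e] at pp
        have := h.lo x (y + 1) hx h1
        exact ⟨hc', hp, e, h1, h2, by omega⟩
      · right; left
        rw [e] at pp
        have := h.lo (x + 1) y h1 hy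
        exact ⟨hc', hp, e, h1, h2, by omega⟩
    · right; right
      have pp := h.prom_off hb hn _ _ hp
      have := h.lo x y hx hy
      refine ⟨hc', hp, ?_, by omega⟩
      by_contra h0
      apply hp
      have e1 : x = 0 := by omega
      have e2 : y = 0 := by omega
      subst e1 e2
      rfl

theorem prom_ge (h : RStd b n f) (hb : 0 < b) (hn : 0 < n) (x y : ℕ) (hx : x < b) (hy : y < n) :
    f (x, y) ≤ promote (b * n) f (x, y) + 1 ∧
    (pth f (x + y) = (x, y) → f (x, y) ≤ promote (b * n) f (x, y)) := by
  have h0 := h.hi x y hx hy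
  rcases h.prom_cases hb hn x y hx hy with ⟨_, _, e⟩ | ⟨_, _, _, h1, _, e⟩ | ⟨_, _, _, h1, _, e⟩ |
    ⟨_, h1, _, e⟩
  · omega
  · have := h.row x y hx h1; omega
  · have := h.col x y h1 hy; omega
  · exact ⟨by omega, fun q => absurd q h1⟩

/-- Every value `v < N` of the promotion comes from the value `v + 1`. -/
theorem prom_src (h : RStd b n f) (hb : 0 < b) (hn : 0 < n) (x y : ℕ) (hx : x < b) (hy : y < n)
    (h0 : 0 < x + y) :
    (pth f (x + y) ≠ (x, y) ∧ promote (b * n) f (x, y) + 1 = f (x, y)) ∨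
    (pth f (x + y) = (x, y) ∧ ∃ y', y = y' + 1 ∧ pth f (x + y') = (x, y') ∧
      (x + 1 < b → f (x, y) < f (x + 1, y')) ∧ promote (b * n) f (x, y') + 1 = f (x, y)) ∨
    (pth f (x + y) = (x, y) ∧ ∃ x', x = x' + 1 ∧ pth f (x' + y) = (x', y) ∧
      (y + 1 < n → f (x, y) < f (x', y + 1)) ∧ promote (b * n) f (x', y) + 1 = f (x, y)) := by
  by_cases hp : pth f (x + y) = (x, y)
  · right
    obtain ⟨k, hk⟩ : ∃ k, x + y = k + 1 := ⟨x + y - 1, by omega⟩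
    have hk' : k < b + n - 2 := by omega
    have hm := h.pth_mem hb hn k hk'.le
    have pp := h.prom_path hb hn k hk'
    have hp' := hp
    rw [hk] at hp
    rcases e : pth f k with ⟨u, v⟩
    rw [e] at hm pp
    dsimp only at hm
    have hl := h.lo x y hx hy
    rcases h.pth_step hb hn k hk' e with ⟨e1, h1, h2⟩ | ⟨e1, h1, h2⟩
    · rw [e1] at hp pp
      simp only [Prod.mk.injEq] at hp
      obtain ⟨rfl, rfl⟩ := hp
      left
      refine ⟨hp', v, rfl, ?_, h2, by omega⟩
      rw [← e]; congr 1; omega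
    · rw [e1] at hp pp
      simp only [Prod.mk.injEq] at hp
      obtain ⟨rfl, rfl⟩ := hp
      right
      refine ⟨hp', u, rfl, ?_, h2, by omega⟩
      rw [← e]; congr 1; omega
  · left
    have pp := h.prom_off hb hn _ _ hp
    have := h.lo x y hx hy
    exact ⟨hp, by omega⟩

theorem prom (h : RStd b n f) (hb : 0 < b) (hn : 0 < n) : RStd b n (promote (b * n) f) := by
  have hlt : ∀ x y, x < b → y < n → 1 ≤ f (x, y) ∧ f (x, y) ≤ b * n := fun x y hx hy =>
    ⟨h.lo x y hx hy, h.hi x y hx hy⟩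
  refine ⟨?_, ?_, ?_, ?_, ?_, ?_, ?_⟩
  · intro x y hxy
    rw [h.prom_eq hb hn, Function.update_of_ne]
    · have z := h.off x y hxy
      unfold slid
      dsimp only
      split_ifs with h1 h2 h3
      · have := h.pth_mem hb hn _ h2.le
        rw [h1] at this
        exact absurd ⟨this.1, this.2.1⟩ hxy
      · rfl
      · omega
      · omega
    · intro e
      simp only [Prod.mk.injEq] at e
      omega
  · intro x y hx hy
    rcases h.prom_cases hb hn x y hx hy with ⟨_, _, e⟩ | ⟨_, _, _, h1, _, e⟩ |
      ⟨_, _, _, h1, _, e⟩ | ⟨_, h1, h2, e⟩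
    · have := hlt x y hx hy; omega
    · have := h.ge_two _ _ hx h1 (by omega); omega
    · have := h.ge_two _ _ h1 hy (by omega); omega
    · have := h.ge_two _ _ hx hy h2; omega
  · intro x y hx hy
    rcases h.prom_cases hb hn x y hx hy with ⟨_, _, e⟩ | ⟨_, _, _, h1, _, e⟩ |
      ⟨_, _, _, h1, _, e⟩ | ⟨_, h1, h2, e⟩
    · omega
    · have := hlt _ _ hx h1; omega
    · have := hlt _ _ h1 hy; omega
    · have := hlt _ _ hx hy; omega
  · intro x y x' y' hx hy hx' hy' e
    rcases h.prom_cases hb hn x y hx hy with ⟨_, _, e1⟩ | ⟨_, a1, a2, h1, _, e1⟩ |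
      ⟨_, a1, a2, h1, _, e1⟩ | ⟨_, a1, a2, e1⟩ <;>
    rcases h.prom_cases hb hn x' y' hx' hy' with ⟨_, _, e2⟩ | ⟨_, b1, b2, h2, _, e2⟩ |
      ⟨_, b1, b2, h2, _, e2⟩ | ⟨_, b1, b2, e2⟩
    · omega
    · have := hlt _ _ hx' h2; omega
    · have := hlt _ _ h2 hy'; omega
    · have := hlt _ _ hx' hy'; omega
    · have := hlt _ _ hx h1; omega
    · have := h.inj _ _ _ _ hx h1 hx' h2 (by omega); omega
    · have := h.inj _ _ _ _ hx h1 h2 hy' (by omega)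
      have q : x + y = x' + y' := by omega
      rw [q, b1] at a1; simpa [eq_comm] using a1
    · have := h.inj _ _ _ _ hx h1 hx' hy' (by omega)
      exfalso; apply b1
      rw [← this.1, ← this.2, ← a2]; rfl
    · have := hlt _ _ h1 hy; omega
    · have := h.inj _ _ _ _ h1 hy hx' h2 (by omega)
      have q : x + y = x' + y' := by omega
      rw [q, b1] at a1; simpa [eq_comm] using a1
    · have := h.inj _ _ _ _ h1 hy h2 hy' (by omega); omega
    · have := h.inj _ _ _ _ h1 hy hx' hy' (by omega)
      exfalso; apply b1
      rw [← this.1, ← this.2, ← a2]; congr 1; omega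
    · have := hlt _ _ hx hy; omega
    · have := h.inj _ _ _ _ hx hy hx' h2 (by omega)
      exfalso; apply a1
      rw [this.1, this.2, ← b2]; rfl
    · have := h.inj _ _ _ _ hx hy h2 hy' (by omega)
      exfalso; apply a1
      rw [this.1, this.2, ← b2]; congr 1; omega
    · exact h.inj _ _ _ _ hx hy hx' hy' (by omega)
  · intro v hv hv'
    by_cases q : v = b * n
    · exact ⟨b - 1, n - 1, by omega, by omega, by rw [h.prom_corner hb hn, q]⟩
    · obtain ⟨x, y, hx, hy, e⟩ := h.surj (v + 1) (by omega) (by omega)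
      have h0 : 0 < x + y := by
        by_contra h0
        have e1 : x = 0 := by omega
        have e2 : y = 0 := by omega
        rw [e1, e2, h.origin hb hn] at e
        omega
      rcases h.prom_src hb hn x y hx hy h0 with ⟨_, e1⟩ | ⟨_, y', _, _, _, e1⟩ |
        ⟨_, x', _, _, _, e1⟩
      · exact ⟨x, y, hx, hy, by omega⟩
      · exact ⟨x, y', hx, by omega, by omega⟩
      · exact ⟨x', y, by omega, hy, by omega⟩
  · intro x y hx hy
    have g := h.prom_ge hb hn x (y + 1) hx hy
    have g0 := h.row x y hx hy
    rcases h.prom_cases hb hn x y hx (by omega) with ⟨_, _, e⟩ | ⟨_, _, a, h1, _, e⟩ |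
      ⟨_, _, _, h1, h2, e⟩ | ⟨_, h1, h2, e⟩
    · omega
    · have := g.2 a; omega
    · have := h2 hy; omega
    · omega
  · intro x y hx hy
    have g := h.prom_ge hb hn (x + 1) y hx hy
    have g0 := h.col x y hx hy
    rcases h.prom_cases hb hn x y (by omega) hy with ⟨_, _, e⟩ | ⟨_, _, _, h1, h2, e⟩ |
      ⟨_, _, a, h1, h2, e⟩ | ⟨_, h1, h2, e⟩
    · omega
    · have := h2 hx; omega
    · rw [add_right_comm] at a
      have := g.2 a; omega
    · omega

theorem rowOf_eq (h : RStd b n f) {x y : ℕ} (hx : x < b) (hy : y < n) :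
    rowOf f (f (x, y)) = x := by
  unfold rowOf
  have : {a | ∃ b, f (a, b) = f (x, y)} = {x} := by
    ext a
    simp only [Set.mem_ofPred_eq, Set.mem_singleton_iff]
    constructor
    · rintro ⟨c, e⟩
      by_cases q : a < b ∧ c < n
      · exact (h.inj _ _ _ _ q.1 q.2 hx hy e).1
      · have := h.off _ _ q
        have := h.lo _ _ hx hy
        omega
    · rintro rfl
      exact ⟨y, rfl⟩
  rw [this]
  simp

theorem rowOf_eq' (h : RStd b n f) {x y v : ℕ} (hx : x < b) (hy : y < n) (e : f (x, y) = v) :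
    rowOf f v = x := by
  rw [← e]; exact h.rowOf_eq hx hy

/-- consecutive entries: descents -/
theorem consec (h : RStd b n f) {x y x' y' : ℕ} (hx : x < b) (hy : y < n) (hx' : x' < b)
    (hy' : y' < n) (e : f (x', y') = f (x, y) + 1) :
    (x < x' ∧ y' ≤ y) ∨ (x' ≤ x ∧ y < y') := by
  by_cases c : x < x'
  · left
    refine ⟨c, ?_⟩
    by_contra c2
    have := h.mono (x := x) (y := y) (x' := x') (y' := y') (by omega) (by omega) hx' hy'
    omega
  · right
    refine ⟨by omega, ?_⟩
    by_contra c2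
    have := h.mono (x := x') (y := y') (x' := x) (y' := y) (by omega) (by omega) hx hy
    omega

theorem desc_mid (h : RStd b n f) (hb : 0 < b) (hn : 0 < n) (i : ℕ) (h1 : 1 ≤ i)
    (h2 : i + 1 < b * n) :
    rowOf (promote (b * n) f) i < rowOf (promote (b * n) f) (i + 1) ↔
      rowOf f (i + 1) < rowOf f (i + 1 + 1) := by
  have hg := h.prom hb hn
  obtain ⟨x, y, hx, hy, e⟩ := h.surj (i + 1) (by omega) (by omega)
  obtain ⟨u, v, hu, hv, e'⟩ := h.surj (i + 1 + 1) (by omega) (by omega)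
  have z1 : 0 < x + y := by
    by_contra h0
    have e1 : x = 0 := by omega
    have e2 : y = 0 := by omega
    rw [e1, e2, h.origin hb hn] at e
    omega
  have z2 : 0 < u + v := by
    by_contra h0
    have e1 : u = 0 := by omega
    have e2 : v = 0 := by omega
    rw [e1, e2, h.origin hb hn] at e'
    omega
  rw [h.rowOf_eq' hx hy e, h.rowOf_eq' hu hv e']
  have C := h.consec hx hy hu hv (by omega)
  rcases h.prom_src hb hn x y hx hy z1 with ⟨p1, e1⟩ | ⟨p1, y', rfl, q1, r1, e1⟩ |
        ⟨p1, x', rfl, q1, r1, e1⟩ <;>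
  rcases h.prom_src hb hn u v hu hv z2 with ⟨p2, e2⟩ | ⟨p2, v', rfl, q2, r2, e2⟩ |
        ⟨p2, u', rfl, q2, r2, e2⟩
  · rw [hg.rowOf_eq' (v := i) hx hy (by omega), hg.rowOf_eq' (v := i + 1) hu hv (by omega)]
  · rw [hg.rowOf_eq' (v := i) hx hy (by omega),
      hg.rowOf_eq' (v := i + 1) (y := v') hu (by omega) (by omega)]
  · have D := hg.consec (x := x) (y := y) (x' := u') (y' := v) hx hy (by omega) (by omega)
      (by omega)
    rw [hg.rowOf_eq' (v := i) hx hy (by omega),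
      hg.rowOf_eq' (v := i + 1) (x := u') (y := v) (by omega) (by omega) (by omega)]
    omega
  · rw [hg.rowOf_eq' (v := i) (y := y') hx (by omega) (by omega),
      hg.rowOf_eq' (v := i + 1) hu hv (by omega)]
  · rw [hg.rowOf_eq' (v := i) (y := y') hx (by omega) (by omega),
      hg.rowOf_eq' (v := i + 1) (y := v') hu (by omega) (by omega)]
  · have D := hg.consec (x := x) (y := y') (x' := u') (y' := v) hx (by omega) (by omega) (by omega)
      (by omega)
    rw [hg.rowOf_eq' (v := i) (y := y') hx (by omega) (by omega),
      hg.rowOf_eq' (v := i + 1) (x := u') (y := v) (by omega) (by omega) (by omega)]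
    constructor
    · omega
    · intro hh
      by_contra hc
      have a1 : u' = x := by omega
      have a2 : v = y' + 1 := by omega
      subst a1 a2
      have b1 := r1 hu
      have b2 := h.row (u' + 1) y' hu hv
      omega
  · have D := hg.consec (x := x') (y := y) (x' := u) (y' := v) (by omega) hy hu hv (by omega)
    rw [hg.rowOf_eq' (v := i) (x := x') (y := y) (by omega) (by omega) (by omega),
      hg.rowOf_eq' (v := i + 1) hu hv (by omega)]
    omega
  · have D := hg.consec (x := x') (y := y) (x' := u) (y' := v') (by omega) hy hu (by omega)
      (by omega)
    rw [hg.rowOf_eq' (v := i) (x := x') (y := y) (by omega) (by omega) (by omega),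
      hg.rowOf_eq' (v := i + 1) (y := v') hu (by omega) (by omega)]
    constructor
    · intro hh
      by_contra hc
      have a1 : u = x' + 1 := by omega
      have a2 : v' = y := by omega
      subst a1 a2
      have b1 := r1 hv
      have b2 := h.col x' (v' + 1) hx hv
      omega
    · omega
  · rw [hg.rowOf_eq' (v := i) (x := x') (y := y) (by omega) (by omega) (by omega),
      hg.rowOf_eq' (v := i + 1) (x := u') (y := v) (by omega) (by omega) (by omega)]
    omega

/-- If the first path starts down, the second path stays weakly above. -/
theorem inv_down (h : RStd b n f) (hb : 0 < b) (hn : 0 < n) (h0 : (pth f 1).1 = 1) (k : ℕ)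
    (hk : k < b + n - 2) :
    (pth (promote (b * n) f) k).1 < (pth f k).1 ∨
    ((pth (promote (b * n) f) k).1 = (pth f k).1 ∧ (pth f (k + 1)).1 = (pth f k).1 + 1) := by
  have hg := h.prom hb hn
  induction k with
  | zero => right; simpa [pth] using h0
  | succ k ih =>
    have ih := ih (by omega)
    have m1 := h.pth_mem hb hn k (by omega)
    have m2 := hg.pth_mem hb hn k (by omega)
    rcases e1 : pth f k with ⟨x, y⟩
    rcases e2 : pth (promote (b * n) f) k with ⟨u, v⟩
    rw [e1] at m1
    rw [e2] at m2
    rw [e1, e2] at ih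
    dsimp only at m1 m2 ih
    obtain ⟨hx, hy, hxy⟩ := m1
    obtain ⟨hu, hv, huv⟩ := m2
    have s1 := h.pth_step hb hn k (by omega) e1
    have s2 := hg.pth_step hb hn k (by omega) e2
    rcases s2 with ⟨e4, h4, g4⟩ | ⟨e4, h4, g4⟩
    · -- second path goes right
      rw [e4]
      rcases s1 with ⟨e3, h3, g3⟩ | ⟨e3, h3, g3⟩
      · rw [e3] at ih ⊢
        dsimp only at ih ⊢
        left; omega
      · rw [e3]
        dsimp only
        left; omega
    · rw [e4]
      have pp := h.prom_path hb hn (k + 1) hk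
      rcases s1 with ⟨e3, h3, g3⟩ | ⟨e3, h3, g3⟩
      · -- first path right, second down
        have s3 := h.pth_step hb hn (k + 1) hk e3
        rw [e3] at ih pp ⊢
        dsimp only at ih ⊢
        rcases s3 with ⟨e5, h5, g5⟩ | ⟨e5, h5, g5⟩
        · by_cases c : u + 1 < x
          · left; exact c
          exfalso
          have a1 : x = u + 1 := by omega
          have a2 : v = y + 1 := by omega
          subst a1 a2
          rw [e5] at pp
          have po := h.prom_off hb hn u (y + 1 + 1) (by
            have : u + (y + 1 + 1) = k + 1 := by omega
            rw [this, e3]; simp)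
          have := g4 h5
          have := h.col u (y + 1 + 1) hx h5
          have := h.lo u (y + 1 + 1) hu h5
          omega
        · rw [e5]; dsimp only; omega
      · -- both down
        have s3 := h.pth_step hb hn (k + 1) hk e3
        rw [e3] at ih pp ⊢
        dsimp only at ih ⊢
        rcases s3 with ⟨e5, h5, g5⟩ | ⟨e5, h5, g5⟩
        · by_cases c : u < x
          · left; omega
          exfalso
          have a1 : x = u := by omega
          have a2 : v = y := by omega
          subst a1 a2
          rw [e5] at pp
          have po := h.prom_off hb hn x (v + 1) (by
            have : x + (v + 1) = k + 1 := by omega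
            rw [this, e3]; simp)
          have := g4 h5
          have := h.col x (v + 1) h4 h5
          have := h.lo x (v + 1) hu h5
          omega
        · rw [e5]; dsimp only; omega

/-- If the first path starts right, the second path stays weakly left. -/
theorem inv_right (h : RStd b n f) (hb : 0 < b) (hn : 0 < n) (h0 : (pth f 1).2 = 1) (k : ℕ)
    (hk : k < b + n - 2) :
    (pth (promote (b * n) f) k).2 < (pth f k).2 ∨
    ((pth (promote (b * n) f) k).2 = (pth f k).2 ∧ (pth f (k + 1)).2 = (pth f k).2 + 1) := by
  have hg := h.prom hb hn
  induction k with
  | zero => right; simpa [pth] using h0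
  | succ k ih =>
    have ih := ih (by omega)
    have m1 := h.pth_mem hb hn k (by omega)
    have m2 := hg.pth_mem hb hn k (by omega)
    rcases e1 : pth f k with ⟨x, y⟩
    rcases e2 : pth (promote (b * n) f) k with ⟨u, v⟩
    rw [e1] at m1
    rw [e2] at m2
    rw [e1, e2] at ih
    dsimp only at m1 m2 ih
    obtain ⟨hx, hy, hxy⟩ := m1
    obtain ⟨hu, hv, huv⟩ := m2
    have s1 := h.pth_step hb hn k (by omega) e1
    have s2 := hg.pth_step hb hn k (by omega) e2
    rcases s2 with ⟨e4, h4, g4⟩ | ⟨e4, h4, g4⟩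
    · rw [e4]
      have pp := h.prom_path hb hn (k + 1) hk
      rcases s1 with ⟨e3, h3, g3⟩ | ⟨e3, h3, g3⟩
      · -- both right
        have s3 := h.pth_step hb hn (k + 1) hk e3
        rw [e3] at ih pp ⊢
        dsimp only at ih ⊢
        rcases s3 with ⟨e5, h5, g5⟩ | ⟨e5, h5, g5⟩
        · rw [e5]; dsimp only; omega
        · by_cases c : v < y
          · left; omega
          exfalso
          have a1 : x = u := by omega
          have a2 : v = y := by omega
          subst a1 a2
          rw [e5] at pp
          have po := h.prom_off hb hn (x + 1) v (by
            have : x + 1 + v = k + 1 := by omega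
            rw [this, e3]; simp)
          have := g4 h5
          have := h.row (x + 1) v h5 h4
          have := h.lo (x + 1) v h5 hv
          omega
      · -- first path down, second right
        have s3 := h.pth_step hb hn (k + 1) hk e3
        rw [e3] at ih pp ⊢
        dsimp only at ih ⊢
        rcases s3 with ⟨e5, h5, g5⟩ | ⟨e5, h5, g5⟩
        · rw [e5]; dsimp only; omega
        · by_cases c : v + 1 < y
          · left; exact c
          exfalso
          have a1 : y = v + 1 := by omega
          have a2 : u = x + 1 := by omega
          subst a1 a2
          rw [e5] at pp
          have po := h.prom_off hb hn (x + 1 + 1) v (by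
            have : x + 1 + 1 + v = k + 1 := by omega
            rw [this, e3]; simp)
          have := g4 h5
          have := h.row (x + 1 + 1) v h5 hy
          have := h.lo (x + 1 + 1) v h5 hv
          omega
    · -- second path goes down
      rw [e4]
      rcases s1 with ⟨e3, h3, g3⟩ | ⟨e3, h3, g3⟩
      · rw [e3]
        dsimp only
        left; omega
      · rw [e3] at ih ⊢
        dsimp only at ih ⊢
        left; omega

theorem desc_zero (h : RStd b n f) (hb : 0 < b) (hn : 0 < n) (hN : 2 ≤ b * n) :
    rowOf (promote (b * n) (promote (b * n) f)) (b * n - 1) <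
      rowOf (promote (b * n) (promote (b * n) f)) (b * n) ↔ rowOf f 1 < rowOf f (1 + 1) := by
  have hg := h.prom hb hn
  have hgg := hg.prom hb hn
  have hL : 0 < b + n - 2 := by
    by_contra hc
    have e1 : b = 1 := by omega
    have e2 : n = 1 := by omega
    subst e1 e2
    omega
  obtain ⟨k, hk⟩ : ∃ k, b + n - 2 = k + 1 := ⟨b + n - 2 - 1, by omega⟩
  have hk' : k < b + n - 2 := by omega
  have m := hg.pth_mem hb hn k hk'.le
  have pp := hg.prom_path hb hn k hk'
  rw [← hk, hg.pth_last hb hn, hg.corner hb hn] at pp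
  have r1 := hgg.rowOf_eq' m.1 m.2.1 pp
  have r2 := hgg.rowOf_eq' (x := b - 1) (y := n - 1) (by omega) (by omega) (hgg.corner hb hn)
  have r3 := h.rowOf_eq' (x := 0) (y := 0) hb hn (h.origin hb hn)
  have m1 := h.pth_mem hb hn 1 (by omega)
  have pp1 := h.prom_path hb hn 0 hL
  rw [pth, hg.origin hb hn] at pp1
  have r4 := h.rowOf_eq' (v := 1 + 1) m1.1 m1.2.1 (by
    simp only [zero_add] at pp1
    rw [Prod.mk.eta]; omega)
  rw [r1, r2, r3, r4]
  have mk := h.pth_mem hb hn k hk'.le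
  have ml := h.pth_last hb hn
  rw [hk] at ml
  constructor
  · intro q
    by_contra c
    have := h.inv_right hb hn (by omega) k hk'
    rw [ml] at this
    dsimp only at this
    omega
  · intro q
    have := h.inv_down hb hn (by omega) k hk'
    rw [ml] at this
    dsimp only at this
    omega

end RStd

/-- (Rhoades, Lemma 3.3.)  For a standard Young tableau `T` of rectangular shape with `N`
boxes, the cyclic descent set shifts cyclically under promotion:
`D(p(T)) = {i - 1 (mod N) : i ∈ D(T)}`, as subsets of `ℤ/Nℤ`. -/
theorem cyclic_descents_shift_under_promotion
    (b n : ℕ) (f : (ℕ × ℕ) → ℕ)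
    (hf : IsStdFilling (strCell (rectShape b n)) (b * n) f) :
    ((↑) '' tabCycDes (b * n) (promote (b * n) f) : Set (ZMod (b * n))) =
      (fun x => x - 1) '' ((↑) '' tabCycDes (b * n) f) := by
  have h := rstd_of hf
  rcases Nat.eq_zero_or_pos (b * n) with hN | hN
  · have : ∀ g, tabCycDes (b * n) g = ∅ := by
      intro g
      rw [hN]
      simp [tabCycDes]
    rw [this, this]; simp
  have hb : 0 < b := Nat.pos_of_mul_pos_right hN
  have hn : 0 < n := Nat.pos_of_mul_pos_left hN
  have hg := h.prom hb hn
  rcases Nat.lt_or_ge (b * n) 2 with h2 | h2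
  · have h1 : b * n = 1 := by omega
    have key : ∀ g, RStd b n g → tabCycDes (b * n) g = ∅ := by
      intro g hg
      have r := (hg.prom hb hn).rowOf_eq' (x := 0) (y := 0) hb hn ((hg.prom hb hn).origin hb hn)
      rw [h1] at r ⊢
      ext i
      simp only [tabCycDes, Set.mem_union, Set.mem_ofPred_eq, Set.mem_empty_iff_false, iff_false]
      omega
    rw [key _ h, key _ hg]; simp
  have dm := h.desc_mid hb hn
  have dz := h.desc_zero hb hn h2
  generalize hNN : b * n = N at *
  have A : ∀ i, i + 1 < N → (i ∈ tabCycDes N (promote N f) ↔ i + 1 ∈ tabCycDes N f) := by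
    intro i hi
    simp only [tabCycDes, Set.mem_union, Set.mem_ofPred_eq]
    rcases Nat.eq_zero_or_pos i with rfl | h0
    · constructor
      · rintro (⟨q, _⟩ | ⟨_, q⟩)
        · omega
        · exact Or.inl ⟨by omega, hi, dz.1 q⟩
      · rintro (⟨_, _, q⟩ | ⟨q, _⟩)
        · exact Or.inr ⟨rfl, dz.2 q⟩
        · omega
    · have := dm i h0 hi
      omega
  have B : N - 1 ∈ tabCycDes N (promote N f) ↔ 0 ∈ tabCycDes N f := by
    simp only [tabCycDes, Set.mem_union, Set.mem_ofPred_eq]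
    have : N - 1 + 1 = N := by omega
    rw [this]
    constructor
    · rintro (⟨_, _, q⟩ | ⟨q, _⟩)
      · exact Or.inr ⟨trivial, q⟩
      · omega
    · rintro (⟨q, _⟩ | ⟨_, q⟩)
      · omega
      · exact Or.inl ⟨by omega, by omega, q⟩
  have cN : ((N - 1 : ℕ) : ZMod N) = 0 - 1 := by
    rw [Nat.cast_sub (by omega)]; simp
  have lt : ∀ g i, i ∈ tabCycDes N g → i < N := by
    intro g i
    simp only [tabCycDes, Set.mem_union, Set.mem_ofPred_eq]
    omega
  ext z
  simp only [Set.mem_image, exists_exists_and_eq_and]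
  constructor
  · rintro ⟨i, hi, rfl⟩
    have := lt _ _ hi
    by_cases c : i + 1 < N
    · exact ⟨i + 1, (A i c).1 hi, by push_cast; ring⟩
    · have e : i = N - 1 := by omega
      subst e
      exact ⟨0, B.1 hi, by rw [cN]; simp⟩
  · rintro ⟨i, hi, rfl⟩
    have := lt _ _ hi
    rcases i with _ | i
    · exact ⟨N - 1, B.2 hi, by rw [cN]; simp⟩
    · exact ⟨i, (A i this).2 hi, by push_cast; ring⟩
end

section
/- Let w_0 be the longest element of the type B_n Coxeter group and R(w_0) its set of reduced words. Then Σ_{w ∈ R(w_0)} q^{maj(w)} = q^{n·binom(n,2)} · [n²]_q! / ([n]_q^n Π_{i=1}^{n−1} ([i]_q · [2n−i]_q)^i); that is, the major index generating function of R(w_0) equals, up to the shift q^{n·binom(n,2)}, the q-analogue of the hook length formula for the n×n square Young diagram. -/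
/-! ### Words, crystal operators, and the major index -/

/-- The position (if any) of the rightmost letter `j` of `w` that is unpaired in the
bracket pairing of the letters `j+1` (opening brackets) and `j` (closing brackets) of `w`. -/
def unpairedPos (j : ℕ) (w : List ℕ) : Option ℕ :=
  (((List.range w.length).zip w).foldl
    (fun (s : ℕ × Option ℕ) p =>
      if p.2 = j + 1 then (s.1 + 1, s.2)
      else if p.2 = j then (if 0 < s.1 then (s.1 - 1, s.2) else (0, some p.1))
      else s)
    (0, none)).2

/-- The crystal raising operator `e_j` on words: in the subword of `w` formed by the letters
`j` and `j+1`, pair each `j+1` (opening bracket) with a `j` (closing bracket); the unpaired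
letters form a subword `j^r (j+1)^s`, and `e_j` changes this subword into
`j^(r-1) (j+1)^(s+1)`, i.e. it turns the last unpaired `j` into a `j+1`, leaving the rest
of `w` unchanged.  (If `r = 0`, we let `e_j` fix `w`.) -/
def cryE (j : ℕ) (w : List ℕ) : List ℕ :=
  match unpairedPos j w with
  | none => w
  | some i => w.set i (j + 1)

/-- The composite operator `ē = e_1 ∘ e_2 ∘ ⋯ ∘ e_(n-1)` (applying `e_(n-1)` first). -/
def cryEbar (n : ℕ) (w : List ℕ) : List ℕ :=
  (List.range (n - 1)).reverse.foldl (fun v i => cryE (i + 1) v) w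

/-- A square word of order `n`: a word with exactly `n` copies of each of the letters
`1, …, n` (and no other letters), such that every initial segment contains at least as
many letters `j+1` as letters `j`, for every `j`. -/
def IsSquareWord (n : ℕ) (w : List ℕ) : Prop :=
  w.length = n * n ∧
  (∀ j, 1 ≤ j → j ≤ n → w.count j = n) ∧
  (∀ k j, 1 ≤ j → j < n → (w.take k).count j ≤ (w.take k).count (j + 1))

/-- The major index of a word `v = v_1 v_2 ⋯ v_l`: the sum of the descent positions,
i.e. of the positions `i` (`1 ≤ i ≤ l - 1`) such that `v_i > v_(i+1)`. -/
def majW (v : List ℕ) : ℕ :=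
  ∑ i ∈ Finset.range v.length, if 0 < i ∧ v.getD i 0 < v.getD (i-1) 0 then i else 0

/-! ### `q`-analogues, as polynomials with integer coefficients -/

open Polynomial in
/-- The `q`-integer `[m]_q = 1 + q + ⋯ + q^(m-1)`, as a polynomial in `ℤ[q]`. -/
noncomputable def qInt (m : ℕ) : Polynomial ℤ := ∑ k ∈ Finset.range m, Polynomial.X ^ k

/-- The `q`-factorial `[N]_q! = [N]_q [N-1]_q ⋯ [1]_q`. -/
noncomputable def qFact (N : ℕ) : Polynomial ℤ := ∏ m ∈ Finset.range N, qInt (m + 1)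

open Polynomial in
/-- The `q`-analogue of the hook length formula for the `n × n` square Young diagram,
`[n²]_q! / ([n]_q^n · ∏_(i=1)^(n-1) ([i]_q [2n-i]_q)^i)`.
(The division is exact; it is expressed by `Polynomial.divByMonic`, the divisor being
a monic polynomial.) -/
noncomputable def qHookSquare (n : ℕ) : Polynomial ℤ :=
  qFact (n ^ 2) /ₘ ((qInt n) ^ n * ∏ i ∈ Finset.Icc 1 (n - 1), (qInt i * qInt (2 * n - i)) ^ i)


set_option linter.unusedSectionVars false
set_option linter.unusedSimpArgs false

namespace BW

/-! ### Part 1: a combinatorial symmetry lemma for functions on words -/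

/-- Signed sum of differences attached to the first two letters. -/
def gg (c : List ℕ → ℚ) (x y : ℕ) (r : List ℕ) : ℚ :=
  ∑ t ∈ Finset.range (x + 1), (c ((x + 1 - t) :: (y + t) :: r) - c ((y + t) :: (x + 1 - t) :: r))

def GG (c : List ℕ → ℚ) : List ℕ → ℚ
  | x :: y :: r => gg c x y r
  | _ => 0

structure Hyp (c : List ℕ → ℚ) (m : ℕ) : Prop where
  cyc : ∀ x r, r.length + 1 = m → c (x :: r) = c (r ++ [x])
  zero : ∀ l r, r.length + 2 = m → c (0 :: l :: r) = c (l :: 0 :: r)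
  rel : ∀ β : List ℕ, β.length = m → ∑ i ∈ Finset.range m, GG c (β.rotate i) = 0

lemma cyc_append {c : List ℕ → ℚ} {m : ℕ} (h : ∀ x r, r.length + 1 = m → c (x :: r) = c (r ++ [x]))
    (a : List ℕ) : ∀ b : List ℕ, a.length + b.length = m → c (a ++ b) = c (b ++ a) := by
  induction a with
  | nil => intro b _; simp
  | cons x a ih =>
    intro b hb
    rw [List.cons_append, h x (a ++ b) (by simp at hb ⊢; omega), List.append_assoc,
      ih (b ++ [x]) (by simp at hb ⊢; omega)]
    simp

def SymMem (c : List ℕ → ℚ) (m j : ℕ) : Prop :=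
  ∀ l l' : List ℕ, l.Perm l' → l.length = m → j ∈ l → c l = c l'

lemma symMem_of {c : List ℕ → ℚ} {m : ℕ} (h : ∀ x r, r.length + 1 = m → c (x :: r) = c (r ++ [x]))
    (j : ℕ) (hs : ∀ r r' : List ℕ, r.Perm r' → r.length + 1 = m → c (j :: r) = c (j :: r')) :
    SymMem c m j := by
  intro l l' hp hl hj
  obtain ⟨a, b, rfl⟩ := List.append_of_mem hj
  obtain ⟨a', b', rfl⟩ := List.append_of_mem (hp.subset hj)
  have hl' := hp.length_eq
  rw [cyc_append h a (j :: b) (by simpa using hl), cyc_append h a' (j :: b')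
    (by simp at hl hl' ⊢; omega)]
  rw [List.cons_append, List.cons_append]
  apply hs
  · have : (j :: (b ++ a)).Perm (j :: (b' ++ a')) := by
      refine List.Perm.trans ?_ (hp.trans ?_)
      · simpa using (List.perm_append_comm (l₁ := j :: b) (l₂ := a))
      · simpa using (List.perm_append_comm (l₁ := a') (l₂ := j :: b'))
    exact (List.perm_cons j).1 this
  · simp at hl ⊢; omega

lemma gg_mem {c : List ℕ → ℚ} {m j : ℕ} (hs : SymMem c m j) (x y : ℕ) (r : List ℕ)
    (hr : r.length + 2 = m) (hj : j ∈ r) : gg c x y r = 0 := by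
  unfold gg
  apply Finset.sum_eq_zero
  intro t _
  rw [hs _ _ (List.Perm.swap _ _ _) (by simpa using hr) (by simp [hj]), sub_self]

lemma gg_last {c : List ℕ → ℚ} {m k : ℕ} (h : Hyp c m) (hs : ∀ j < k, SymMem c m j)
    (z : ℕ) (r : List ℕ) (hr : r.length + 2 = m) : gg c z k r = 0 := by
  set s := z + 1 + k with hsdef
  set d : ℕ → ℚ := fun a => c (a :: (s - a) :: r) - c ((s - a) :: a :: r) with hd
  have h1 : gg c z k r = ∑ a ∈ Finset.range (z + 1), d (a + 1) := by
    unfold gg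
    rw [← Finset.sum_range_reflect]
    apply Finset.sum_congr rfl
    intro a ha
    have ha := Finset.mem_range.1 ha
    simp only [hd]
    rw [show z + 1 - (z + 1 - 1 - a) = a + 1 by omega,
      show k + (z + 1 - 1 - a) = s - (a + 1) by omega]
  have h0 : d 0 = 0 := by
    simp only [hd]; rw [h.zero _ _ hr]; simp
  have htot : ∑ a ∈ Finset.range (s + 1), d a = 0 := by
    have := Finset.sum_range_reflect d (s + 1)
    have h2 : ∑ a ∈ Finset.range (s + 1), d (s + 1 - 1 - a) = - ∑ a ∈ Finset.range (s + 1), d a := by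
      rw [← Finset.sum_neg_distrib]
      apply Finset.sum_congr rfl
      intro a ha
      have ha := Finset.mem_range.1 ha
      simp only [hd]
      rw [show s + 1 - 1 - a = s - a by omega, show s - (s - a) = a by omega]; ring
    linarith
  rw [h1]
  have h3 : s + 1 = (z + 2) + k := by omega
  rw [h3, Finset.sum_range_add] at htot
  have h4 : ∑ x ∈ Finset.range k, d (z + 2 + x) = 0 := by
    apply Finset.sum_eq_zero
    intro x hx
    have hx := Finset.mem_range.1 hx
    simp only [hd]
    rw [hs (s - (z + 2 + x)) (by omega) _ _ (List.Perm.swap _ _ _) (by simpa using hr) (by simp),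
      sub_self]
  rw [h4, add_zero, Finset.sum_range_succ', h0, add_zero] at htot
  exact htot

lemma gg_first {c : List ℕ → ℚ} {m k : ℕ} (hs : ∀ j < k + 1, SymMem c m j)
    (y : ℕ) (r : List ℕ) (hr : r.length + 2 = m) :
    gg c k y r = c ((k + 1) :: y :: r) - c (y :: (k + 1) :: r) := by
  unfold gg
  rw [Finset.sum_range_succ', Finset.sum_eq_zero, zero_add]
  · simp
  · intro t ht
    have ht := Finset.mem_range.1 ht
    rw [hs (k + 1 - (t + 1)) (by omega) _ _ (List.Perm.swap _ _ _) (by simpa using hr) (by simp),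
      sub_self]

lemma rotate_succ_cons (k : ℕ) (γ : List ℕ) (s : ℕ) (hs : s ≤ γ.length) :
    (k :: γ).rotate (s + 1) = γ.drop s ++ k :: γ.take s := by
  rw [List.rotate_eq_drop_append_take (by simpa using hs)]
  simp

lemma periodic_sum (v : ℕ → ℚ) (p : ℕ) (hv : ∀ i, v (i + p) = v i) (s : ℕ) :
    ∑ i ∈ Finset.range p, v (i + s) = ∑ i ∈ Finset.range p, v i := by
  induction s with
  | zero => simp
  | succ s ih =>
    rw [← ih]
    have h1 := Finset.sum_range_succ (fun i => v (i + s)) p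
    have h2 := Finset.sum_range_succ' (fun i => v (i + s)) p
    have h3 : v (p + s) = v (0 + s) := by rw [add_comm p s, hv, zero_add]
    simp only [h3] at h1
    have h4 : ∀ i, i + 1 + s = i + (s + 1) := fun i => by omega
    simp only [h4] at h2
    linarith

/-- a relation obtained from `rel` for a word starting with `k`. -/
lemma rel_cons {c : List ℕ → ℚ} {m k : ℕ} (h : Hyp c m) (hs : ∀ j < k, SymMem c m j)
    (γ : List ℕ) (hγ : γ.length + 1 = m) (h2 : 2 ≤ m) :
    GG c (k :: γ) + ∑ s ∈ Finset.range (m - 2), GG c ((k :: γ).rotate (s + 1)) = 0 := by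
  have h1 := h.rel (k :: γ) (by simpa using hγ)
  obtain ⟨p, rfl⟩ : ∃ p, m = p + 2 := ⟨m - 2, by omega⟩
  rw [Finset.sum_range_succ', Finset.sum_range_succ] at h1
  have h3 : GG c ((k :: γ).rotate (p + 1)) = 0 := by
    rw [rotate_succ_cons _ _ _ (by omega)]
    have : (γ.drop p).length = 1 := by simp; omega
    obtain ⟨z, hz⟩ := List.length_eq_one_iff.1 this
    rw [hz]
    show gg c z k _ = 0
    apply gg_last h hs
    simp; omega
  rw [h3, List.rotate_zero] at h1
  simp only [Nat.add_sub_cancel]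
  linarith

theorem sym_of_hyp : ∀ (m : ℕ) (c : List ℕ → ℚ), Hyp c m →
    ∀ l l' : List ℕ, l.Perm l' → l.length = m → c l = c l' := by
  intro m
  induction m with
  | zero =>
    intro c _ l l' hp hl
    have := List.length_eq_zero_iff.1 hl
    subst this
    rw [List.nil_perm.1 hp]
  | succ m' IH =>
    intro c h
    by_cases hm : m' = 0
    · subst hm
      intro l l' hp hl
      obtain ⟨x, rfl⟩ := List.length_eq_one_iff.1 hl
      rw [List.singleton_perm.1 hp]
    have key : ∀ k, SymMem c (m' + 1) k := by
      intro k
      induction k using Nat.strong_induction_on with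
      | _ k ih =>
      -- letter k moves freely
      have free : ∀ y r, r.length + 2 = m' + 1 → c (k :: y :: r) = c (y :: k :: r) := by
        intro y r hr
        rcases k with _ | k
        · exact h.zero y r hr
        · have h1 := rel_cons h (k := k) (fun j hj => ih j (by omega)) (y :: r)
            (by simpa using hr) (by omega)
          rw [Finset.sum_eq_zero, add_zero] at h1
          · have h2 := gg_first (k := k) ih y r hr
            have h3 : gg c k y r = 0 := h1
            rw [h3] at h2
            linarith
          · intro s hs
            have hs := Finset.mem_range.1 hs
            rw [rotate_succ_cons _ _ _ (by simp; omega)]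
            have hlen : ((y :: r).drop s).length = r.length + 1 - s := by simp
            rcases hdr : (y :: r).drop s with _ | ⟨a, _ | ⟨b, t⟩⟩
            · rw [hdr] at hlen; simp at hlen; omega
            · rw [hdr] at hlen; simp at hlen; omega
            · show gg c a b _ = 0
              apply gg_mem (ih k (by omega))
              · rw [hdr] at hlen
                simp at hlen ⊢; omega
              · simp
      have hcyc' : ∀ x r, r.length + 1 = m' → c (k :: x :: r) = c (k :: (r ++ [x])) := by
        intro x r hr
        rw [free x r (by omega), h.cyc x (k :: r) (by simp; omega)]
        rfl
      have H' : Hyp (fun β => c (k :: β)) m' := by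
        refine ⟨hcyc', ?_, ?_⟩
        · intro l r hr
          show c (k :: 0 :: l :: r) = c (k :: l :: 0 :: r)
          rw [h.cyc k _ (by simp; omega), h.cyc k _ (by simp; omega)]
          exact h.zero l (r ++ [k]) (by simp; omega)
        · intro β hβ
          by_cases hm1 : m' = 1
          · subst hm1
            obtain ⟨x, rfl⟩ := List.length_eq_one_iff.1 hβ
            simp [GG]
          set v : ℕ → ℚ := fun i => GG (fun β => c (k :: β)) (β.rotate i) with hv
          set u : ℕ → ℚ := fun i => c ((k + 1) :: β.rotate i) with hu
          have hper : β.rotate m' = β := by rw [← hβ, List.rotate_length]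
          have main : ∀ i, u i - u (i + 1) + ∑ s ∈ Finset.range (m' - 1), v (s + i) = 0 := by
            intro i
            have h1 := rel_cons h ih (β.rotate i) (by simp [hβ]) (by omega)
            have hlenγ : (β.rotate i).length = m' := by simp [hβ]
            have e1 : GG c (k :: β.rotate i) = u i - u (i + 1) := by
              simp only [hu]
              rw [← List.rotate_rotate]
              rcases hγ : β.rotate i with _ | ⟨y, r⟩
              · rw [hγ] at hlenγ; simp at hlenγ; omega
              · rw [hγ] at hlenγ; simp at hlenγ
                show gg c k y r = _
                have hyr : gg c k y r = c ((k + 1) :: y :: r) - c (y :: (k + 1) :: r) := by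
                  unfold gg
                  rw [Finset.sum_range_succ', Finset.sum_eq_zero, zero_add]
                  · simp
                  · intro t ht
                    have ht := Finset.mem_range.1 ht
                    rcases Nat.eq_zero_or_pos t with rfl | htp
                    · have := free (y + 1) r (by omega)
                      simp only [zero_add, Nat.add_sub_cancel]
                      rw [this, sub_self]
                    · rw [ih (k + 1 - (t + 1)) (by omega) _ _ (List.Perm.swap _ _ _)
                        (by simp; omega) (by simp), sub_self]
                rw [hyr, h.cyc y _ (by simp; omega)]
                simp
            have e2 : ∑ s ∈ Finset.range (m' + 1 - 2), GG c ((k :: β.rotate i).rotate (s + 1)) =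
                ∑ s ∈ Finset.range (m' - 1), v (s + i) := by
              rw [show m' + 1 - 2 = m' - 1 by omega]
              apply Finset.sum_congr rfl
              intro s hs
              have hs := Finset.mem_range.1 hs
              rw [rotate_succ_cons _ _ _ (by omega)]
              simp only [hv]
              rw [add_comm s i, ← List.rotate_rotate,
                List.rotate_eq_drop_append_take (l := β.rotate i) (by omega)]
              have hlt : ((β.rotate i).take s).length = s := by simp; omega
              have hld : ((β.rotate i).drop s).length = m' - s := by simp [hβ]
              generalize (β.rotate i).take s = T at *
              generalize (β.rotate i).drop s = D at *
              rcases D with _ | ⟨p, _ | ⟨q, r1⟩⟩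
              · simp at hld; omega
              · simp at hld; omega
              · simp at hld
                show gg c p q (r1 ++ k :: T) = gg (fun β => c (k :: β)) p q (r1 ++ T)
                have hpq : ∀ p q, c (p :: q :: (r1 ++ k :: T)) = c (k :: p :: q :: (r1 ++ T)) := by
                  intro p q
                  have a1 := cyc_append h.cyc (p :: q :: r1) (k :: T) (by simp; omega)
                  have a2 := cyc_append (c := fun β => c (k :: β)) hcyc' T (p :: q :: r1) (by simp; omega)
                  simp only [List.cons_append] at a1 a2
                  rw [a1, a2]
                unfold gg
                simp only [hpq]
            rw [e1, e2] at h1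
            exact h1
          have hvp : ∀ i, v (i + m') = v i := by
            intro i
            simp only [hv]
            rw [add_comm, ← List.rotate_rotate, hper]
          have hsum : ∑ i ∈ Finset.range m', (u i - u (i + 1) +
              ∑ s ∈ Finset.range (m' - 1), v (s + i)) = 0 :=
            Finset.sum_eq_zero (fun i _ => main i)
          rw [Finset.sum_add_distrib, Finset.sum_range_sub', Finset.sum_comm] at hsum
          have hu0 : u 0 - u m' = 0 := by simp [hu, hper]
          have hin : ∀ s ∈ Finset.range (m' - 1), ∑ i ∈ Finset.range m', v (s + i) =
              ∑ i ∈ Finset.range m', v i := by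
            intro s _
            rw [← periodic_sum v m' hvp s]
            exact Finset.sum_congr rfl (fun i _ => by rw [add_comm])
          rw [hu0, zero_add, Finset.sum_congr rfl hin, Finset.sum_const, Finset.card_range,
            nsmul_eq_mul] at hsum
          rcases mul_eq_zero.1 hsum with h0 | h0
          · have : m' - 1 = 0 := by exact_mod_cast h0
            omega
          · exact h0
      exact symMem_of h.cyc k (fun r r' hp hr => IH _ H' r r' hp (by omega))
    intro l l' hp hl
    rcases l with _ | ⟨x, l⟩
    · simp at hl
    · exact key x _ _ hp hl (by simp)

end BW

namespace BW

section Alg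
variable {R : Type*} [Ring R] [Algebra ℚ R]

/-- Product `(1 + x u_0) ⋯ (1 + x u_{m-1})`. -/
def PP (u : ℕ → R) (x : ℚ) : ℕ → R
  | 0 => 1
  | m + 1 => PP u x m * (1 + x • u m)

/-- Coefficients of `PP`. -/
def aa (u : ℕ → R) : ℕ → ℕ → R
  | 0, 0 => 1
  | 0, _ + 1 => 0
  | m + 1, 0 => aa u m 0
  | m + 1, k + 1 => aa u m (k + 1) + aa u m k * u m

lemma aa_zero (u : ℕ → R) (m : ℕ) : aa u m 0 = 1 := by
  induction m with
  | zero => rfl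
  | succ m ih => exact ih

lemma aa_big (u : ℕ → R) (m : ℕ) : ∀ k, m < k → aa u m k = 0 := by
  induction m with
  | zero =>
    intro k hk
    obtain ⟨k, rfl⟩ : ∃ j, k = j + 1 := ⟨k - 1, by omega⟩
    rfl
  | succ m ih =>
    intro k hk
    obtain ⟨k, rfl⟩ : ∃ j, k = j + 1 := ⟨k - 1, by omega⟩
    show aa u m (k + 1) + aa u m k * u m = 0
    rw [ih _ (by omega), ih _ (by omega)]; simp

lemma PP_eq_sum (u : ℕ → R) (x : ℚ) (m : ℕ) :
    PP u x m = ∑ k ∈ Finset.range (m + 1), x ^ k • aa u m k := by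
  induction m with
  | zero => simp [PP, aa]
  | succ m ih =>
    rw [PP, ih, Finset.sum_range_succ' _ (m + 1)]
    have h1 : ∀ k, aa u (m + 1) (k + 1) = aa u m (k + 1) + aa u m k * u m := fun k => rfl
    simp only [h1, smul_add, Finset.sum_add_distrib]
    have h2 : ∑ k ∈ Finset.range (m + 1), x ^ (k + 1) • aa u m (k + 1) + x ^ 0 • aa u (m + 1) 0 =
        ∑ k ∈ Finset.range (m + 1), x ^ k • aa u m k := by
      have := Finset.sum_range_succ' (fun k => x ^ k • aa u m k) (m + 1)
      rw [Finset.sum_range_succ, aa_big u m (m + 1) (by omega), smul_zero, add_zero] at this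
      rw [this]; rfl
    rw [mul_add, mul_one, add_right_comm, h2, Finset.sum_mul]
    congr 1
    apply Finset.sum_congr rfl
    intro k _
    rw [smul_mul_assoc, mul_smul_comm, smul_smul, pow_succ]

lemma PP_comm_of_far (u : ℕ → R) (x : ℚ) (m j : ℕ)
    (hc : ∀ i < m, u i * u j = u j * u i) : Commute (PP u x m) (u j) := by
  induction m with
  | zero => exact Commute.one_left _
  | succ m ih =>
    refine Commute.mul_left (ih (fun i hi => hc i (by omega))) ?_
    refine Commute.add_left (Commute.one_left _) (Commute.smul_left ?_ x)
    exact hc m (by omega)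

lemma rank2_three (a b : R) (ha : a * a = 0) (hb : b * b = 0) (hab : a * b * a = b * a * b)
    (x y : ℚ) :
    (1 + (-y) • a) * (1 + x • b) * (1 + y • a) * (1 + y • b) =
    (1 + (-x) • a) * (1 + y • b) * (1 + x • a) * (1 + x • b) := by
  have ha' : ∀ z, a * (a * z) = 0 := fun z => by rw [← mul_assoc, ha, zero_mul]
  have hb' : ∀ z, b * (b * z) = 0 := fun z => by rw [← mul_assoc, hb, zero_mul]
  have h1 : b * (a * b) = a * (b * a) := by rw [← mul_assoc, ← mul_assoc, hab]
  have h2 : ∀ z, b * (a * (b * z)) = a * (b * (a * z)) := fun z => by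
    have := congrArg (· * z) h1
    simpa [mul_assoc] using this
  simp only [mul_add, add_mul, mul_one, one_mul, smul_mul_assoc, mul_smul_comm, mul_assoc, ha, hb,
    ha', hb', h1, h2, smul_zero, mul_zero, add_zero, smul_smul]
  module

lemma rank2_four (a b : R) (ha : a * a = 0) (hb : b * b = 0)
    (hab : a * b * a * b = b * a * b * a) (x y : ℚ) :
    (1 + (-x) • a) * (1 + y • b) * (1 + x • a) * (1 + x • b) =
    (1 + (-y) • a) * (1 + x • b) * (1 + y • a) * (1 + y • b) *
      (1 - (x * y * (y - x)) • (b * a * b - a * b * a)) := by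
  have ha' : ∀ z, a * (a * z) = 0 := fun z => by rw [← mul_assoc, ha, zero_mul]
  have hb' : ∀ z, b * (b * z) = 0 := fun z => by rw [← mul_assoc, hb, zero_mul]
  have h1 : b * (a * (b * a)) = a * (b * (a * b)) := by
    simp only [← mul_assoc, hab]
  have h2 : ∀ z, b * (a * (b * (a * z))) = a * (b * (a * (b * z))) := fun z => by
    have := congrArg (· * z) h1
    simpa [mul_assoc] using this
  simp only [mul_add, add_mul, mul_sub, mul_one, one_mul, smul_mul_assoc, mul_smul_comm, mul_assoc,
    ha, hb, ha', hb', h1, h2, smul_zero, mul_zero, add_zero, smul_smul, sub_zero, smul_sub, smul_add]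
  module

/-- The nil-Coxeter relations of type `B_n`. -/
structure NilB (u : ℕ → R) (n : ℕ) : Prop where
  sq : ∀ i, u i * u i = 0
  far : ∀ i j, i + 2 ≤ j → u i * u j = u j * u i
  br3 : ∀ i, i + 2 < n → u i * u (i + 1) * u i = u (i + 1) * u i * u (i + 1)
  br4 : ∀ i, i + 2 = n → u i * u (i + 1) * u i * u (i + 1) = u (i + 1) * u i * u (i + 1) * u i

lemma PP_step {u : ℕ → R} {n : ℕ} (h : NilB u n) (x y : ℚ) (k : ℕ) :
    PP u x (k + 2) * PP u y (k + 2) = PP u x (k + 1) * PP u y (k + 1) *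
      ((1 + (-y) • u k) * (1 + x • u (k + 1)) * (1 + y • u k) * (1 + y • u (k + 1))) := by
  have hc : Commute (PP u y k) (1 + x • u (k + 1)) :=
    Commute.add_right (Commute.one_right _) (Commute.smul_right
      (PP_comm_of_far u y k (k + 1) (fun i hi => h.far i _ (by omega))) x)
  have hi : (1 + y • u k) * (1 + (-y) • u k) = 1 := by
    simp only [mul_add, add_mul, mul_one, one_mul, smul_mul_assoc, mul_smul_comm, h.sq]
    module
  have e1 : PP u x (k + 2) = PP u x (k + 1) * (1 + x • u (k + 1)) := rfl
  have e2 : PP u y (k + 2) = PP u y k * (1 + y • u k) * (1 + y • u (k + 1)) := rfl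
  have e3 : PP u y (k + 1) = PP u y k * (1 + y • u k) := rfl
  rw [e1, e2, e3]
  calc _ = PP u x (k + 1) * ((1 + x • u (k + 1)) * PP u y k) * (1 + y • u k) *
        (1 + y • u (k + 1)) := by simp only [mul_assoc]
    _ = PP u x (k + 1) * (PP u y k * 1 * (1 + x • u (k + 1))) * (1 + y • u k) *
        (1 + y • u (k + 1)) := by rw [← hc.eq, mul_one]
    _ = _ := by
      have hi' : ∀ z, (1 + y • u k) * ((1 + (-y) • u k) * z) = z := fun z => by
        rw [← mul_assoc, hi, one_mul]
      simp only [mul_assoc, hi', one_mul]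

lemma PP_comm {u : ℕ → R} {n : ℕ} (h : NilB u n) (x y : ℚ) (k : ℕ) (hk : k < n ∨ k ≤ 1) :
    PP u x k * PP u y k = PP u y k * PP u x k := by
  induction k using Nat.strong_induction_on with
  | _ k ih =>
  rcases k with _ | _ | k
  · simp [PP]
  · simp only [PP, one_mul, mul_add, add_mul, mul_one, smul_mul_assoc, mul_smul_comm, h.sq]
    module
  · rw [PP_step h, PP_step h, ih (k + 1) (by omega) (by omega),
      rank2_three _ _ (h.sq _) (h.sq _) (h.br3 k (by omega))]

/-- The central correction term. -/
def eta (u : ℕ → R) (n : ℕ) : R :=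
  if 2 ≤ n then u (n - 1) * u (n - 2) * u (n - 1) - u (n - 2) * u (n - 1) * u (n - 2) else 0

lemma PP_main {u : ℕ → R} {n : ℕ} (h : NilB u n) (x y : ℚ) :
    PP u x n * PP u y n - PP u y n * PP u x n =
      (x * y * (y - x)) • (PP u x n * PP u y n * eta u n) := by
  by_cases hn : 2 ≤ n
  · obtain ⟨p, rfl⟩ : ∃ p, n = p + 2 := ⟨n - 2, by omega⟩
    have e : eta u (p + 2) = u (p + 1) * u p * u (p + 1) - u p * u (p + 1) * u p := by
      simp [eta]
    rw [PP_step h y x, PP_comm h y x (p + 1) (by omega),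
      rank2_four _ _ (h.sq _) (h.sq _) (h.br4 p rfl), ← e, ← mul_assoc, ← PP_step h x y, mul_sub,
      mul_one, mul_smul_comm]
    abel
  · rw [PP_comm h x y n (by omega)]
    simp [eta, hn]

lemma coeff_zero (N : ℕ) (r : ℕ → R) (h : ∀ x : ℚ, ∑ k ∈ Finset.range N, x ^ k • r k = 0) :
    ∀ k < N, r k = 0 := by
  intro k hk
  rw [← Module.forall_dual_apply_eq_zero_iff ℚ]
  intro f
  have hp : (∑ k ∈ Finset.range N, Polynomial.C (f (r k)) * Polynomial.X ^ k) = 0 := by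
    apply Polynomial.funext
    intro x
    have := congrArg f (h x)
    simp only [map_sum, map_smul, smul_eq_mul, map_zero] at this
    rw [Polynomial.eval_finsetSum]
    simp only [Polynomial.eval_mul, Polynomial.eval_C, Polynomial.eval_pow, Polynomial.eval_X,
      Polynomial.eval_zero]
    rw [← this]
    exact Finset.sum_congr rfl (fun i _ => by ring)
  have := congrArg (fun p => Polynomial.coeff p k) hp
  simp only [Polynomial.finsetSum_coeff, Polynomial.coeff_C_mul_X_pow, Polynomial.coeff_zero] at this
  simpa [hk] using this

/-- Shift of a sequence. -/
def sh (f : ℕ → R) : ℕ → R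
  | 0 => 0
  | k + 1 => f k

/-- partial sums of a power series. -/
def SS (f : ℕ → R) (x : ℚ) (N : ℕ) : R := ∑ k ∈ Finset.range N, x ^ k • f k

lemma SS_sh (f : ℕ → R) (x : ℚ) (N : ℕ) : SS (sh f) x (N + 1) = x • SS f x N := by
  unfold SS
  rw [Finset.sum_range_succ']
  simp only [sh, smul_zero, add_zero, Finset.smul_sum, smul_smul, pow_succ']

lemma SS_aa (u : ℕ → R) (x : ℚ) (n N : ℕ) (h : n < N) : SS (aa u n) x N = PP u x n := by
  rw [PP_eq_sum]
  unfold SS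
  obtain ⟨d, rfl⟩ : ∃ d, N = n + 1 + d := ⟨N - (n + 1), by omega⟩
  rw [Finset.sum_range_add, add_eq_left]
  apply Finset.sum_eq_zero
  intro k _
  rw [aa_big u n _ (by omega), smul_zero]

lemma SS_mul (f g : ℕ → R) (x y : ℚ) (N : ℕ) : SS f x N * SS g y N =
    ∑ k ∈ Finset.range N, x ^ k • ∑ l ∈ Finset.range N, y ^ l • (f k * g l) := by
  unfold SS
  rw [Finset.sum_mul]
  apply Finset.sum_congr rfl
  intro k _
  rw [smul_mul_assoc, Finset.mul_sum]
  congr 1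
  exact Finset.sum_congr rfl (fun l _ => by rw [mul_smul_comm])

lemma aa_commutator {u : ℕ → R} {n : ℕ} (h : NilB u n) (k l : ℕ) :
    aa u n k * aa u n l - aa u n l * aa u n k =
      (sh (aa u n) k * sh (sh (aa u n)) l - sh (sh (aa u n)) k * sh (aa u n) l) * eta u n := by
  set a := aa u n with ha
  set r : ℕ → ℕ → R := fun k l => a k * a l - a l * a k -
    (sh a k * sh (sh a) l - sh (sh a) k * sh a l) * eta u n with hr
  set N := n + 3 + k + l with hN
  have e0 : ∀ x, SS a x N = PP u x n := fun x => SS_aa u x n N (by omega)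
  have e1 : ∀ x, SS (sh a) x N = x • PP u x n := fun x => by
    rw [show N = (n + 2 + k + l) + 1 by omega, SS_sh, SS_aa u x n _ (by omega)]
  have e2 : ∀ x, SS (sh (sh a)) x N = x • x • PP u x n := fun x => by
    rw [show N = (n + 1 + k + l) + 1 + 1 by omega, SS_sh, SS_sh, SS_aa u x n _ (by omega)]
  have key : ∀ x y : ℚ, ∑ k ∈ Finset.range N, x ^ k • ∑ l ∈ Finset.range N, y ^ l • r k l = 0 := by
    intro x y
    have m1 := SS_mul a a x y N
    have m2 := SS_mul a a y x N
    have m3 := SS_mul (sh a) (sh (sh a)) x y N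
    have m4 := SS_mul (sh (sh a)) (sh a) x y N
    have m2' : SS a y N * SS a x N =
        ∑ k ∈ Finset.range N, x ^ k • ∑ l ∈ Finset.range N, y ^ l • (a l * a k) := by
      rw [m2]
      simp only [Finset.smul_sum]
      rw [Finset.sum_comm]
      exact Finset.sum_congr rfl (fun k _ => Finset.sum_congr rfl (fun l _ => by
        rw [smul_smul, smul_smul, mul_comm]))
    have : ∑ k ∈ Finset.range N, x ^ k • ∑ l ∈ Finset.range N, y ^ l • r k l =
        SS a x N * SS a y N - SS a y N * SS a x N - (SS (sh a) x N * SS (sh (sh a)) y N -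
          SS (sh (sh a)) x N * SS (sh a) y N) * eta u n := by
      rw [m1, m2', m3, m4]
      simp only [hr, smul_sub, Finset.sum_sub_distrib, sub_mul, Finset.sum_mul, smul_mul_assoc,
        Finset.smul_sum]
    rw [this, e0, e0, e1, e1, e2, e2, PP_main h]
    simp only [smul_mul_assoc, mul_smul_comm, smul_smul, sub_mul]
    module
  have k1 : ∀ y, ∀ k < N, ∑ l ∈ Finset.range N, y ^ l • r k l = 0 := fun y =>
    coeff_zero N (fun k => ∑ l ∈ Finset.range N, y ^ l • r k l) (fun x => key x y)
  have k2 := coeff_zero N (r k) (fun y => k1 y k (by omega)) l (by omega)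
  exact sub_eq_zero.1 k2

/-- The value of a trace functional on a word in the letters `a_k`. -/
def cc (u : ℕ → R) (n : ℕ) (φ : R →ₗ[ℚ] ℚ) (α : List ℕ) : ℚ := φ ((α.map (aa u n)).prod)

lemma telescope (a : ℕ → R) (x y : ℕ) :
    ∑ t ∈ Finset.range (x + 1), (sh a (x + 1 - t) * sh (sh a) (y + t) -
      sh (sh a) (x + 1 - t) * sh a (y + t)) = a x * sh (sh a) y := by
  have h : ∀ t ∈ Finset.range (x + 1), sh a (x + 1 - t) * sh (sh a) (y + t) -
      sh (sh a) (x + 1 - t) * sh a (y + t) = sh a (x + 1 - t) * sh (sh a) (y + t) -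
        sh a (x + 1 - (t + 1)) * sh (sh a) (y + (t + 1)) := by
    intro t ht
    have ht := Finset.mem_range.1 ht
    rw [show x + 1 - t = (x - t) + 1 by omega, show x + 1 - (t + 1) = x - t by omega]
    rfl
  rw [Finset.sum_congr rfl h, Finset.sum_range_sub' (fun t => sh a (x + 1 - t) * sh (sh a) (y + t))]
  simp [sh]

/-- auxiliary functional -/
def HH (u : ℕ → R) (n : ℕ) (φ : R →ₗ[ℚ] ℚ) : List ℕ → ℚ
  | [] => 0
  | y :: s => φ (sh (sh (aa u n)) y * eta u n * (s.map (aa u n)).prod)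

lemma gg_eq {u : ℕ → R} {n : ℕ} (h : NilB u n) (φ : R →ₗ[ℚ] ℚ) (x y : ℕ) (r : List ℕ) :
    gg (cc u n φ) x y r =
      φ (aa u n x * sh (sh (aa u n)) y * eta u n * (r.map (aa u n)).prod) := by
  rw [← telescope (aa u n) x y, Finset.sum_mul, Finset.sum_mul, map_sum]
  unfold gg
  apply Finset.sum_congr rfl
  intro t _
  rw [← aa_commutator h]
  simp [cc, sub_mul, mul_assoc]

lemma HH_sum {u : ℕ → R} {n : ℕ} (h : NilB u n) (φ : R →ₗ[ℚ] ℚ)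
    (htr : ∀ X Y, φ (X * Y) = φ (Y * X)) (β : List ℕ) : ∀ p : List ℕ,
    φ ((p.map (aa u n)).prod * (aa u n 1 * (β.map (aa u n)).prod - (β.map (aa u n)).prod * aa u n 1)) =
      ∑ i ∈ Finset.range β.length, HH u n φ ((β ++ p).rotate i) := by
  induction β with
  | nil => intro p; simp
  | cons b β ih =>
    intro p
    rw [List.length_cons, Finset.sum_range_succ']
    have h1 : ∀ i, ((b :: β) ++ p).rotate (i + 1) = (β ++ (p ++ [b])).rotate i := by
      intro i
      rw [List.cons_append, List.rotate_cons_succ, List.append_assoc]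
    simp only [h1]
    rw [← ih (p ++ [b]), List.rotate_zero]
    have h2 := aa_commutator h 1 b
    have h3 : sh (aa u n) 1 = 1 := aa_zero u n
    have h4 : sh (sh (aa u n)) 1 = 0 := rfl
    rw [h3, h4, one_mul, zero_mul, sub_zero] at h2
    show _ = _ + φ (sh (sh (aa u n)) b * eta u n * ((β ++ p).map (aa u n)).prod)
    have h5 : φ ((aa u n 1 * aa u n b - aa u n b * aa u n 1) * (List.map (aa u n) (β ++ p)).prod) =
        φ ((List.map (aa u n) p).prod * ((aa u n 1 * aa u n b - aa u n b * aa u n 1) *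
          (List.map (aa u n) β).prod)) := by
      rw [htr (List.map (aa u n) p).prod, List.map_append, List.prod_append, ← mul_assoc]
    rw [← h2, h5, ← map_add]
    congr 1
    simp only [List.map_append, List.prod_append, List.map_cons, List.prod_cons, List.map_nil,
      List.prod_nil, mul_one]
    noncomm_ring

theorem hyp_cc {u : ℕ → R} {n : ℕ} (h : NilB u n) (φ : R →ₗ[ℚ] ℚ)
    (htr : ∀ X Y, φ (X * Y) = φ (Y * X)) (m : ℕ) : Hyp (cc u n φ) m := by
  refine ⟨?_, ?_, ?_⟩
  · intro x r _
    simp only [cc, List.map_cons, List.prod_cons, List.map_append, List.prod_append, List.map_nil,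
      List.prod_nil, mul_one]
    exact htr _ _
  · intro l r _
    simp [cc, aa_zero]
  · intro β hβ
    rcases m with _ | _ | m
    · simp
    · obtain ⟨x, rfl⟩ := List.length_eq_one_iff.1 hβ
      simp [GG]
    have h1 : ∀ i, GG (cc u n φ) (β.rotate i) = HH u n φ (β.rotate (i + 1)) := by
      intro i
      rw [← List.rotate_rotate]
      have hl : (β.rotate i).length = m + 2 := by simp [hβ]
      generalize β.rotate i = γ at *
      rcases γ with _ | ⟨x, _ | ⟨y, r⟩⟩
      · simp at hl
      · simp at hl
      · show gg _ x y r = φ _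
        rw [gg_eq h, mul_assoc, mul_assoc, htr]
        simp [mul_assoc]
    simp only [h1]
    have hper : ∀ i, HH u n φ (β.rotate (i + (m + 1 + 1))) = HH u n φ (β.rotate i) := by
      intro i
      rw [add_comm, ← List.rotate_rotate, ← hβ, List.rotate_length]
    rw [periodic_sum (fun i => HH u n φ (β.rotate i)) (m + 1 + 1) hper 1]
    have := HH_sum h φ htr β []
    rw [hβ] at this
    simp only [List.append_nil] at this
    rw [← this]
    simp only [List.map_nil, List.prod_nil, one_mul, map_sub]
    rw [htr, sub_self]

theorem cc_perm {u : ℕ → R} {n : ℕ} (h : NilB u n) (φ : R →ₗ[ℚ] ℚ)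
    (htr : ∀ X Y, φ (X * Y) = φ (Y * X)) {l l' : List ℕ} (hp : l.Perm l') :
    cc u n φ l = cc u n φ l' :=
  sym_of_hyp l.length _ (hyp_cc h φ htr _) l l' hp rfl

end Alg
end BW

namespace BW

section Words
variable {R : Type*} [Ring R] [Algebra ℚ R]

lemma aa_left (u : ℕ → R) (m : ℕ) : ∀ k, aa u (m + 1) (k + 1) =
    aa (fun t => u (t + 1)) m (k + 1) + u 0 * aa (fun t => u (t + 1)) m k := by
  induction m with
  | zero =>
    intro k
    rcases k with _ | k <;> simp [aa]
  | succ m ih =>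
    intro k
    have e1 : aa u (m + 1 + 1) (k + 1) = aa u (m + 1) (k + 1) + aa u (m + 1) k * u (m + 1) := rfl
    have e2 : aa (fun t => u (t + 1)) (m + 1) (k + 1) = aa (fun t => u (t + 1)) m (k + 1) +
      aa (fun t => u (t + 1)) m k * u (m + 1) := rfl
    rw [e1, e2, ih k]
    rcases k with _ | k
    · simp [aa_zero]; abel
    · have e3 : aa (fun t => u (t + 1)) (m + 1) (k + 1) = aa (fun t => u (t + 1)) m (k + 1) +
        aa (fun t => u (t + 1)) m k * u (m + 1) := rfl
      rw [ih k, e3]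
      noncomm_ring

/-- Words of length `N`. -/
def WS (n : ℕ) : ℕ → Finset (List (Fin n))
  | 0 => {[]}
  | N + 1 => (Finset.univ ×ˢ WS n N).map ⟨fun p => p.1 :: p.2, by
      rintro ⟨a, b⟩ ⟨c, d⟩ h; simpa using h⟩

lemma sum_WS_succ {A : Type*} [AddCommMonoid A] (n N : ℕ) (f : List (Fin n) → A) :
    ∑ ω ∈ WS n (N + 1), f ω = ∑ x : Fin n, ∑ ω ∈ WS n N, f (x :: ω) := by
  rw [WS, Finset.sum_map, Finset.sum_product]
  rfl

lemma mem_WS (n N : ℕ) (ω : List (Fin n)) : ω ∈ WS n N ↔ ω.length = N := by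
  induction N generalizing ω with
  | zero => simp [WS]
  | succ N ih =>
    simp only [WS, Finset.mem_map, Finset.mem_product, Finset.mem_univ, true_and,
      Function.Embedding.coeFn_mk, Prod.exists, ih]
    constructor
    · rintro ⟨a, b, hb, rfl⟩
      show (a :: b).length = N + 1
      simp [hb]
    · intro h
      rcases ω with _ | ⟨x, ω⟩
      · simp at h
      · exact ⟨x, ω, by simpa using h, rfl⟩

/-- The statistic (a major index read from the right). -/
def MM {n : ℕ} : List (Fin n) → ℕ
  | [] => 0
  | [_] => 0
  | x :: y :: r => MM (y :: r) + if (y : ℕ) ≤ x then r.length + 1 else 0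

/-- `(q;q)_N` -/
def qp (q : ℚ) (N : ℕ) : ℚ := ∏ l ∈ Finset.range N, (1 - q ^ (l + 1))

/-- weight of a word -/
def rr {n : ℕ} (q : ℚ) (ω : List (Fin n)) : ℚ := q ^ MM ω / qp q ω.length

/-- head condition -/
def hd {n : ℕ} (i : ℕ) : List (Fin n) → Bool
  | [] => false
  | x :: _ => decide (i ≤ (x : ℕ))

variable (u : ℕ → R) {n : ℕ} (q : ℚ)

/-- operator of a word -/
def UU (ω : List (Fin n)) : R := (ω.map (fun i => u (i : ℕ))).prod

def FF (n N : ℕ) : R := ∑ ω ∈ WS n N, rr q ω • UU u ω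

def Fg (n N i : ℕ) : R := ∑ ω ∈ WS n N, if hd i ω then rr q ω • UU u ω else 0

lemma rr_cons (hq : ∀ k, 1 - q ^ (k + 1) ≠ 0) (x : Fin n) (ω : List (Fin n)) :
    (1 - q ^ (ω.length + 1)) * rr q (x :: ω) =
      rr q ω * (if hd (x + 1) ω then 1 else q ^ ω.length) := by
  have h1 : qp q (ω.length + 1) = qp q ω.length * (1 - q ^ (ω.length + 1)) :=
    Finset.prod_range_succ _ _
  have h2 := hq ω.length
  have h3 : qp q ω.length ≠ 0 := Finset.prod_ne_zero_iff.2 (fun l _ => hq l)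
  unfold rr
  rw [List.length_cons, h1]
  have h4 : q ^ MM (x :: ω) = q ^ MM ω * (if hd (x + 1) ω then 1 else q ^ ω.length) := by
    rcases ω with _ | ⟨y, r⟩
    · simp [MM, hd]
    · by_cases hy : (y : ℕ) ≤ x
      · have : ¬ ((x : ℕ) + 1 ≤ y) := by omega
        simp only [MM, hd, hy, if_true, this, decide_false, List.length_cons, pow_add]
        simp
      · have : ((x : ℕ) + 1 ≤ y) := by omega
        simp only [MM, hd, hy, if_true, this, decide_true, List.length_cons, if_false, add_zero,
          mul_one]
  rw [h4]
  field_simp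

lemma first_letter (hq : ∀ k, 1 - q ^ (k + 1) ≠ 0) (x : Fin n) (N : ℕ) :
    (1 - q ^ (N + 1)) • ∑ ω ∈ WS n N, rr q (x :: ω) • UU u (x :: ω) =
      u x * (q ^ N • FF u q n N + (1 - q ^ N) • Fg u q n N (x + 1)) := by
  unfold FF Fg
  rw [Finset.smul_sum, Finset.smul_sum, Finset.smul_sum, ← Finset.sum_add_distrib, Finset.mul_sum]
  apply Finset.sum_congr rfl
  intro ω hω
  have hl := (mem_WS n N ω).1 hω
  have hr := rr_cons q hq x ω
  rw [hl] at hr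
  rw [smul_smul, hr]
  have : UU u (x :: ω) = u x * UU u ω := by simp [UU]
  rw [this]
  split_ifs
  · rw [mul_one, ← mul_smul_comm]; congr 1; module
  · rw [← mul_smul_comm]; congr 1; module

/-- coefficients with letters at least `i` -/
def ab (n i j : ℕ) : R := aa (fun t => u (i + t)) (n - i) j

lemma ab_zero (i : ℕ) : ab u n i 0 = 1 := aa_zero _ _

lemma ab_top (j : ℕ) : ab u n n (j + 1) = 0 := aa_big _ _ _ (by omega)

lemma ab_step (i j : ℕ) (hi : i < n) :
    ab u n i (j + 1) = ab u n (i + 1) (j + 1) + u i * ab u n (i + 1) j := by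
  unfold ab
  rw [show n - i = (n - (i + 1)) + 1 by omega, aa_left]
  have h : (fun t => u (i + (t + 1))) = fun t => u (i + 1 + t) := by
    funext t; congr 1; omega
  rw [h, add_zero]

lemma Fg_top (N : ℕ) : Fg u q n N n = 0 := by
  apply Finset.sum_eq_zero
  intro ω _
  rcases ω with _ | ⟨x, r⟩
  · simp [hd]
  · have := x.2
    have h : ¬ (n ≤ (x : ℕ)) := by omega
    simp [hd, h]

lemma Fg_step (N i : ℕ) (hi : i < n) : Fg u q n (N + 1) i = Fg u q n (N + 1) (i + 1) +
    ∑ ω ∈ WS n N, rr q (⟨i, hi⟩ :: ω) • UU u ((⟨i, hi⟩ : Fin n) :: ω) := by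
  unfold Fg
  rw [sum_WS_succ, sum_WS_succ]
  simp only [hd, decide_eq_true_eq]
  have : ∑ ω ∈ WS n N, rr q (⟨i, hi⟩ :: ω) • UU u ((⟨i, hi⟩ : Fin n) :: ω) =
      ∑ x : Fin n, if x = ⟨i, hi⟩ then ∑ ω ∈ WS n N, rr q (x :: ω) • UU u (x :: ω) else 0 := by
    simp
  rw [this, ← Finset.sum_add_distrib]
  apply Finset.sum_congr rfl
  intro x _
  by_cases h1 : x = ⟨i, hi⟩
  · subst h1; simp
  · have h2 : (x : ℕ) ≠ i := fun h => h1 (Fin.ext h)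
    by_cases h3 : i ≤ (x : ℕ)
    · have : i + 1 ≤ (x : ℕ) := by omega
      simp [h1, h3, this]
    · have : ¬ i + 1 ≤ (x : ℕ) := by omega
      simp [h1, h3, this]

lemma Fg_bot (N : ℕ) : Fg u q n (N + 1) 0 = FF u q n (N + 1) := by
  unfold Fg FF
  apply Finset.sum_congr rfl
  intro ω hω
  have hl := (mem_WS n _ ω).1 hω
  rcases ω with _ | ⟨x, r⟩
  · simp at hl
  · simp [hd]

lemma Fg_rec (hq : ∀ k, 1 - q ^ (k + 1) ≠ 0) (N : ℕ) : ∀ d i, i + d = n →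
    (1 - q ^ N) • Fg u q n N i =
      ∑ j ∈ Finset.range N, q ^ (N - 1 - j) • (ab u n i (j + 1) * FF u q n (N - 1 - j)) := by
  induction N with
  | zero => intro d i _; simp
  | succ N ihN =>
    intro d
    induction d with
    | zero =>
      intro i hi
      obtain rfl : i = n := by omega
      rw [Fg_top]
      simp [ab_top]
    | succ d ihd =>
      intro i hi
      have hin : i < n := by omega
      rw [Fg_step u q N i hin, smul_add, first_letter u q hq, ihd (i + 1) (by omega),
        ihN d (i + 1) (by omega)]
      simp only [ab_step u i _ hin, add_mul, smul_add, Finset.sum_add_distrib]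
      congr 1
      rw [Finset.sum_range_succ']
      simp only [ab_zero, Nat.add_sub_cancel, Nat.sub_zero, mul_one, mul_add, mul_smul_comm]
      rw [add_comm]
      congr 1
      rw [Finset.mul_sum]
      apply Finset.sum_congr rfl
      intro j _
      rw [show N - (j + 1) = N - 1 - j by omega, mul_smul_comm, mul_assoc]

theorem FF_rec (hq : ∀ k, 1 - q ^ (k + 1) ≠ 0) (N : ℕ) (hN : 0 < N) :
    (1 - q ^ N) • FF u q n N =
      ∑ j ∈ Finset.range N, q ^ (N - 1 - j) • (aa u n (j + 1) * FF u q n (N - 1 - j)) := by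
  obtain ⟨N, rfl⟩ : ∃ m, N = m + 1 := ⟨N - 1, by omega⟩
  have := Fg_rec (n := n) u q hq (N + 1) n 0 (by omega)
  rw [Fg_bot] at this
  rw [this]
  simp [ab]

lemma FF_zero : FF u q n 0 = 1 := by
  simp [FF, WS, rr, UU, MM, qp]

end Words
end BW

namespace BW

section Inv
variable {R : Type*} [Ring R] [Algebra ℚ R]
open Polynomial

noncomputable def AP (u : ℕ → R) : ℕ → R[X]
  | 0 => 1
  | m + 1 => AP u m * (1 + C (u m) * X)

noncomputable def BP (u : ℕ → R) : ℕ → R[X]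
  | 0 => 1
  | m + 1 => (1 - C (u m) * X) * BP u m

lemma AP_coeff (u : ℕ → R) (m : ℕ) : ∀ k, (AP u m).coeff k = aa u m k := by
  induction m with
  | zero => intro k; rcases k with _ | k <;> simp [AP, aa, coeff_one]
  | succ m ih =>
    intro k
    rcases k with _ | k
    · simp [AP, aa, mul_add, ← mul_assoc, ih]
    · simp [AP, aa, mul_add, ← mul_assoc, ih]

lemma BP_deg (u : ℕ → R) (m : ℕ) : ∀ k, m < k → (BP u m).coeff k = 0 := by
  induction m with
  | zero => intro k hk; simp [BP, coeff_one]; omega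
  | succ m ih =>
    intro k hk
    obtain ⟨k, rfl⟩ : ∃ j, k = j + 1 := ⟨k - 1, by omega⟩
    rw [BP, sub_mul, one_mul, coeff_sub, mul_assoc, coeff_C_mul, coeff_X_mul, ih _ (by omega),
      ih _ (by omega)]
    simp

lemma BP_mul_AP (u : ℕ → R) (hsq : ∀ i, u i * u i = 0) (m : ℕ) : BP u m * AP u m = 1 := by
  induction m with
  | zero => simp [BP, AP]
  | succ m ih =>
    rw [BP, AP, mul_assoc, ← mul_assoc (BP u m), ih, one_mul]
    have : (C (u m) * X) * (C (u m) * X) = (0 : R[X]) := by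
      rw [mul_assoc, ← mul_assoc X, X_mul_C, ← mul_assoc, ← mul_assoc, ← C_mul, hsq]
      simp
    rw [sub_mul, mul_add, mul_add, this]
    simp

/-- inverse coefficients -/
noncomputable def bb (u : ℕ → R) (n k : ℕ) : R := (BP u n).coeff k

lemma bb_zero (u : ℕ → R) (n : ℕ) : bb u n 0 = 1 := by
  unfold bb
  induction n with
  | zero => simp [BP]
  | succ n ih => simp [BP, sub_mul, mul_assoc, ih]

lemma bb_rel (u : ℕ → R) (hsq : ∀ i, u i * u i = 0) (n k : ℕ) :
    ∑ j ∈ Finset.range (k + 1 + 1), bb u n j * aa u n (k + 1 - j) = 0 := by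
  have := congrArg (fun p => coeff p (k + 1)) (BP_mul_AP u hsq n)
  simp only [coeff_mul, coeff_one] at this
  rw [Finset.Nat.sum_antidiagonal_eq_sum_range_succ_mk] at this
  simpa [AP_coeff, bb] using this

end Inv

section Quot
open MvPolynomial
variable (c : List ℕ → ℚ)

/-- the linear functional on polynomials given by a symmetric function on words -/
noncomputable def tauB : MvPolynomial ℕ ℚ →ₗ[ℚ] ℚ :=
  (MvPolynomial.basisMonomials ℕ ℚ).constr ℚ (fun s => c (Finsupp.toMultiset s).toList)

/-- word monomial -/
noncomputable def wm (α : List ℕ) : MvPolynomial ℕ ℚ := (α.map X).prod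

lemma wm_eq (α : List ℕ) : wm α = monomial (Multiset.toFinsupp (α : Multiset ℕ)) 1 := by
  induction α with
  | nil => simp [wm]
  | cons x α ih =>
    have : wm (x :: α) = X x * wm α := by simp [wm]
    rw [this, ih, X, monomial_mul, one_mul, ← Multiset.cons_coe, ← Multiset.singleton_add, map_add]
    simp

variable {c}

lemma tauB_wm (hc : ∀ l l' : List ℕ, l.Perm l' → c l = c l') (α : List ℕ) : tauB c (wm α) = c α := by
  rw [wm_eq, tauB]
  have := (MvPolynomial.basisMonomials ℕ ℚ).constr_basis ℚ
    (fun s => c (Finsupp.toMultiset s).toList) (Multiset.toFinsupp (α : Multiset ℕ))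
  rw [MvPolynomial.coe_basisMonomials] at this
  rw [this]
  apply hc
  rw [← Multiset.coe_eq_coe]
  simp

lemma wm_span (f g : MvPolynomial ℕ ℚ →ₗ[ℚ] ℚ) (h : ∀ α, f (wm α) = g (wm α)) : f = g := by
  apply (MvPolynomial.basisMonomials ℕ ℚ).ext
  intro s
  have := h (Finsupp.toMultiset s).toList
  rw [wm_eq] at this
  simpa using this

lemma wm_cons (x : ℕ) (α : List ℕ) : wm (x :: α) = X x * wm α := by simp [wm]

variable (c) in
/-- the radical ideal of the functional -/
noncomputable def radI : Ideal (MvPolynomial ℕ ℚ) where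
  carrier := {b | ∀ b', tauB c (b' * b) = 0}
  add_mem' := by
    intro a b ha hb b'
    rw [mul_add, map_add, ha, hb, add_zero]
  zero_mem' := by intro b'; simp
  smul_mem' := by
    intro r b hb b'
    rw [smul_eq_mul, ← mul_assoc]
    exact hb _

lemma mem_radI_of_wm (b : MvPolynomial ℕ ℚ) (h : ∀ α, tauB c (wm α * b) = 0) : b ∈ radI c := by
  intro b'
  have : (tauB c).comp (LinearMap.mulRight ℚ b) = 0 := by
    apply wm_span
    intro α
    simpa using h α
  simpa using LinearMap.congr_fun this b'

end Quot

section Transfer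
open MvPolynomial
variable {R : Type*} [Ring R] [Algebra ℚ R] {u : ℕ → R} {n : ℕ} {φ : R →ₗ[ℚ] ℚ}

/-- the inverse coefficients in the polynomial ring -/
noncomputable def EB : ℕ → MvPolynomial ℕ ℚ
  | 0 => 1
  | k + 1 => - ∑ j : Fin (k + 1), EB j * X (k + 1 - j)

lemma EB_tau (hc : ∀ l l' : List ℕ, l.Perm l' → cc u n φ l = cc u n φ l')
    (hsq : ∀ i, u i * u i = 0) (k : ℕ) : ∀ α : List ℕ,
    tauB (cc u n φ) (wm α * EB k) = φ (bb u n k * (α.map (aa u n)).prod) := by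
  induction k using Nat.strong_induction_on with
  | _ k ih =>
  intro α
  rcases k with _ | k
  · rw [EB, mul_one, tauB_wm hc, bb_zero, one_mul]; rfl
  · have h1 : bb u n (k + 1) = - ∑ j : Fin (k + 1), bb u n j * aa u n (k + 1 - j) := by
      have := bb_rel u hsq n k
      rw [Finset.sum_range_succ, Nat.sub_self, aa_zero, mul_one] at this
      rw [Fin.sum_univ_eq_sum_range (fun j => bb u n j * aa u n (k + 1 - j)) (k + 1)]
      exact eq_neg_of_add_eq_zero_right this
    rw [EB, h1, mul_neg, map_neg, Finset.mul_sum, neg_mul, map_neg, Finset.sum_mul, map_sum, map_sum]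
    congr 1
    apply Finset.sum_congr rfl
    intro j _
    have := ih j (by omega) ((k + 1 - j) :: α)
    rw [wm_cons] at this
    rw [show wm α * (EB j * X (k + 1 - j)) = X (k + 1 - ↑j) * wm α * EB ↑j by ring, this]
    simp [mul_assoc]

/-- the q-series coefficients in the polynomial ring -/
noncomputable def PB (q : ℚ) : ℕ → MvPolynomial ℕ ℚ
  | 0 => (1 : MvPolynomial ℕ ℚ)
  | N + 1 => (1 - q ^ (N + 1))⁻¹ • ∑ j : Fin (N + 1), q ^ (N - j : ℕ) •
      ((X ((j : ℕ) + 1) : MvPolynomial ℕ ℚ) * PB q (N - j))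

lemma PB_tau (hc : ∀ l l' : List ℕ, l.Perm l' → cc u n φ l = cc u n φ l') (q : ℚ)
    (hq : ∀ k, 1 - q ^ (k + 1) ≠ 0) (N : ℕ) : ∀ α : List ℕ,
    tauB (cc u n φ) (wm α * PB q N) = φ ((α.map (aa u n)).prod * FF u q n N) := by
  induction N using Nat.strong_induction_on with
  | _ N ih =>
  intro α
  rcases N with _ | N
  · rw [PB, mul_one, tauB_wm hc, FF_zero, mul_one]; rfl
  · have h1 : FF u q n (N + 1) = (1 - q ^ (N + 1))⁻¹ • ∑ j : Fin (N + 1),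
        q ^ (N - j) • (aa u n (j + 1) * FF u q n (N - j)) := by
      have := FF_rec (n := n) u q hq (N + 1) (by omega)
      rw [Fin.sum_univ_eq_sum_range (fun j => q ^ (N - j) • (aa u n (j + 1) * FF u q n (N - j)))
        (N + 1)]
      simp only [Nat.add_sub_cancel] at this
      rw [← this, smul_smul, inv_mul_cancel₀ (hq N), one_smul]
    rw [PB, h1, mul_smul_comm, mul_smul_comm, map_smul, map_smul, Finset.mul_sum, Finset.mul_sum,
      map_sum, map_sum]
    congr 1
    apply Finset.sum_congr rfl
    intro j _
    have := ih (N - j) (by omega) (α ++ [(j : ℕ) + 1])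
    rw [mul_smul_comm, mul_smul_comm, map_smul, map_smul]
    congr 1
    have e : wm (α ++ [(j : ℕ) + 1]) = wm α * X ((j : ℕ) + 1) := by simp [wm]
    rw [e] at this
    rw [← mul_assoc, this]
    simp [mul_assoc]

/-- Transfer principle: an identity valid in all commutative `ℚ`-algebras. -/
theorem transfer (h : NilB u n) (htr : ∀ X Y, φ (X * Y) = φ (Y * X)) (q : ℚ)
    (hq : ∀ k, 1 - q ^ (k + 1) ≠ 0) (N : ℕ) (d : ℚ)
    (hcomm : ∀ (Q : Type) [CommRing Q] [Algebra ℚ Q] (hh E F : ℕ → Q), hh 0 = 1 →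
      (∀ k, n < k → hh k = 0) → E 0 = 1 → (∀ k, n < k → E k = 0) →
      (∀ k, ∑ j ∈ Finset.range (k + 1 + 1), E j * hh (k + 1 - j) = 0) → F 0 = 1 →
      (∀ N, (1 - q ^ (N + 1)) • F (N + 1) =
        ∑ j ∈ Finset.range (N + 1), q ^ (N - j) • (hh (j + 1) * F (N - j))) →
      F N = d • hh n ^ n) :
    φ (FF u q n N) = d * φ (aa u n n ^ n) := by
  have hc : ∀ l l' : List ℕ, l.Perm l' → cc u n φ l = cc u n φ l' :=
    fun l l' hp => cc_perm h φ htr hp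
  set c := cc u n φ with hcdef
  set π := Ideal.Quotient.mkₐ ℚ (radI c) with hπ
  have hz : ∀ b : MvPolynomial ℕ ℚ, π b = 0 ↔ b ∈ radI c := fun b => Ideal.Quotient.eq_zero_iff_mem
  have h0 : π (X 0) = 1 := by
    rw [← sub_eq_zero, ← map_one π, ← map_sub, hz]
    apply mem_radI_of_wm
    intro α
    rw [mul_sub, mul_one, map_sub, mul_comm, ← wm_cons, tauB_wm hc, tauB_wm hc]
    simp [hcdef, cc, aa_zero]
  have key := hcomm (MvPolynomial ℕ ℚ ⧸ radI c) (fun k => π (X k)) (fun k => π (EB k))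
    (fun k => π (PB q k)) h0 ?_ (by simp [EB]) ?_ ?_ (by simp [PB]) ?_
  · have k2 : PB q N - d • X n ^ n ∈ radI c := by
      rw [← hz, map_sub, key, map_smul, map_pow, sub_self]
    have k3 := k2 1
    rw [one_mul, map_sub, map_smul, sub_eq_zero] at k3
    have k4 := PB_tau hc q hq N []
    simp only [wm, List.map_nil, List.prod_nil, one_mul] at k4
    rw [← k4, k3, smul_eq_mul]
    have k5 := tauB_wm hc (List.replicate n n)
    simp only [wm, List.map_replicate, List.prod_replicate] at k5
    rw [k5]
    simp [hcdef, cc]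
  · intro k hk
    show π (X k) = 0
    rw [hz]
    apply mem_radI_of_wm
    intro α
    rw [mul_comm, ← wm_cons, tauB_wm hc]
    simp [hcdef, cc, aa_big u n k hk]
  · intro k hk
    show π (EB k) = 0
    rw [hz]
    apply mem_radI_of_wm
    intro α
    rw [EB_tau hc h.sq, bb, BP_deg u n k hk, zero_mul, map_zero]
  · intro k
    rw [Finset.sum_range_succ, Nat.sub_self, h0, mul_one, EB, map_neg, map_sum,
      Fin.sum_univ_eq_sum_range (fun j => π (EB j * X (k + 1 - j))) (k + 1)]
    simp only [map_mul]
    exact add_neg_cancel _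
  · intro N
    show _ • π (PB q (N + 1)) = _
    rw [PB, map_smul, smul_smul, mul_inv_cancel₀ (hq N), one_smul, map_sum,
      Fin.sum_univ_eq_sum_range (fun j => π (q ^ (N - j) • (X (j + 1) * PB q (N - j)))) (N + 1)]
    simp only [map_smul, map_mul]

end Transfer
end BW

namespace BW

section Companion
open Polynomial Matrix

lemma exists_companion {Q : Type*} [CommRing Q] [Nontrivial Q] (P : Q[X]) (hP : P.Monic) (n : ℕ)
    (hn : P.natDegree = n) : ∃ (A : Matrix (Fin n) (Fin n) Q) (v : ℕ → Fin n → Q),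
      A.charpoly = P ∧ (∀ k a i, (A ^ k) a i = v (k + i) a) ∧
      (∀ l : Fin n, v l = Pi.single l 1) := by
  obtain ⟨b, hdim, hgen⟩ : ∃ b : PowerBasis Q (AdjoinRoot P), b.dim = n ∧
      b.gen = AdjoinRoot.root P := ⟨AdjoinRoot.powerBasis' hP, hn, rfl⟩
  subst hdim
  refine ⟨Algebra.leftMulMatrix b.basis b.gen, fun l a => b.basis.repr (b.gen ^ l) a, ?_, ?_, ?_⟩
  · have hd : (minpoly Q b.gen).natDegree = P.natDegree := by
      rw [← charpoly_leftMulMatrix, charpoly_natDegree_eq_dim, hn]; simp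
    have hm : (minpoly Q b.gen).Monic := by
      rw [← charpoly_leftMulMatrix]; exact charpoly_monic _
    have hdvd : P ∣ minpoly Q b.gen := by
      rw [← AdjoinRoot.mk_eq_zero, ← AdjoinRoot.aeval_eq, ← hgen]
      exact minpoly.aeval Q b.gen
    rw [charpoly_leftMulMatrix]
    exact (eq_of_monic_of_dvd_of_natDegree_le hP hm hdvd hd.le)
  · intro k a i
    rw [← map_pow, Algebra.leftMulMatrix_eq_repr_mul]
    rw [b.basis_eq_pow, ← pow_add]
  · intro l
    funext a
    have := b.basis_eq_pow l
    show b.basis.repr (b.gen ^ (l : ℕ)) a = _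
    rw [← this, Module.Basis.repr_self, Finsupp.single_apply, Pi.single_apply]
    simp [eq_comm]

lemma coeff_prod_of_le {ι Q : Type*} [CommRing Q] (s : Finset ι) (f : ι → Q[X]) (d : ι → ℕ)
    (h : ∀ i ∈ s, (f i).natDegree ≤ d i) :
    (∏ i ∈ s, f i).coeff (∑ i ∈ s, d i) = ∏ i ∈ s, (f i).coeff (d i) := by
  classical
  induction s using Finset.induction_on with
  | empty => simp
  | insert a s ha ih =>
    rw [Finset.prod_insert ha, Finset.sum_insert ha, Finset.prod_insert ha,
      coeff_mul_add_eq_of_natDegree_le (h a (by simp)), ih (fun i hi => h i (by simp [hi]))]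
    exact (natDegree_prod_le _ _).trans (Finset.sum_le_sum (fun i hi => h i (by simp [hi])))

lemma coeff_det_of_le {Q : Type*} [CommRing Q] (n : ℕ) (A : Matrix (Fin n) (Fin n) Q[X])
    (d : Fin n → ℕ) (h : ∀ i j, (A i j).natDegree ≤ d j) :
    A.det.coeff (∑ j, d j) = (Matrix.of fun i j => (A i j).coeff (d j)).det := by
  rw [det_apply, det_apply, finsetSum_coeff]
  apply Finset.sum_congr rfl
  intro σ _
  rw [coeff_smul, coeff_prod_of_le _ _ _ (fun i _ => h (σ i) i)]
  simp

end Companion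

section Psi
/-- coefficients of the q-exponential -/
def ps (q : ℚ) (k : ℕ) : ℚ := q ^ (k.choose 2) / ∏ l ∈ Finset.range k, (q ^ (l + 1) - 1)

lemma ps_zero (q : ℚ) : ps q 0 = 1 := by simp [ps]

lemma ps_succ (q : ℚ) (hq : ∀ k, q ^ (k + 1) - 1 ≠ 0) (k : ℕ) :
    ps q (k + 1) * (q ^ (k + 1) - 1) = q ^ k * ps q k := by
  unfold ps
  have h1 := hq k
  have h2 : ∏ l ∈ Finset.range k, (q ^ (l + 1) - 1) ≠ 0 :=
    Finset.prod_ne_zero_iff.2 (fun l _ => hq l)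
  rw [Finset.prod_range_succ, show (k + 1).choose 2 = k + k.choose 2 by
    rw [Nat.choose_succ_succ' k 1, Nat.choose_one_right], pow_add]
  field_simp

/-- the Jacobi–Trudi type matrix -/
def PsiM (q : ℚ) (n : ℕ) : Matrix (Fin n) (Fin n) ℚ := Matrix.of fun j i => ps q (n + j - i)

end Psi

section CommMain
open Polynomial Matrix
variable {Q : Type*} [CommRing Q] [Algebra ℚ Q]

/-- polynomial with given coefficients up to n -/
noncomputable def polyOf (n : ℕ) (h : ℕ → Q) : Q[X] := ∑ k ∈ Finset.range (n + 1), C (h k) * X ^ k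

lemma polyOf_coeff (n : ℕ) (h : ℕ → Q) (hb : ∀ k, n < k → h k = 0) (k : ℕ) :
    (polyOf n h).coeff k = h k := by
  simp only [polyOf, finsetSum_coeff, coeff_C_mul_X_pow]
  rw [Finset.sum_ite_eq]
  split_ifs with hk
  · rfl
  · rw [hb k (by simpa [Nat.lt_succ_iff] using hk)]

lemma polyOf_natDegree (n : ℕ) (h : ℕ → Q) : (polyOf n h).natDegree ≤ n := by
  apply natDegree_sum_le_of_forall_le
  intro i hi
  have := Finset.mem_range.1 hi
  exact (natDegree_C_mul_X_pow_le _ _).trans (by omega)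

/-- The matrix series. -/
noncomputable def MX (q : ℚ) (n : ℕ) (A : Matrix (Fin n) (Fin n) Q) : Matrix (Fin n) (Fin n) Q[X] :=
  ∑ k ∈ Finset.range (2 * n), (C (algebraMap ℚ Q (ps q k)) * X ^ k) • (A ^ k).map C

lemma MX_partial (q : ℚ) (hq : ∀ k, q ^ (k + 1) - 1 ≠ 0) (n : ℕ)
    (B : Matrix (Fin n) (Fin n) Q[X]) (N : ℕ) :
    (1 - (X : Q[X]) • B) * ∑ k ∈ Finset.range N, (C (algebraMap ℚ Q (q ^ k * ps q k)) * X ^ k) • B ^ k =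
      ∑ k ∈ Finset.range N, (C (algebraMap ℚ Q (ps q k)) * X ^ k) • B ^ k -
        (C (algebraMap ℚ Q ((q ^ N - 1) * ps q N)) * X ^ N) • B ^ N := by
  induction N with
  | zero =>
    rw [Finset.range_zero, Finset.sum_empty, Finset.sum_empty, mul_zero, pow_zero, sub_self, zero_mul,
      map_zero, map_zero, zero_mul, zero_smul, sub_zero]
  | succ N ih =>
    rw [Finset.sum_range_succ, mul_add, ih, Finset.sum_range_succ]
    have h1 : (q ^ (N + 1) - 1) * ps q (N + 1) = q ^ N * ps q N := by
      rw [mul_comm, ps_succ q hq]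
    have h3 : (1 - (X : Q[X]) • B) * (C (algebraMap ℚ Q (q ^ N * ps q N)) * X ^ N) • B ^ N =
        (C (algebraMap ℚ Q (q ^ N * ps q N)) * X ^ N) • B ^ N -
          (X * (C (algebraMap ℚ Q (q ^ N * ps q N)) * X ^ N)) • B ^ (N + 1) := by
      rw [sub_mul, one_mul, smul_mul_smul_comm, ← pow_succ']
    rw [h1, h3]
    have h2 : (C (algebraMap ℚ Q ((q ^ N - 1) * ps q N)) : Q[X]) =
      C (algebraMap ℚ Q (q ^ N * ps q N)) - C (algebraMap ℚ Q (ps q N)) := by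
      rw [← C_sub, ← map_sub]; congr 2; ring
    rw [h2, show (X : Q[X]) * (C (algebraMap ℚ Q (q ^ N * ps q N)) * X ^ N) =
      C (algebraMap ℚ Q (q ^ N * ps q N)) * X ^ (N + 1) by ring]
    module

lemma MX_rec (q : ℚ) (hq : ∀ k, q ^ (k + 1) - 1 ≠ 0) (n : ℕ) (A : Matrix (Fin n) (Fin n) Q)
    (hA : A ^ (2 * n) = 0) : MX q n A = (1 - (X : Q[X]) • A.map C) *
      (compRingHom (C (algebraMap ℚ Q q) * X)).mapMatrix (MX q n A) := by
  have hB : ∀ k, (A ^ k).map C = (A.map C : Matrix (Fin n) (Fin n) Q[X]) ^ k := fun k =>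
    map_pow (C.mapMatrix : Matrix (Fin n) (Fin n) Q →+* Matrix (Fin n) (Fin n) Q[X]) A k
  have h0 : (A.map C : Matrix (Fin n) (Fin n) Q[X]) ^ (2 * n) = 0 := by
    rw [← hB, hA]; ext i j; simp
  have := MX_partial q hq n (A.map C) (2 * n)
  rw [h0, smul_zero, sub_zero] at this
  have e : MX q n A = ∑ k ∈ Finset.range (2 * n), (C (algebraMap ℚ Q (ps q k)) * X ^ k) •
      (A.map C : Matrix (Fin n) (Fin n) Q[X]) ^ k := by
    unfold MX
    exact Finset.sum_congr rfl (fun k _ => by rw [hB])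
  conv_lhs => rw [e, ← this]
  congr 1
  unfold MX
  rw [map_sum]
  apply Finset.sum_congr rfl
  intro k _
  rw [← hB]
  ext i j : 1
  rw [RingHom.mapMatrix_apply, Matrix.map_apply, Matrix.smul_apply, Matrix.smul_apply,
    Matrix.map_apply, smul_eq_mul, smul_eq_mul, coe_compRingHom_apply, mul_comp, mul_comp, C_comp,
    C_comp, pow_comp, X_comp, mul_pow, map_mul, map_mul, map_pow, map_pow]
  ring

lemma polyOf_mul (n : ℕ) (h E : ℕ → Q) (h0 : h 0 = 1) (hb : ∀ k, n < k → h k = 0) (E0 : E 0 = 1)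
    (Eb : ∀ k, n < k → E k = 0)
    (hE : ∀ k, ∑ j ∈ Finset.range (k + 1 + 1), E j * h (k + 1 - j) = 0) :
    polyOf n E * polyOf n h = 1 := by
  ext k
  rw [coeff_mul, Finset.Nat.sum_antidiagonal_eq_sum_range_succ_mk]
  simp only [polyOf_coeff n h hb, polyOf_coeff n E Eb, coeff_one]
  rcases k with _ | k
  · simp [h0, E0]
  · rw [hE]; simp

/-- The main determinantal evaluation in a commutative algebra. -/
theorem comm_main [Nontrivial Q] (q : ℚ) (hq : ∀ k, q ^ (k + 1) - 1 ≠ 0) (n : ℕ) (hn : 0 < n)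
    (hdet : (PsiM q n).det ≠ 0)
    (h E F : ℕ → Q) (h0 : h 0 = 1) (hb : ∀ k, n < k → h k = 0) (E0 : E 0 = 1)
    (Eb : ∀ k, n < k → E k = 0)
    (hE : ∀ k, ∑ j ∈ Finset.range (k + 1 + 1), E j * h (k + 1 - j) = 0) (F0 : F 0 = 1)
    (hF : ∀ N, (1 - q ^ (N + 1)) • F (N + 1) =
        ∑ j ∈ Finset.range (N + 1), q ^ (N - j) • (h (j + 1) * F (N - j))) :
    F (n ^ 2) = ((PsiM q n).det * (-1) ^ n) • h n ^ n := by
  set P := reflect n (polyOf n h) with hPdef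
  have hPc : ∀ i ≤ n, P.coeff i = h (n - i) := by
    intro i hi
    rw [hPdef, coeff_reflect, revAt_le hi, polyOf_coeff n h hb]
  have hPd : P.natDegree ≤ n := by
    rw [natDegree_le_iff_coeff_eq_zero]
    intro i hi
    rw [hPdef, coeff_reflect, revAt_eq_self_of_lt hi, polyOf_coeff n h hb, hb i hi]
  have hPm : P.Monic := monic_of_natDegree_le_of_coeff_eq_one n hPd (by rw [hPc n le_rfl]; simpa using h0)
  have hPn : P.natDegree = n := by
    apply le_antisymm hPd
    apply le_natDegree_of_ne_zero
    rw [hPc n le_rfl, Nat.sub_self, h0]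
    exact one_ne_zero
  obtain ⟨A, v, hA, hv, hv0⟩ := exists_companion P hPm n hPn
  -- nilpotency
  have hnil : A ^ (2 * n) = 0 := by
    have h1 : reflect n (polyOf n E) * P = X ^ (n + n) := by
      rw [hPdef, ← reflect_mul _ _ (polyOf_natDegree n E) (polyOf_natDegree n h),
        polyOf_mul n h E h0 hb E0 Eb hE, reflect_one]
    have h2 := congrArg (aeval A) h1
    rw [map_mul, ← hA, aeval_self_charpoly, mul_zero, map_pow, aeval_X] at h2
    rw [two_mul, ← h2]
  -- the functional equation
  set g := (MX q n A).det with hg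
  have hrev : A.charpolyRev = polyOf n h := by
    rw [← reverse_charpoly, hA, reverse, hPn, hPdef, reflect_reflect]
  have hgf : g = polyOf n h * g.comp (C (algebraMap ℚ Q q) * X) := by
    have h1 := congrArg Matrix.det (MX_rec q hq n A hnil)
    rw [det_mul, ← RingHom.map_det] at h1
    rw [← hrev]
    exact h1
  have hg0 : g.coeff 0 = 1 := by
    rw [coeff_zero_eq_eval_zero, hg, ← coe_evalRingHom, RingHom.map_det]
    have : (evalRingHom 0).mapMatrix (MX q n A) = 1 := by
      unfold MX
      rw [map_sum]
      obtain ⟨m, hm⟩ : ∃ m, 2 * n = m + 1 := ⟨2 * n - 1, by omega⟩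
      rw [hm, Finset.sum_range_succ', Finset.sum_eq_zero, zero_add]
      · ext i j
        rw [RingHom.mapMatrix_apply, Matrix.map_apply, Matrix.smul_apply, Matrix.map_apply,
          smul_eq_mul, coe_evalRingHom, eval_mul, eval_mul, eval_pow, eval_X, eval_C, eval_C,
          ps_zero, map_one, pow_zero, pow_zero, one_mul, one_mul]
      · intro k _
        ext i j
        rw [RingHom.mapMatrix_apply, Matrix.map_apply, Matrix.smul_apply, Matrix.map_apply,
          smul_eq_mul, coe_evalRingHom, eval_mul, eval_mul, eval_pow, eval_X, pow_succ, mul_zero,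
          mul_zero, zero_mul, Matrix.zero_apply]
    rw [this, det_one]
  have hgF : ∀ N, g.coeff N = F N := by
    intro N
    induction N using Nat.strong_induction_on with
    | _ N ih =>
    rcases N with _ | N
    · rw [hg0, F0]
    · have h1 := congrArg (fun p => coeff p (N + 1)) hgf
      simp only [coeff_mul, comp_C_mul_X_coeff] at h1
      rw [Finset.Nat.sum_antidiagonal_eq_sum_range_succ_mk, Finset.sum_range_succ'] at h1
      simp only [polyOf_coeff n h hb, h0, one_mul, Nat.sub_zero] at h1
      have h2 : ∀ j ∈ Finset.range (N + 1), h (j + 1) * (g.coeff (N + 1 - (j + 1)) *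
          algebraMap ℚ Q q ^ (N + 1 - (j + 1))) = q ^ (N - j) • (h (j + 1) * F (N - j)) := by
        intro j _
        rw [show N + 1 - (j + 1) = N - j by omega, ih (N - j) (by omega), Algebra.smul_def, map_pow]
        ring
      rw [Finset.sum_congr rfl h2, ← hF] at h1
      have h3 : (1 - q ^ (N + 1)) • g.coeff (N + 1) = (1 - q ^ (N + 1)) • F (N + 1) := by
        rw [sub_smul, one_smul, sub_eq_iff_eq_add]
        conv_lhs => rw [h1]
        rw [Algebra.smul_def (q ^ (N + 1)), map_pow, mul_comm]
      have h4 : (1 - q ^ (N + 1)) ≠ 0 := fun h => hq N (by linarith)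
      have h5 := congrArg (fun z => (1 - q ^ (N + 1))⁻¹ • z) h3
      simpa [smul_smul, inv_mul_cancel₀ h4] using h5
  rw [← hgF]
  set ι : ℚ →+* Q[X] := (C : Q →+* Q[X]).comp (algebraMap ℚ Q) with hι
  have hιC : ∀ x, ι x = C (algebraMap ℚ Q x) := fun x => rfl
  set K : Matrix (Fin n) (Fin n) Q[X] := ι.mapMatrix ((PsiM q n)⁻¹) with hK
  set D : Matrix (Fin n) (Fin n) Q[X] := diagonal (fun i : Fin n => (X : Q[X]) ^ (i : ℕ)) with hD
  set L : Matrix (Fin n) (Fin n) Q[X] := Matrix.of fun a i : Fin n => ∑ l ∈ Finset.range n,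
    (if (i : ℕ) ≤ l then C (algebraMap ℚ Q (ps q (l - i)) * v l a) * X ^ l else 0) with hL
  set H : Matrix (Fin n) (Fin n) Q[X] := Matrix.of fun a j : Fin n =>
    C ((A ^ n) a j) * X ^ (n + (j : ℕ)) with hH
  have hvz : ∀ l a, 2 * n ≤ l → v l a = 0 := by
    intro l a hl
    have := hv l a ⟨0, hn⟩
    simp only [add_zero] at this
    rw [← this, show l = 2 * n + (l - 2 * n) by omega, pow_add, hnil, zero_mul, Matrix.zero_apply]
  have hMD : MX q n A * D = L + H * ι.mapMatrix (PsiM q n) := by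
    ext a i : 1
    set G : ℕ → Q[X] := fun l =>
      if (i : ℕ) ≤ l then C (algebraMap ℚ Q (ps q (l - i)) * v l a) * X ^ l else 0 with hG
    have e1 : (MX q n A * D) a i = ∑ k ∈ Finset.range (2 * n), G ((i : ℕ) + k) := by
      rw [hD, Matrix.mul_diagonal, MX, Matrix.sum_apply, Finset.sum_mul]
      apply Finset.sum_congr rfl
      intro k _
      rw [Matrix.smul_apply, Matrix.map_apply, hv, hG]
      simp only [Nat.le_add_right, if_true, Nat.add_sub_cancel_left, smul_eq_mul]
      rw [C_mul, pow_add, add_comm k]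
      ring
    have e2 : (L + H * ι.mapMatrix (PsiM q n)) a i = ∑ l ∈ Finset.range (2 * n), G l := by
      rw [Matrix.add_apply, two_mul, Finset.sum_range_add, Matrix.mul_apply,
        ← Fin.sum_univ_eq_sum_range (fun j => G (n + j))]
      congr 1
      apply Finset.sum_congr rfl
      intro j _
      have : (i : ℕ) ≤ n + j := by omega
      rw [hG]
      simp only [this, if_true]
      rw [RingHom.mapMatrix_apply, Matrix.map_apply, hH, Matrix.of_apply, hv, hιC, PsiM,
        Matrix.of_apply, C_mul]
      ring
    have e3 : ∑ l ∈ Finset.range (i + 2 * n), G l = ∑ k ∈ Finset.range (2 * n), G ((i : ℕ) + k) := by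
      rw [Finset.sum_range_add, Finset.sum_eq_zero, zero_add]
      intro l hl
      have := Finset.mem_range.1 hl
      rw [hG]
      exact if_neg (by omega)
    have e4 : ∑ l ∈ Finset.range (2 * n + i), G l = ∑ l ∈ Finset.range (2 * n), G l := by
      rw [Finset.sum_range_add]
      conv_rhs => rw [← add_zero (∑ l ∈ Finset.range (2 * n), G l)]
      congr 1
      apply Finset.sum_eq_zero
      intro l _
      rw [hG]
      simp only [hvz (2 * n + l) a (by omega), mul_zero, C_0, zero_mul, ite_self]
    rw [e1, e2, ← e3, add_comm, e4]
  have hKinv : ι.mapMatrix (PsiM q n) * K = 1 := by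
    rw [hK, ← map_mul, Matrix.mul_nonsing_inv _ (IsUnit.mk0 _ hdet), map_one]
  have hMDK : MX q n A * D * K = L * K + H := by
    rw [hMD, add_mul, mul_assoc, hKinv, mul_one]
  have hLdeg : ∀ a j, (L * K) a j ∈ degreeLT Q n := by
    intro a j
    rw [Matrix.mul_apply]
    apply Submodule.sum_mem
    intro i _
    rw [hK, RingHom.mapMatrix_apply, Matrix.map_apply, hιC, mul_comm, ← smul_eq_C_mul]
    apply Submodule.smul_mem
    rw [hL, Matrix.of_apply]
    apply Submodule.sum_mem
    intro l hl
    split_ifs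
    · rw [mem_degreeLT]
      exact (degree_C_mul_X_pow_le _ _).trans_lt (by exact_mod_cast Finset.mem_range.1 hl)
    · exact Submodule.zero_mem _
  have hdeg : ∀ a j, ((L * K + H) a j).natDegree ≤ n + (j : ℕ) := by
    intro a j
    rw [Matrix.add_apply]
    apply natDegree_add_le_of_degree_le
    · exact (natDegree_le_of_degree_le (mem_degreeLT.1 (hLdeg a j)).le).trans (by omega)
    · exact natDegree_C_mul_X_pow_le _ _
  have hco : (Matrix.of fun a j => ((L * K + H) a j).coeff (n + (j : ℕ))) = A ^ n := by
    ext a j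
    rw [Matrix.of_apply, Matrix.add_apply, coeff_add, hH, Matrix.of_apply, coeff_C_mul_X_pow,
      if_pos rfl, coeff_eq_zero_of_degree_lt, zero_add]
    exact (mem_degreeLT.1 (hLdeg a j)).trans_le (by exact_mod_cast Nat.le_add_right _ _)
  have hfin := coeff_det_of_le n (L * K + H) (fun j => n + (j : ℕ)) hdeg
  rw [hco, ← hMDK, det_mul, det_mul, hK, ← RingHom.map_det, hD, det_diagonal,
    Finset.prod_pow_eq_pow_sum, Finset.sum_add_distrib, hιC, mul_assoc, mul_comm (X ^ _),
    ← mul_assoc, coeff_mul_X_pow, mul_comm, coeff_C_mul, det_pow, det_eq_sign_charpoly_coeff A, hA,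
    hPc 0 (Nat.zero_le _), Finset.sum_const, Finset.card_univ, Fintype.card_fin, smul_eq_mul,
    ← sq, Nat.sub_zero, det_nonsing_inv, Ring.inverse_eq_inv', ← hg, mul_pow, ← pow_mul] at hfin
  have hsg : ((-1 : Q)) ^ (n * n) = (-1) ^ n := by
    rw [pow_mul]
    rcases Nat.even_or_odd n with he | ho
    · rw [he.neg_one_pow, one_pow]
    · rw [ho.neg_one_pow, ho.neg_one_pow]
  rw [hsg] at hfin
  rw [mul_smul, Algebra.smul_def, Algebra.smul_def, map_pow, map_neg, map_one, ← hfin, ← mul_assoc,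
    ← map_mul, mul_inv_cancel₀ hdet, map_one, one_mul]

end CommMain
end BW

namespace BW
section Delta
open Polynomial Matrix

/-- product of q^l-1 -/
def fa (q : ℚ) (k : ℕ) : ℚ := ∏ l ∈ Finset.range k, (q ^ (l + 1) - 1)

lemma fa_ne (q : ℚ) (hq : ∀ k, q ^ (k + 1) - 1 ≠ 0) (k : ℕ) : fa q k ≠ 0 :=
  Finset.prod_ne_zero_iff.2 (fun l _ => hq l)

lemma ps_row (q : ℚ) (hq0 : q ≠ 0) (hq : ∀ k, q ^ (k + 1) - 1 ≠ 0) (N b : ℕ) (hb : b ≤ N) :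
    ps q (N - b) = ps q N * (((-1) ^ b * q ^ ((b + 1).choose 2)) *
      ∏ s ∈ Finset.range b, ((q ^ N)⁻¹ - (q ^ s)⁻¹)) := by
  induction b with
  | zero => simp
  | succ b ih =>
    have ih := ih (by omega)
    obtain ⟨m, rfl⟩ : ∃ m, N = b + 1 + m := ⟨N - (b + 1), by omega⟩
    rw [show b + 1 + m - (b + 1) = m by omega]
    rw [show b + 1 + m - b = m + 1 by omega] at ih
    have h1 := ps_succ q hq m
    rw [ih] at h1
    have h2 : ps q m = (q ^ m)⁻¹ * (q ^ m * ps q m) := by field_simp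
    rw [h2, ← h1, Finset.prod_range_succ, show (b + 1 + 1).choose 2 = (b + 1) + (b + 1).choose 2 by
      rw [Nat.choose_succ_succ' (b + 1) 1, Nat.choose_one_right]]
    generalize ∏ s ∈ Finset.range b, ((q ^ (b + 1 + m))⁻¹ - (q ^ s)⁻¹) = Z
    generalize (b + 1).choose 2 = c
    simp only [pow_add, pow_one]
    field_simp
    ring

lemma det_PsiM (q : ℚ) (hq0 : q ≠ 0) (hq : ∀ k, q ^ (k + 1) - 1 ≠ 0) (n : ℕ) :
    (PsiM q n).det = q ^ (n * n.choose 2) * ∏ b ∈ Finset.range n, (fa q b / fa q (n + b)) := by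
  set z : Fin n → ℚ := fun a => (q ^ (n + (a : ℕ)))⁻¹ with hz
  set p : Fin n → ℚ[X] := fun b => ∏ s ∈ Finset.range (b : ℕ), (X - C ((q ^ s)⁻¹)) with hp
  have hpm : ∀ b, (p b).Monic := fun b => monic_prod_of_monic _ _ (fun s _ => monic_X_sub_C _)
  have hpd : ∀ b, (p b).natDegree = b := by
    intro b
    rw [hp]
    simp only
    rw [natDegree_prod_of_monic _ _ (fun s _ => monic_X_sub_C _)]
    simp
  have h1 : PsiM q n = Matrix.of fun a b : Fin n => ps q (n + (a : ℕ)) *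
      (Matrix.of fun a b : Fin n => ((-1) ^ (b : ℕ) * q ^ (((b : ℕ) + 1).choose 2)) *
        (Matrix.of fun a b : Fin n => (p b).eval (z a)) a b) a b := by
    ext a b
    simp only [PsiM, Matrix.of_apply]
    rw [ps_row q hq0 hq _ _ (by omega), hp, hz]
    simp only [eval_prod, eval_sub, eval_X, eval_C]
  rw [h1, det_mul_column, det_mul_row, ← det_eval_matrixOfPolynomials_eq_det_vandermonde z p hpd hpm,
    det_vandermonde]
  have h2 : ∏ i : Fin n, ∏ j ∈ Finset.Ioi i, (z j - z i) =
      ∏ b ∈ Finset.range n, ∏ a ∈ Finset.range b, ((q ^ (n + b))⁻¹ - (q ^ (n + a))⁻¹) := by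
    rw [← Fin.prod_univ_eq_prod_range (fun b => ∏ a ∈ Finset.range b, ((q ^ (n + b))⁻¹ - (q ^ (n + a))⁻¹))]
    rw [Finset.prod_comm' (t' := Finset.univ) (s' := fun j => Finset.Iio j) (by simp)]
    apply Finset.prod_congr rfl
    intro b _
    rw [← Nat.Iio_eq_range, ← Fin.map_valEmbedding_Iio, Finset.prod_map]
    rfl
  have h3 : ∀ b : ℕ, ∏ a ∈ Finset.range b, ((q ^ (n + b))⁻¹ - (q ^ (n + a))⁻¹) =
      (-1) ^ b * (q ^ (b * (n + b)))⁻¹ * fa q b := by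
    intro b
    rw [fa, ← Finset.prod_range_reflect (fun l => q ^ (l + 1) - 1)]
    have : (-1 : ℚ) ^ b * (q ^ (b * (n + b)))⁻¹ = ∏ a ∈ Finset.range b, (- (q ^ (n + b))⁻¹) := by
      rw [Finset.prod_const, Finset.card_range, neg_pow (q ^ (n + b))⁻¹, mul_comm b, pow_mul, inv_pow]
    rw [this, ← Finset.prod_mul_distrib]
    apply Finset.prod_congr rfl
    intro a ha
    have ha := Finset.mem_range.1 ha
    obtain ⟨c, rfl⟩ : ∃ c, b = a + 1 + c := ⟨b - (a + 1), by omega⟩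
    rw [show a + 1 + c - 1 - a + 1 = c + 1 by omega]
    simp only [pow_add, pow_one]
    field_simp
    ring
  rw [h2, Fin.prod_univ_eq_prod_range (fun a => ps q (n + a)),
    Fin.prod_univ_eq_prod_range (fun b => (-1 : ℚ) ^ b * q ^ ((b + 1).choose 2)),
    ← Finset.prod_mul_distrib, ← Finset.prod_mul_distrib, mul_comm n, pow_mul]
  conv_rhs => rw [← Finset.card_range n, ← Finset.prod_const, Finset.card_range,
    ← Finset.prod_mul_distrib]
  apply Finset.prod_congr rfl
  intro b _
  have hps : ps q (n + b) = q ^ ((n + b).choose 2) / fa q (n + b) := rfl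
  rw [h3, hps]
  have hs : ((-1 : ℚ) ^ b) * (-1) ^ b = 1 := by rw [← mul_pow]; simp
  have hf := fa_ne q hq (n + b)
  have he : (n + b).choose 2 + (b + 1).choose 2 = n.choose 2 + b * (n + b) := by
    clear hf hs hps
    clear * -
    induction b with
    | zero => simp
    | succ b ih =>
      have e1 : (n + (b + 1)).choose 2 = (n + b) + (n + b).choose 2 := by
        rw [← add_assoc, Nat.choose_succ_succ' (n + b) 1, Nat.choose_one_right]
      have e2 : (b + 1 + 1).choose 2 = (b + 1) + (b + 1).choose 2 := by
        rw [Nat.choose_succ_succ' (b + 1) 1, Nat.choose_one_right]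
      rw [e1, e2]
      nlinarith
  have he' : q ^ ((n + b).choose 2) * q ^ ((b + 1).choose 2) = q ^ (n.choose 2) * q ^ (b * (n + b)) := by
    rw [← pow_add, he, pow_add]
  have hne : q ^ (b * (n + b)) ≠ 0 := pow_ne_zero _ hq0
  calc _ = (q ^ ((n + b).choose 2) * q ^ ((b + 1).choose 2)) * ((-1 : ℚ) ^ b * (-1) ^ b) *
        (q ^ (b * (n + b)))⁻¹ * (fa q b / fa q (n + b)) := by ring
    _ = _ := by rw [he', hs]; field_simp

lemma prod_tri {K : Type*} [CommMonoid K] (f : ℕ → K) (n : ℕ) :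
    ∏ b ∈ Finset.range n, ∏ l ∈ Finset.range b, f l = ∏ l ∈ Finset.range n, f l ^ (n - 1 - l) := by
  induction n with
  | zero => simp
  | succ n ih =>
    rw [Finset.prod_range_succ, ih, ← Finset.prod_mul_distrib, Finset.prod_range_succ]
    simp only [Nat.add_sub_cancel, Nat.sub_self, pow_zero, mul_one]
    apply Finset.prod_congr rfl
    intro l hl
    have := Finset.mem_range.1 hl
    rw [← pow_succ]
    congr 1
    omega

lemma hook_count {K : Type*} [CommMonoid K] (f : ℕ → K) (n : ℕ) :
    ∏ b ∈ Finset.range n, ∏ l ∈ Finset.range (n + b), f (l + 1) =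
    (∏ b ∈ Finset.range n, ∏ l ∈ Finset.range b, f (l + 1)) *
      (f n ^ n * ∏ i ∈ Finset.Icc 1 (n - 1), (f i * f (2 * n - i)) ^ i) := by
  rcases n with _ | m
  · simp
  have e1 : ∀ g : ℕ → K, ∏ i ∈ Finset.Icc 1 (m + 1 - 1), g i = ∏ l ∈ Finset.range m, g (l + 1) := by
    intro g
    rw [show Finset.Icc 1 (m + 1 - 1) = Finset.Ico 1 (m + 1) from rfl,
      Finset.prod_Ico_eq_prod_range]
    exact Finset.prod_congr rfl (fun l _ => by rw [add_comm])
  have e2 : ∏ l ∈ Finset.range m, f (m + 1 + l + 1) ^ (m - l) =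
      ∏ l ∈ Finset.range m, f (2 * (m + 1) - (l + 1)) ^ (l + 1) := by
    rw [← Finset.prod_range_reflect]
    apply Finset.prod_congr rfl
    intro l hl
    have := Finset.mem_range.1 hl
    congr 1
    · congr 1; omega
    · omega
  have e3 : (∏ l ∈ Finset.range m, f (l + 1) ^ (m - l)) * ∏ l ∈ Finset.range m, f (l + 1) ^ (l + 1) =
      (∏ l ∈ Finset.range m, f (l + 1)) ^ (m + 1) := by
    rw [← Finset.prod_mul_distrib, ← Finset.prod_pow]
    apply Finset.prod_congr rfl
    intro l hl
    have := Finset.mem_range.1 hl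
    rw [← pow_add]
    congr 1; omega
  rw [e1]
  have e4 : ∀ b ∈ Finset.range (m + 1), ∏ l ∈ Finset.range (m + 1 + b), f (l + 1) =
      (∏ l ∈ Finset.range (m + 1), f (l + 1)) * ∏ l ∈ Finset.range b, f (m + 1 + l + 1) :=
    fun b _ => Finset.prod_range_add _ _ _
  rw [Finset.prod_congr rfl e4]
  simp only [Finset.prod_mul_distrib, Finset.prod_const, Finset.card_range, mul_pow]
  rw [prod_tri (fun l => f (l + 1)), prod_tri (fun l => f (m + 1 + l + 1)),
    Finset.prod_range_succ _ m, Finset.prod_range_succ _ m, Finset.prod_range_succ _ m]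
  simp only [Nat.add_sub_cancel, Nat.sub_self, pow_zero, mul_one]
  rw [e2, mul_pow, ← e3]
  ac_rfl

end Delta
end BW

namespace BW
section MainQ
open Finset

theorem main_q {R : Type*} [Ring R] [Algebra ℚ R] {u : ℕ → R} {n : ℕ} (h : NilB u n) (φ : R →ₗ[ℚ] ℚ)
    (htr : ∀ X Y, φ (X * Y) = φ (Y * X)) (q : ℚ) (hq0 : q ≠ 0) (hq : ∀ k, q ^ (k + 1) - 1 ≠ 0)
    (h1 : φ (aa u n n ^ n) = 1) :
    qp q (n ^ 2) * φ (FF u q n (n ^ 2)) *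
      ((q ^ n - 1) ^ n * ∏ i ∈ Finset.Icc 1 (n - 1), ((q ^ i - 1) * (q ^ (2 * n - i) - 1)) ^ i) =
    q ^ (n * n.choose 2) * fa q (n ^ 2) := by
  have hdet := det_PsiM q hq0 hq n
  have hdet0 : (PsiM q n).det ≠ 0 := by
    rw [hdet]
    exact mul_ne_zero (pow_ne_zero _ hq0) (Finset.prod_ne_zero_iff.2
      (fun b _ => div_ne_zero (fa_ne q hq _) (fa_ne q hq _)))
  have ht := transfer (φ := φ) h htr q (fun k hk => hq k (by linarith)) (n ^ 2) ((PsiM q n).det * (-1) ^ n) (by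
    intro Q _ _ hh E F h0 hb E0 Eb hE F0 hF
    rcases subsingleton_or_nontrivial Q with hs | hs
    · exact Subsingleton.elim _ _
    rcases Nat.eq_zero_or_pos n with rfl | hn
    · simp [F0]
    · exact comm_main q hq n hn hdet0 hh E F h0 hb E0 Eb hE F0 hF)
  rw [ht, h1, mul_one]
  have hqp : qp q (n ^ 2) = (-1) ^ n * fa q (n ^ 2) := by
    have : ((-1 : ℚ)) ^ (n ^ 2) = (-1) ^ n := by
      rw [sq, pow_mul]
      rcases Nat.even_or_odd n with he | ho
      · rw [he.neg_one_pow, one_pow]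
      · rw [ho.neg_one_pow, ho.neg_one_pow]
    rw [← this, qp, fa]
    conv_rhs => rw [← Finset.card_range (n ^ 2), ← Finset.prod_const, Finset.card_range,
      ← Finset.prod_mul_distrib]
    exact Finset.prod_congr rfl (fun l _ => by ring)
  have hc := hook_count (fun k => q ^ k - 1) n
  have hs : ((-1 : ℚ) ^ n) * (-1) ^ n = 1 := by rw [← mul_pow]; simp
  have hA : ∏ b ∈ Finset.range n, fa q b ≠ 0 := Finset.prod_ne_zero_iff.2 (fun b _ => fa_ne q hq _)
  have hB : ∏ b ∈ Finset.range n, fa q (n + b) ≠ 0 := Finset.prod_ne_zero_iff.2 (fun b _ => fa_ne q hq _)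
  rw [hqp, hdet, Finset.prod_div_distrib]
  change ∏ b ∈ Finset.range n, fa q (n + b) = (∏ b ∈ Finset.range n, fa q b) * _ at hc
  generalize (q ^ n - 1) ^ n * ∏ i ∈ Finset.Icc 1 (n - 1), ((q ^ i - 1) * (q ^ (2 * n - i) - 1)) ^ i = D at *
  rw [hc] at hB ⊢
  have hD : D ≠ 0 := fun h => hB (by rw [h, mul_zero])
  calc _ = ((-1 : ℚ) ^ n * (-1) ^ n) * fa q (n ^ 2) * q ^ (n * n.choose 2) *
      (((∏ b ∈ Finset.range n, fa q b) / ((∏ b ∈ Finset.range n, fa q b) * D)) * D) := by ring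
    _ = _ := by
      rw [hs, show ((∏ b ∈ Finset.range n, fa q b) / ((∏ b ∈ Finset.range n, fa q b) * D)) * D = 1 by
        field_simp]
      ring

end MainQ
end BW

namespace BW
section NormalForm
variable {W : Type*} [Group W]

/-- Type B relations for a sequence of elements, `t 0` being the special one. -/
structure RelB (t : ℕ → W) (n : ℕ) : Prop where
  sq : ∀ i, t i * t i = 1
  far : ∀ i j, i + 2 ≤ j → t i * t j = t j * t i
  br3 : ∀ i, 1 ≤ i → i + 1 < n → t i * t (i + 1) * t i = t (i + 1) * t i * t (i + 1)
  br4 : 1 < n → t 0 * t 1 * t 0 * t 1 = t 1 * t 0 * t 1 * t 0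

/-- `t_i t_{i+1} ⋯ t_{i+m-1}` -/
def asc (t : ℕ → W) : ℕ → ℕ → W
  | _, 0 => 1
  | i, m + 1 => t i * asc t (i + 1) m

/-- `t_i ⋯ t_1 t_0 t_1 ⋯ t_k` -/
def updn (t : ℕ → W) (k : ℕ) : ℕ → W
  | 0 => asc t 0 (k + 1)
  | i + 1 => t (i + 1) * updn t k i

variable {t : ℕ → W} {n : ℕ}

lemma asc_far (h : RelB t n) (j : ℕ) (m : ℕ) : ∀ i, j + 2 ≤ i → t j * asc t i m = asc t i m * t j := by
  induction m with
  | zero => intro i _; simp [asc]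
  | succ m ih =>
    intro i hi
    rw [asc, ← mul_assoc, h.far j i hi, mul_assoc, ih (i + 1) (by omega), mul_assoc]

lemma asc_shift (h : RelB t n) (m : ℕ) : ∀ i j, i < j → j < i + m → 2 ≤ j → i + m ≤ n →
    t j * asc t i m = asc t i m * t (j - 1) := by
  induction m with
  | zero => intro i j h1 h2; omega
  | succ m ih =>
    intro i j h1 h2 h3 h4
    rcases Nat.lt_or_ge (i + 1) j with h5 | h5
    · rw [asc, ← mul_assoc, ← h.far i j h5, mul_assoc, ih (i + 1) j h5 (by omega) h3 (by omega),
        mul_assoc]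
    · obtain rfl : j = i + 1 := by omega
      obtain ⟨m, rfl⟩ : ∃ m', m = m' + 1 := ⟨m - 1, by omega⟩
      rw [asc, asc, Nat.add_sub_cancel]
      have := h.br3 i (by omega) (by omega)
      rw [← mul_assoc, ← mul_assoc, ← this, mul_assoc (t i * t (i + 1)), asc_far h i m _ (by omega)]
      simp only [mul_assoc]

lemma updn_shift (h : RelB t n) (k : ℕ) (hk : k + 1 ≤ n) (i : ℕ) : ∀ j, i + 1 < j → j ≤ k →
    t j * updn t k i = updn t k i * t (j - 1) := by
  induction i with
  | zero => intro j h1 h2; exact asc_shift h _ _ _ (by omega) (by omega) (by omega) (by omega)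
  | succ i ih =>
    intro j h1 h2
    rw [updn, ← mul_assoc, ← h.far (i + 1) j (by omega), mul_assoc, ih j (by omega) h2, mul_assoc]

lemma updn_comm (h : RelB t n) (k : ℕ) (hk : k + 1 ≤ n) (i : ℕ) : ∀ j, j < i → i ≤ k →
    t j * updn t k i = updn t k i * t j := by
  induction i with
  | zero => intro j h1; omega
  | succ i ih =>
    intro j h1 h2
    rcases Nat.lt_or_ge j i with h3 | h3
    · rw [updn, ← mul_assoc, h.far j (i + 1) (by omega), mul_assoc, ih j h3 (by omega), mul_assoc]
    · obtain rfl : j = i := by omega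
      rcases j with _ | j
      · obtain ⟨k, rfl⟩ : ∃ m', k = m' + 1 := ⟨k - 1, by omega⟩
        simp only [updn, asc]
        have := h.br4 (by omega)
        rw [← mul_assoc, ← mul_assoc, ← mul_assoc, zero_add, this,
          mul_assoc (t 1 * t 0 * t 1), asc_far h 0 _ _ (by omega)]
        simp only [mul_assoc]
      · rw [updn, updn]
        have := h.br3 (j + 1) (by omega) (by omega)
        rw [← mul_assoc, ← mul_assoc, this, mul_assoc (t (j + 1 + 1) * t (j + 1)),
          updn_shift h k hk j _ (by omega) (by omega)]
        simp only [mul_assoc, Nat.add_sub_cancel]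

/-- normal forms with cost -/
inductive NF (t : ℕ → W) : ℕ → W → ℕ → Prop
  | zero : NF t 0 1 0
  | dn {k : ℕ} {v : W} {m : ℕ} (i : ℕ) : NF t k v m → 1 ≤ i → i ≤ k + 1 →
      NF t (k + 1) (asc t i (k + 1 - i) * v) (m + (k + 1 - i))
  | up {k : ℕ} {v : W} {m : ℕ} (i : ℕ) : NF t k v m → i ≤ k →
      NF t (k + 1) (updn t k i * v) (m + (k + 1 + i))

lemma NF_mul (h : RelB t n) {k : ℕ} {w : W} {m : ℕ} (hw : NF t k w m) : k ≤ n → ∀ j, j < k →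
    ∃ m', NF t k (t j * w) m' := by
  induction hw with
  | zero => intro _ j hj; omega
  | @dn k v m i hv h1 h2 ih =>
    intro hk j hj
    rcases Nat.lt_or_ge (j + 1) i with h3 | h3
    · obtain ⟨m', hm'⟩ := ih (by omega) j (by omega)
      rw [← mul_assoc, asc_far h j _ i (by omega), mul_assoc]
      exact ⟨_, NF.dn i hm' h1 h2⟩
    rcases Nat.lt_or_ge i j with h4 | h4
    · obtain ⟨m', hm'⟩ := ih (by omega) (j - 1) (by omega)
      rw [← mul_assoc, asc_shift h _ i j h4 (by omega) (by omega) (by omega), mul_assoc]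
      exact ⟨_, NF.dn i hm' h1 h2⟩
    rcases Nat.eq_or_lt_of_le h4 with rfl | h5
    · obtain ⟨d, hd⟩ : ∃ d, k + 1 - j = d + 1 := ⟨k - j, by omega⟩
      rw [hd, asc, ← mul_assoc, ← mul_assoc, h.sq, one_mul]
      obtain rfl : d = k + 1 - (j + 1) := by omega
      exact ⟨_, NF.dn (j + 1) hv (by omega) (by omega)⟩
    · obtain rfl : i = j + 1 := by omega
      have e : t j * (asc t (j + 1) (k + 1 - (j + 1)) * v) = asc t j (k + 1 - j) * v := by
        obtain ⟨d, hd⟩ : ∃ d, k + 1 - j = d + 1 := ⟨k - j, by omega⟩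
        obtain rfl : d = k + 1 - (j + 1) := by omega
        rw [hd, asc, mul_assoc]
      rw [e]
      rcases Nat.eq_zero_or_pos j with rfl | hj0
      · exact ⟨_, NF.up 0 hv (by omega)⟩
      · exact ⟨_, NF.dn j hv (by omega) (by omega)⟩
  | @up k v m i hv h1 ih =>
    intro hk j hj
    rcases Nat.lt_or_ge j i with h3 | h3
    · obtain ⟨m', hm'⟩ := ih (by omega) j (by omega)
      rw [← mul_assoc, updn_comm h k hk i j h3 h1, mul_assoc]
      exact ⟨_, NF.up i hm' h1⟩
    rcases Nat.lt_or_ge (i + 1) j with h4 | h4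
    · obtain ⟨m', hm'⟩ := ih (by omega) (j - 1) (by omega)
      rw [← mul_assoc, updn_shift h k hk i j h4 (by omega), mul_assoc]
      exact ⟨_, NF.up i hm' h1⟩
    rcases Nat.eq_or_lt_of_le h3 with rfl | h5
    · rcases i with _ | i
      · rw [updn, asc, ← mul_assoc, ← mul_assoc, h.sq, one_mul]
        exact ⟨_, NF.dn 1 hv le_rfl (by omega)⟩
      · rw [updn, ← mul_assoc, ← mul_assoc, h.sq, one_mul]
        exact ⟨_, NF.up i hv (by omega)⟩
    · obtain rfl : j = i + 1 := by omega
      rw [← mul_assoc]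
      exact ⟨_, NF.up (i + 1) hv (by omega)⟩

lemma NF_one (t : ℕ → W) (k : ℕ) : NF t k 1 0 := by
  induction k with
  | zero => exact NF.zero
  | succ k ih =>
    have := NF.dn (k + 1) ih (by omega) le_rfl
    simpa [asc] using this

/-- longest normal form -/
def wst (t : ℕ → W) : ℕ → W
  | 0 => 1
  | k + 1 => updn t k k * wst t k

lemma NF_bound {k : ℕ} {w : W} {m : ℕ} (hw : NF t k w m) : m ≤ k ^ 2 ∧ (m = k ^ 2 → w = wst t k) := by
  induction hw with
  | zero => simp [wst]
  | @dn k v m i hv h1 h2 ih =>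
    have : (k + 1) ^ 2 = k ^ 2 + (2 * k + 1) := by ring
    constructor
    · omega
    · intro h; omega
  | @up k v m i hv h1 ih =>
    have : (k + 1) ^ 2 = k ^ 2 + (2 * k + 1) := by ring
    constructor
    · omega
    · intro h
      obtain rfl : i = k := by omega
      rw [wst, ih.2 (by omega)]

lemma NF_len {ℓ : W → ℕ} (h1 : ℓ 1 = 0) (hs : ∀ i w, ℓ (t i * w) ≤ ℓ w + 1) {k : ℕ} {w : W} {m : ℕ}
    (hw : NF t k w m) : ℓ w ≤ m := by
  have ha : ∀ m i v, ℓ (asc t i m * v) ≤ ℓ v + m := by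
    intro m
    induction m with
    | zero => intro i v; simp [asc]
    | succ m ih =>
      intro i v
      rw [asc, mul_assoc]
      have := hs i (asc t (i + 1) m * v)
      have := ih (i + 1) v
      omega
  have hu : ∀ k i v, ℓ (updn t k i * v) ≤ ℓ v + (k + 1 + i) := by
    intro k i v
    induction i with
    | zero => exact ha _ _ _
    | succ i ih =>
      rw [updn, mul_assoc]
      have := hs (i + 1) (updn t k i * v)
      omega
  induction hw with
  | zero => simp [h1]
  | @dn k v m i hv h1 h2 ih => have := ha (k + 1 - i) i v; omega
  | @up k v m i hv h1 ih => have := hu k i v; omega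

end NormalForm
end BW

namespace BW
section Rep

lemma B_apply (n : ℕ) (i j : Fin n) : (CoxeterMatrix.B n) i j =
    if (i : ℕ) = j then 1 else if ((i : ℕ) + 1 = n ∧ (j : ℕ) + 2 = n) ∨ ((j : ℕ) + 1 = n ∧ (i : ℕ) + 2 = n)
      then 4 else if (j : ℕ) + 1 = i ∨ (i : ℕ) + 1 = j then 3 else 2 := by
  change (if i = j then 1
      else (if (i : ℕ) = n - 1 ∧ (j : ℕ) = n - 2 ∨ (j : ℕ) = n - 1 ∧ (i : ℕ) = n - 2 then 4
        else (if (j : ℕ) + 1 = i ∨ (i : ℕ) + 1 = j then 3 else 2))) = _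
  have := i.2
  have := j.2
  simp only [Fin.ext_iff]
  split_ifs <;> first | rfl | omega

/-- generators acting on sequences -/
def gen (n a : ℕ) (y : ℕ → ℤ) : ℕ → ℤ := fun k =>
  if a + 1 = n then (if k = a then - y k else y k)
  else if k = a then y (a + 1) else if k = a + 1 then y a else y k

lemma gen_invol (n a : ℕ) : Function.Involutive (gen n a) := by
  intro y
  funext k
  unfold gen
  grind

def genP (n a : ℕ) : Equiv.Perm (ℕ → ℤ) := (gen_invol n a).toPerm

lemma genP_apply (n a : ℕ) (y : ℕ → ℤ) : genP n a y = gen n a y := rfl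

lemma gen_far (n a b : ℕ) (hb : b < n) (h : a + 2 ≤ b) (y : ℕ → ℤ) :
    gen n a (gen n b y) = gen n b (gen n a y) := by
  funext k
  unfold gen
  grind

lemma gen_br3 (n a : ℕ) (h : a + 2 < n) (y : ℕ → ℤ) :
    gen n a (gen n (a + 1) (gen n a y)) = gen n (a + 1) (gen n a (gen n (a + 1) y)) := by
  funext k
  unfold gen
  grind

lemma gen_br4 (n a : ℕ) (h : a + 2 = n) (y : ℕ → ℤ) :
    gen n a (gen n (a + 1) (gen n a (gen n (a + 1) y))) =
     gen n (a + 1) (gen n a (gen n (a + 1) (gen n a y))) := by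
  funext k
  unfold gen
  grind

lemma pow2_of {G : Type*} [Group G] {x y : G} (hx : x * x = 1) (hy : y * y = 1)
    (h : x * y = y * x) : (x * y) ^ 2 = 1 := by
  rw [sq]
  nth_rewrite 2 [h]
  rw [mul_assoc, ← mul_assoc y, hy, one_mul, hx]

lemma pow3_of {G : Type*} [Group G] {x y : G} (hx : x * x = 1) (hy : y * y = 1)
    (h : x * y * x = y * x * y) : (x * y) ^ 3 = 1 := by
  have : (x * y) ^ 3 = (x * y * x) * (y * x * y) := by simp only [pow_succ, pow_zero, one_mul, mul_assoc]
  rw [this, ← h]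
  have : x * y * x * (x * y * x) = x * (y * (x * x) * y) * x := by simp only [mul_assoc]
  rw [this, hx, mul_one, hy, mul_one, hx]

lemma pow4_of {G : Type*} [Group G] {x y : G} (hx : x * x = 1) (hy : y * y = 1)
    (h : x * y * x * y = y * x * y * x) : (x * y) ^ 4 = 1 := by
  have : (x * y) ^ 4 = (x * y * x * y) * (x * y * x * y) := by
    simp only [pow_succ, pow_zero, one_mul, mul_assoc]
  rw [this]
  nth_rewrite 2 [h]
  have : x * y * x * y * (y * x * y * x) = x * (y * (x * (y * y) * x) * y) * x := by
    simp only [mul_assoc]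
  rw [this, hy, mul_one, hx, mul_one, hy, mul_one, hx]

lemma genP_lift (n : ℕ) : (CoxeterMatrix.B n).IsLiftable (fun i : Fin n => genP n i) := by
  have hs : ∀ a, genP n a * genP n a = 1 := fun a => Equiv.ext (fun y => gen_invol n a y)
  have hfar : ∀ a b, b < n → a + 2 ≤ b → genP n a * genP n b = genP n b * genP n a :=
    fun a b hb h => Equiv.ext (fun y => gen_far n a b hb h y)
  have hb3 : ∀ a, a + 2 < n → genP n a * genP n (a + 1) * genP n a =
      genP n (a + 1) * genP n a * genP n (a + 1) := fun a h => Equiv.ext (fun y => gen_br3 n a h y)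
  have hb4 : ∀ a, a + 2 = n → genP n a * genP n (a + 1) * genP n a * genP n (a + 1) =
      genP n (a + 1) * genP n a * genP n (a + 1) * genP n a := fun a h => Equiv.ext (fun y => gen_br4 n a h y)
  intro i j
  have hi := i.2
  have hj := j.2
  rw [B_apply]
  change (genP n (i : ℕ) * genP n (j : ℕ)) ^ _ = 1
  split_ifs with h1 h2 h3
  · rw [h1, pow_one, hs]
  · rcases h2 with h2 | h2
    · have e : (i : ℕ) = j + 1 := by omega
      rw [e]
      exact pow4_of (hs _) (hs _) (hb4 _ (by omega)).symm
    · have e : (j : ℕ) = i + 1 := by omega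
      rw [e]
      exact pow4_of (hs _) (hs _) (hb4 _ (by omega))
  · rcases h3 with h3 | h3
    · rw [← h3]
      exact pow3_of (hs _) (hs _) (hb3 _ (by omega)).symm
    · rw [← h3]
      exact pow3_of (hs _) (hs _) (hb3 _ (by omega))
  · rcases Nat.lt_or_ge i j with h4 | h4
    · exact pow2_of (hs _) (hs _) (hfar _ _ hj (by omega))
    · exact pow2_of (hs _) (hs _) (hfar _ _ hi (by omega)).symm

/-- pairing with positive roots, indexed by pairs -/
def rt (y : ℕ → ℤ) (p : ℕ × ℕ) : ℤ := if p.2 ≤ p.1 then y p.1 + y p.2 else y p.1 - y p.2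

def invn (n : ℕ) (y : ℕ → ℤ) : ℕ :=
  ((Finset.range n ×ˢ Finset.range n).filter (fun p => rt y p < 0)).card

def tau (n a : ℕ) (p : ℕ × ℕ) : ℕ × ℕ :=
  if a + 1 = n then (if p.1 = a ∨ p.2 = a then (p.2, p.1) else p)
  else if (p.1 = a ∧ p.2 = a + 1) ∨ (p.1 = a + 1 ∧ p.2 = a) then p
  else ((if p.1 = a then a + 1 else if p.1 = a + 1 then a else p.1),
    (if p.2 = a then a + 1 else if p.2 = a + 1 then a else p.2))

lemma invn_gen (n a : ℕ) (ha : a < n) (y : ℕ → ℤ) : invn n (gen n a y) ≤ invn n y + 1 := by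
  unfold invn
  have hsub : (Finset.range n ×ˢ Finset.range n).filter (fun p => rt (gen n a y) p < 0) ⊆
      insert (if a + 1 = n then (a, a) else (a, a + 1))
        (((Finset.range n ×ˢ Finset.range n).filter (fun p => rt y p < 0)).image (tau n a)) := by
    rintro ⟨i, j⟩ hp
    simp only [Finset.mem_filter, Finset.mem_product, Finset.mem_range] at hp
    obtain ⟨⟨hi, hj⟩, hlt⟩ := hp
    rw [Finset.mem_insert, Finset.mem_image]
    by_cases hsimple : (i, j) = (if a + 1 = n then (a, a) else (a, a + 1))
    · left; exact hsimple
    right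
    refine ⟨tau n a (i, j), ?_, ?_⟩
    · simp only [Finset.mem_filter, Finset.mem_product, Finset.mem_range]
      unfold tau rt gen at *
      grind
    · unfold tau
      grind
  refine (Finset.card_le_card hsub).trans ((Finset.card_insert_le _ _).trans ?_)
  exact Nat.add_le_add_right Finset.card_image_le 1

/-- negation -/
def ngv (n : ℕ) (y : ℕ → ℤ) : ℕ → ℤ := fun k => if k < n then - y k else y k

lemma ngv_gen (n a : ℕ) (ha : a < n) (y : ℕ → ℤ) : ngv n (gen n a y) = gen n a (ngv n y) := by
  funext k
  unfold gen ngv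
  grind

def vst (n : ℕ) : ℕ → ℤ := fun k => (n : ℤ) - k

lemma invn_vst (n : ℕ) : invn n (vst n) = 0 := by
  unfold invn
  rw [Finset.card_eq_zero, Finset.filter_eq_empty_iff]
  rintro ⟨i, j⟩ hp
  simp only [Finset.mem_product, Finset.mem_range] at hp
  unfold rt vst
  grind

lemma invn_ngv (n : ℕ) : invn n (ngv n (vst n)) = n ^ 2 := by
  unfold invn
  rw [Finset.filter_true_of_mem]
  · simp [sq]
  · rintro ⟨i, j⟩ hp
    simp only [Finset.mem_product, Finset.mem_range] at hp
    unfold rt ngv vst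
    grind

end Rep
end BW

namespace BW
section Cox
variable {W : Type*} [Group W] {n : ℕ} (cs : CoxeterSystem (CoxeterMatrix.B n) W)

noncomputable def gW (a : ℕ) : W := if h : a < n then cs.simple ⟨a, h⟩ else 1

lemma gW_of_lt {a : ℕ} (h : a < n) : gW cs a = cs.simple ⟨a, h⟩ := dif_pos h

lemma gW_fin (i : Fin n) : gW cs (i : ℕ) = cs.simple i := dif_pos i.2

lemma gW_sq (a : ℕ) : gW cs a * gW cs a = 1 := by
  unfold gW
  split_ifs
  · exact cs.simple_mul_simple_self _
  · simp

lemma gW_far (a b : ℕ) (h : a + 2 ≤ b) : gW cs a * gW cs b = gW cs b * gW cs a := by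
  by_cases hb : b < n
  · have ha : a < n := by omega
    have := cs.wordProd_braidWord_eq ⟨a, ha⟩ ⟨b, hb⟩
    have hM : (CoxeterMatrix.B n) ⟨a, ha⟩ ⟨b, hb⟩ = 2 := by
      rw [B_apply]; simp only; split_ifs <;> omega
    have hM' : (CoxeterMatrix.B n) ⟨b, hb⟩ ⟨a, ha⟩ = 2 := by
      rw [B_apply]; simp only; split_ifs <;> omega
    simp only [CoxeterSystem.braidWord, hM, hM', CoxeterSystem.alternatingWord, List.concat_eq_append,
      List.nil_append, CoxeterSystem.wordProd, List.map_append, List.map_cons, List.map_nil,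
      List.prod_append, List.prod_cons, List.prod_nil, mul_one, one_mul] at this
    rw [gW_of_lt cs ha, gW_of_lt cs hb]
    simpa [mul_assoc] using this
  · unfold gW; simp [hb]

lemma gW_br3 (a : ℕ) (h : a + 2 < n) : gW cs a * gW cs (a + 1) * gW cs a =
    gW cs (a + 1) * gW cs a * gW cs (a + 1) := by
  have ha : a < n := by omega
  have hb : a + 1 < n := by omega
  have := cs.wordProd_braidWord_eq ⟨a, ha⟩ ⟨a + 1, hb⟩
  have hM : (CoxeterMatrix.B n) ⟨a, ha⟩ ⟨a + 1, hb⟩ = 3 := by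
    rw [B_apply]; grind
  have hM' : (CoxeterMatrix.B n) ⟨a + 1, hb⟩ ⟨a, ha⟩ = 3 := by
    rw [B_apply]; grind
  simp only [CoxeterSystem.braidWord, hM, hM', CoxeterSystem.alternatingWord, List.concat_eq_append,
    List.nil_append, CoxeterSystem.wordProd, List.map_append, List.map_cons, List.map_nil,
    List.prod_append, List.prod_cons, List.prod_nil, mul_one, one_mul] at this
  rw [gW_of_lt cs ha, gW_of_lt cs hb]
  simpa [mul_assoc] using this.symm

lemma gW_br4 (a : ℕ) (h : a + 2 = n) : gW cs a * gW cs (a + 1) * gW cs a * gW cs (a + 1) =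
    gW cs (a + 1) * gW cs a * gW cs (a + 1) * gW cs a := by
  have ha : a < n := by omega
  have hb : a + 1 < n := by omega
  have := cs.wordProd_braidWord_eq ⟨a, ha⟩ ⟨a + 1, hb⟩
  have hM : (CoxeterMatrix.B n) ⟨a, ha⟩ ⟨a + 1, hb⟩ = 4 := by
    rw [B_apply]; simp only; split_ifs <;> omega
  have hM' : (CoxeterMatrix.B n) ⟨a + 1, hb⟩ ⟨a, ha⟩ = 4 := by
    rw [B_apply]; simp only; split_ifs <;> omega
  simp only [CoxeterSystem.braidWord, hM, hM', CoxeterSystem.alternatingWord, List.concat_eq_append,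
    List.nil_append, CoxeterSystem.wordProd, List.map_append, List.map_cons, List.map_nil,
    List.prod_append, List.prod_cons, List.prod_nil, mul_one, one_mul] at this
  rw [gW_of_lt cs ha, gW_of_lt cs hb]
  simpa [mul_assoc] using this

noncomputable def tW (i : ℕ) : W := if i < n then gW cs (n - 1 - i) else 1

lemma relB : RelB (tW cs) n where
  sq i := by
    unfold tW; split_ifs
    · exact gW_sq cs _
    · simp
  far i j h := by
    unfold tW
    split_ifs with h1 h2 h2
    · exact (gW_far cs _ _ (by omega)).symm
    all_goals simp
  br3 i h1 h2 := by
    obtain ⟨a, ha⟩ : ∃ a, n - 1 - (i + 1) = a := ⟨_, rfl⟩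
    unfold tW
    rw [if_pos h2, if_pos (by omega), ha, show n - 1 - i = a + 1 by omega]
    exact (gW_br3 cs a (by omega)).symm
  br4 h := by
    unfold tW
    rw [if_pos h, if_pos (by omega), show n - 1 - 0 = (n - 2) + 1 by omega,
      show n - 1 - 1 = n - 2 by omega]
    exact (gW_br4 cs (n - 2) (by omega)).symm

lemma exists_NF (w : W) : ∃ m, NF (tW cs) n w m := by
  refine cs.simple_induction_left (p := fun w => ∃ m, NF (tW cs) n w m) w ⟨0, NF_one _ n⟩ ?_
  rintro w i ⟨m, hm⟩
  obtain ⟨m', hm'⟩ := NF_mul (relB cs) hm le_rfl (n - 1 - i) (by omega)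
  refine ⟨m', ?_⟩
  have : tW cs (n - 1 - i) = cs.simple i := by
    unfold tW
    rw [if_pos (by omega), show n - 1 - (n - 1 - (i : ℕ)) = i by omega, gW_fin]
  rwa [this] at hm'

lemma len_le (w : W) : cs.length w ≤ n ^ 2 ∧ (n ^ 2 ≤ cs.length w → w = wst (tW cs) n) := by
  obtain ⟨m, hm⟩ := exists_NF cs w
  have h1 := NF_bound hm
  have h2 : cs.length w ≤ m := by
    apply NF_len (t := tW cs) cs.length_one _ hm
    intro i w
    unfold tW gW
    split_ifs
    · have := cs.length_mul_le (cs.simple ⟨n - 1 - i, by assumption⟩) w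
      rw [cs.length_simple] at this
      omega
    · simp
    · simp
  exact ⟨h2.trans h1.1, fun h => h1.2 (by omega)⟩

noncomputable def rho : W →* Equiv.Perm (ℕ → ℤ) := cs.lift ⟨_, genP_lift n⟩

lemma rho_simple (i : Fin n) (y : ℕ → ℤ) : rho cs (cs.simple i) y = gen n i y := by
  rw [rho, cs.lift_apply_simple]; rfl

lemma invn_le_len (w : W) : invn n (rho cs w (vst n)) ≤ cs.length w := by
  have : ∀ ω : List (Fin n), invn n (rho cs (cs.wordProd ω) (vst n)) ≤ ω.length := by
    intro ω
    induction ω with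
    | nil => simp [invn_vst]
    | cons i ω ih =>
      rw [cs.wordProd_cons, map_mul, Equiv.Perm.mul_apply, rho_simple, List.length_cons]
      exact (invn_gen n i i.2 _).trans (by omega)
  obtain ⟨ω, h1, rfl⟩ := cs.exists_isReduced w
  rw [h1.eq]
  exact this ω

/-- acts as minus one -/
def ActNeg (w : W) : Prop := ∀ y, rho cs w y = ngv n y

lemma eq_wst_of_neg {w : W} (h : ActNeg cs w) : cs.length w = n ^ 2 ∧ w = wst (tW cs) n := by
  have h1 := invn_le_len cs w
  rw [h, invn_ngv] at h1
  exact ⟨le_antisymm (len_le cs w).1 h1, (len_le cs w).2 h1⟩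

/-- initial products -/
noncomputable def cpre : ℕ → W
  | 0 => 1
  | m + 1 => cpre m * gW cs m

lemma rho_gW (a : ℕ) (ha : a < n) (y : ℕ → ℤ) : rho cs (gW cs a) y = gen n a y := by
  rw [gW_of_lt cs ha, rho_simple]

lemma rho_cpre (m : ℕ) : m < n → ∀ y, rho cs (cpre cs m) y =
    fun k => if k = 0 then y m else if k ≤ m then y (k - 1) else y k := by
  induction m with
  | zero => intro _ y; funext k; simp [cpre]; grind
  | succ m ih =>
    intro hm y
    rw [cpre, map_mul, Equiv.Perm.mul_apply, ih (by omega), rho_gW cs m (by omega)]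
    funext k
    unfold gen
    grind

lemma rho_c (y : ℕ → ℤ) : rho cs (cpre cs n) y =
    fun k => if k < n then (if k = 0 then - y (n - 1) else y (k - 1)) else y k := by
  rcases Nat.eq_zero_or_pos n with h | h
  · subst h
    funext k
    simp [cpre]
  · obtain ⟨m, rfl⟩ : ∃ m, n = m + 1 := ⟨n - 1, by omega⟩
    rw [cpre, map_mul, Equiv.Perm.mul_apply, rho_cpre cs m (by omega), rho_gW cs m (by omega)]
    funext k
    unfold gen
    grind

lemma rho_c_pow (m : ℕ) : m ≤ n → ∀ y, rho cs (cpre cs n ^ m) y =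
    fun k => if k < n then (if k < m then - y (n + k - m) else y (k - m)) else y k := by
  induction m with
  | zero => intro _ y; funext k; simp
  | succ m ih =>
    intro hm y
    rw [pow_succ', map_mul, Equiv.Perm.mul_apply, ih (by omega), rho_c]
    funext k
    grind

lemma c_pow_neg : ActNeg cs (cpre cs n ^ n) := by
  intro y
  rw [rho_c_pow cs n le_rfl]
  funext k
  unfold ngv
  grind

lemma rho_ngv (w : W) (y : ℕ → ℤ) : rho cs w (ngv n y) = ngv n (rho cs w y) := by
  refine cs.simple_induction_left (p := fun w => rho cs w (ngv n y) = ngv n (rho cs w y)) w (by simp) ?_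
  intro w i ih
  rw [map_mul, Equiv.Perm.mul_apply, ih, Equiv.Perm.mul_apply, rho_simple, rho_simple, ngv_gen n i i.2]

theorem w0_facts (w0 : W) (hw0 : ∀ u, cs.length u ≤ cs.length w0) :
    cs.length w0 = n ^ 2 ∧ w0 = cpre cs n ^ n ∧ w0⁻¹ = w0 ∧ (∀ w, w * w0 = w0 * w) := by
  have hc := eq_wst_of_neg cs (c_pow_neg cs)
  have h1 : w0 = wst (tW cs) n := (len_le cs w0).2 (by rw [← hc.1]; exact hw0 _)
  have h2 : w0 = cpre cs n ^ n := by rw [h1, ← hc.2]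
  have h3 : cs.length w0 = n ^ 2 := by rw [h2, hc.1]
  refine ⟨h3, h2, ?_, ?_⟩
  · rw [(len_le cs w0⁻¹).2 (by rw [cs.length_inv, h3]), h1]
  · intro w
    have h4 : ActNeg cs (w * w0 * w⁻¹) := by
      intro y
      rw [map_mul, map_mul, Equiv.Perm.mul_apply, Equiv.Perm.mul_apply, h2, c_pow_neg cs, rho_ngv,
        ← Equiv.Perm.mul_apply, ← map_mul, mul_inv_cancel, map_one, Equiv.Perm.one_apply]
    have h5 := (eq_wst_of_neg cs h4).2
    rw [← h1] at h5
    exact mul_inv_eq_iff_eq_mul.1 h5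

end Cox
end BW

namespace BW
section Ops
variable {W : Type*} [Group W] {n : ℕ} (cs : CoxeterSystem (CoxeterMatrix.B n) W)

open Classical in
/-- Length-additive left translation. -/
noncomputable def opW (g : W) (d : ℕ) : Module.End ℚ (W →₀ ℚ) :=
  Finsupp.linearCombination ℚ (fun w => if cs.length (g * w) = d + cs.length w
    then Finsupp.single (g * w) (1 : ℚ) else 0)

open Classical in
lemma opW_single (g : W) (d : ℕ) (w : W) : opW cs g d (Finsupp.single w 1) =
    if cs.length (g * w) = d + cs.length w then Finsupp.single (g * w) (1 : ℚ) else 0 := by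
  simp [opW]

lemma opW_mul {g h : W} {d e : ℕ} (hg : cs.length g ≤ d) (hh : cs.length h ≤ e) :
    opW cs g d * opW cs h e = opW cs (g * h) (d + e) := by
  apply Finsupp.lhom_ext'
  intro w
  apply LinearMap.ext_ring
  simp only [LinearMap.coe_comp, Function.comp_apply, Finsupp.lsingle_apply, Module.End.mul_apply]
  rw [opW_single, opW_single]
  have h1 := cs.length_mul_le h w
  have h2 := cs.length_mul_le g (h * w)
  rw [← mul_assoc] at h2
  split_ifs with c1 c2 c2
  · rw [opW_single, if_pos (by rw [← mul_assoc]; omega), mul_assoc]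
  · rw [opW_single, if_neg (by rw [← mul_assoc]; omega)]
  · omega
  · simp

lemma opW_one : opW cs 1 0 = 1 := by
  apply Finsupp.lhom_ext'
  intro w
  apply LinearMap.ext_ring
  simp only [LinearMap.coe_comp, Function.comp_apply, Finsupp.lsingle_apply, Module.End.one_apply]
  rw [opW_single]
  simp

lemma opW_zero : opW cs 1 2 = 0 := by
  apply Finsupp.lhom_ext'
  intro w
  apply LinearMap.ext_ring
  simp only [LinearMap.coe_comp, Function.comp_apply, Finsupp.lsingle_apply]
  rw [opW_single]
  simp

/-- The monoid of such translations. -/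
noncomputable def monW : Submonoid (Module.End ℚ (W →₀ ℚ)) where
  carrier := {X | ∃ g d, cs.length g ≤ d ∧ X = opW cs g d}
  one_mem' := ⟨1, 0, by simp, (opW_one cs).symm⟩
  mul_mem' := by
    rintro _ _ ⟨g, d, h1, rfl⟩ ⟨h, e, h2, rfl⟩
    exact ⟨g * h, d + e, (cs.length_mul_le g h).trans (by omega), opW_mul cs h1 h2⟩

/-- The algebra generated by the translations. -/
noncomputable def algW : Subalgebra ℚ (Module.End ℚ (W →₀ ℚ)) :=
  Algebra.adjoin ℚ (monW cs : Set (Module.End ℚ (W →₀ ℚ)))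

lemma algW_span : Subalgebra.toSubmodule (algW cs) =
    Submodule.span ℚ (monW cs : Set (Module.End ℚ (W →₀ ℚ))) := by
  rw [algW, Algebra.adjoin_eq_span, Submonoid.closure_eq]

/-- coefficient functional -/
noncomputable def phE (w0 : W) : Module.End ℚ (W →₀ ℚ) →ₗ[ℚ] ℚ :=
  (Finsupp.lapply w0) ∘ₗ (LinearMap.applyₗ (Finsupp.single (1 : W) (1 : ℚ)))

open Classical in
lemma phE_opW (w0 g : W) (d : ℕ) : phE w0 (opW cs g d) =
    if cs.length w0 = d ∧ g = w0 then 1 else 0 := by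
  simp only [phE, LinearMap.coe_comp, Function.comp_apply, LinearMap.applyₗ_apply_apply,
    Finsupp.lapply_apply]
  rw [opW_single]
  simp only [mul_one, cs.length_one, add_zero]
  by_cases h : g = w0
  · subst h
    split_ifs with c1 c2 c2
    · simp
    · exact absurd ⟨c1, rfl⟩ c2
    · exact absurd c2.1 c1
    · simp
  · rw [if_neg (show ¬ (cs.length w0 = d ∧ g = w0) from fun k => h k.2)]
    split_ifs
    · simp [Finsupp.single_apply, h]
    · simp

lemma phE_trace (w0 : W) (hc : ∀ w, w * w0 = w0 * w) (X Y : Module.End ℚ (W →₀ ℚ))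
    (hX : X ∈ algW cs) (hY : Y ∈ algW cs) : phE w0 (X * Y) = phE w0 (Y * X) := by
  have hX' : X ∈ Submodule.span ℚ (monW cs : Set (Module.End ℚ (W →₀ ℚ))) := by
    rw [← algW_span]; exact hX
  have hY' : Y ∈ Submodule.span ℚ (monW cs : Set (Module.End ℚ (W →₀ ℚ))) := by
    rw [← algW_span]; exact hY
  clear hX hY
  induction hX' using Submodule.span_induction with
  | zero => simp
  | add a b _ _ ha hb => rw [add_mul, mul_add, map_add, map_add, ha, hb]
  | smul c a _ ha => rw [smul_mul_assoc, mul_smul_comm, map_smul, map_smul, ha]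
  | mem X hX =>
    induction hY' using Submodule.span_induction with
    | zero => simp
    | add a b _ _ ha hb => rw [add_mul, mul_add, map_add, map_add, ha, hb]
    | smul c a _ ha => rw [smul_mul_assoc, mul_smul_comm, map_smul, map_smul, ha]
    | mem Y hY =>
      obtain ⟨g, d, h1, rfl⟩ := hX
      obtain ⟨h, e, h2, rfl⟩ := hY
      rw [opW_mul cs h1 h2, opW_mul cs h2 h1, phE_opW, phE_opW, add_comm]
      have : g * h = w0 ↔ h * g = w0 := by
        constructor
        · intro k
          have := hc h
          rw [← k] at this ⊢
          have h3 : h * g * h = g * h * h := by rw [mul_assoc]; exact this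
          exact mul_right_cancel h3
        · intro k
          have := hc g
          rw [← k] at this ⊢
          have h3 : g * h * g = h * g * g := by rw [mul_assoc]; exact this
          exact mul_right_cancel h3
      by_cases k : g * h = w0
      · simp only [k, this.1 k]
      · rw [if_neg (fun c => k c.2), if_neg (fun c => k (this.2 c.2))]

/-- The nil-Coxeter generators. -/
noncomputable def uW (i : ℕ) : Module.End ℚ (W →₀ ℚ) := if i < n then opW cs (gW cs i) 1 else 0

lemma len_gW (i : ℕ) : cs.length (gW cs i) ≤ 1 := by
  unfold gW; split_ifs
  · rw [cs.length_simple]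
  · simp

lemma uW_mem (i : ℕ) : uW cs i ∈ algW cs := by
  unfold uW; split_ifs
  · exact Algebra.subset_adjoin ⟨_, _, len_gW cs i, rfl⟩
  · exact zero_mem _

lemma len2 {g h : W} {d e : ℕ} (hg : cs.length g ≤ d) (hh : cs.length h ≤ e) :
    cs.length (g * h) ≤ d + e := (cs.length_mul_le g h).trans (by omega)

/-- inside the algebra -/
noncomputable def vW (i : ℕ) : algW cs := ⟨uW cs i, uW_mem cs i⟩

lemma nilB : NilB (vW cs) n where
  sq i := by
    apply Subtype.ext
    show uW cs i * uW cs i = 0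
    unfold uW
    split_ifs
    · rw [opW_mul cs (len_gW cs i) (len_gW cs i), gW_sq, opW_zero]
    · simp
  far i j h := by
    apply Subtype.ext
    show uW cs i * uW cs j = uW cs j * uW cs i
    unfold uW
    split_ifs
    · rw [opW_mul cs (len_gW cs i) (len_gW cs j), opW_mul cs (len_gW cs j) (len_gW cs i),
        gW_far cs i j h]
    all_goals simp
  br3 i h := by
    apply Subtype.ext
    show uW cs i * uW cs (i + 1) * uW cs i = uW cs (i + 1) * uW cs i * uW cs (i + 1)
    unfold uW
    rw [if_pos (by omega), if_pos (by omega)]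
    have hi := len_gW cs i
    have hj := len_gW cs (i + 1)
    rw [opW_mul cs hi hj, opW_mul cs (len2 cs hi hj) hi, opW_mul cs hj hi,
      opW_mul cs (len2 cs hj hi) hj, gW_br3 cs i h]
  br4 i h := by
    apply Subtype.ext
    show uW cs i * uW cs (i + 1) * uW cs i * uW cs (i + 1) =
      uW cs (i + 1) * uW cs i * uW cs (i + 1) * uW cs i
    unfold uW
    rw [if_pos (by omega), if_pos (by omega)]
    have hi := len_gW cs i
    have hj := len_gW cs (i + 1)
    rw [opW_mul cs hi hj, opW_mul cs (len2 cs hi hj) hi,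
      opW_mul cs (len2 cs (len2 cs hi hj) hi) hj, opW_mul cs hj hi,
      opW_mul cs (len2 cs hj hi) hj, opW_mul cs (len2 cs (len2 cs hj hi) hj) hi, gW_br4 cs i h]

/-- the trace functional -/
noncomputable def phW (w0 : W) : algW cs →ₗ[ℚ] ℚ := phE w0 ∘ₗ (algW cs).val.toLinearMap

lemma phW_trace (w0 : W) (hc : ∀ w, w * w0 = w0 * w) (X Y : algW cs) :
    phW cs w0 (X * Y) = phW cs w0 (Y * X) :=
  phE_trace cs w0 hc X Y X.2 Y.2

lemma UU_val (ω : List (Fin n)) : ((UU (vW cs) ω : algW cs) : Module.End ℚ (W →₀ ℚ)) =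
    opW cs (cs.wordProd ω) ω.length := by
  induction ω with
  | nil => simp [UU, opW_one]
  | cons i ω ih =>
    have : UU (vW cs) (i :: ω) = vW cs i * UU (vW cs) ω := by simp [UU]
    rw [this]
    show uW cs i * ((UU (vW cs) ω : algW cs) : Module.End ℚ (W →₀ ℚ)) = _
    rw [ih, uW, if_pos i.2, opW_mul cs (len_gW cs i) (cs.length_wordProd_le ω), cs.wordProd_cons,
      gW_fin, List.length_cons, add_comm]

lemma len_cpre (m : ℕ) : cs.length (cpre cs m) ≤ m := by
  induction m with
  | zero => simp [cpre]
  | succ m ih => exact len2 cs ih (len_gW cs m)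

lemma aa_val (m : ℕ) : m ≤ n → ((aa (vW cs) m m : algW cs) : Module.End ℚ (W →₀ ℚ)) =
    opW cs (cpre cs m) m := by
  induction m with
  | zero => intro _; simp [aa, cpre, opW_one]
  | succ m ih =>
    intro hm
    have : aa (vW cs) (m + 1) (m + 1) = aa (vW cs) m m * vW cs m := by
      show aa (vW cs) m (m + 1) + _ = _
      rw [aa_big _ _ _ (by omega), zero_add]
    rw [this]
    show ((aa (vW cs) m m : algW cs) : Module.End ℚ (W →₀ ℚ)) * uW cs m = _
    rw [ih (by omega), uW, if_pos (by omega), opW_mul cs (len_cpre cs m) (len_gW cs m)]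
    rfl

lemma pow_val (m : ℕ) : cs.length (cpre cs n ^ m) ≤ n * m ∧
    ((aa (vW cs) n n ^ m : algW cs) : Module.End ℚ (W →₀ ℚ)) = opW cs (cpre cs n ^ m) (n * m) := by
  induction m with
  | zero => simp [opW_one]
  | succ m ih =>
    constructor
    · rw [pow_succ]; exact len2 cs ih.1 (len_cpre cs n)
    · rw [pow_succ, pow_succ, Nat.mul_succ, ← opW_mul cs ih.1 (len_cpre cs n), ← ih.2,
        ← aa_val cs n le_rfl]
      rfl

open Classical in
theorem sum_q (w0 : W) (hw0 : ∀ u, cs.length u ≤ cs.length w0) (q : ℚ) (hq0 : q ≠ 0)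
    (hq : ∀ k, q ^ (k + 1) - 1 ≠ 0) :
    (∑ ω ∈ (WS n (n ^ 2)).filter (fun ω => cs.wordProd ω = w0), q ^ MM ω) *
      ((q ^ n - 1) ^ n * ∏ i ∈ Finset.Icc 1 (n - 1), ((q ^ i - 1) * (q ^ (2 * n - i) - 1)) ^ i) =
    q ^ (n * n.choose 2) * fa q (n ^ 2) := by
  obtain ⟨h1, h2, h3, h4⟩ := w0_facts cs w0 hw0
  have h5 : phW cs w0 (aa (vW cs) n n ^ n) = 1 := by
    show phE w0 ((aa (vW cs) n n ^ n : algW cs) : Module.End ℚ (W →₀ ℚ)) = 1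
    rw [(pow_val cs n).2, phE_opW, if_pos]
    exact ⟨by rw [h1, sq], h2.symm⟩
  rw [← main_q (nilB cs) (phW cs w0) (phW_trace cs w0 h4) q hq0 hq h5]
  congr 1
  have hqp : qp q (n ^ 2) ≠ 0 := by
    unfold qp
    apply Finset.prod_ne_zero_iff.2
    intro l _ h
    exact hq l (by linarith)
  rw [FF, map_sum, Finset.mul_sum, Finset.sum_filter]
  apply Finset.sum_congr rfl
  intro ω hω
  rw [mem_WS] at hω
  rw [map_smul]
  have : phW cs w0 (UU (vW cs) ω) = if cs.wordProd ω = w0 then 1 else 0 := by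
    show phE w0 ((UU (vW cs) ω : algW cs) : Module.End ℚ (W →₀ ℚ)) = _
    rw [UU_val, phE_opW]
    simp [hω, h1]
  rw [this, rr, hω]
  split_ifs
  · rw [smul_eq_mul, mul_one, mul_div_cancel₀ _ hqp]
  · simp

end Ops
end BW

namespace BW

lemma majW_snoc (l : List ℕ) (a : ℕ) : majW (l ++ [a]) = majW l +
    if 0 < l.length ∧ a < l.getD (l.length - 1) 0 then l.length else 0 := by
  unfold majW
  rw [List.length_append, List.length_singleton, Finset.sum_range_succ]
  congr 1
  · apply Finset.sum_congr rfl
    intro i hi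
    rw [Finset.mem_range] at hi
    rw [List.getD_append _ _ _ _ hi, List.getD_append _ _ _ _ (by omega)]
  · rcases Nat.eq_zero_or_pos l.length with h | h
    · simp [h]
    · rw [List.getD_append _ _ _ _ (show l.length - 1 < l.length by omega),
        List.getD_append_right _ _ _ _ le_rfl]
      simp

lemma MM_eq {n : ℕ} : ∀ ω : List (Fin n), ω.IsChain (· ≠ ·) →
    MM ω = majW (ω.reverse.map (fun i : Fin n => n - (i : ℕ)))
  | [], _ => by simp [MM, majW]
  | [x], _ => by simp [MM, majW]
  | x :: y :: r, h => by
    rw [List.isChain_cons_cons] at h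
    have ih := MM_eq (y :: r) h.2
    rw [MM, ih, List.reverse_cons (a := x), List.map_append, List.map_singleton, majW_snoc]
    congr 1
    have e : ((y :: r).reverse.map (fun i : Fin n => n - (i : ℕ))).length = r.length + 1 := by simp
    have e2 : ((y :: r).reverse.map (fun i : Fin n => n - (i : ℕ))).getD (r.length + 1 - 1) 0 = n - (y : ℕ) := by
      simp [List.getD_append_right]
    rw [e, e2]
    have hx := x.2
    have hy := y.2
    have hne : (x : ℕ) ≠ y := fun k => h.1 (Fin.ext k)
    split_ifs <;> omega

lemma chain_of_reduced {W : Type*} [Group W] {n : ℕ} (cs : CoxeterSystem (CoxeterMatrix.B n) W) :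
    ∀ ω : List (Fin n), cs.IsReduced ω → ω.IsChain (· ≠ ·)
  | [], _ => by simp
  | [x], _ => by simp
  | x :: y :: r, h => by
    rw [List.isChain_cons_cons]
    refine ⟨?_, chain_of_reduced cs (y :: r) (h.drop 1)⟩
    rintro rfl
    have h1 := h.eq
    rw [cs.wordProd_cons, cs.wordProd_cons, cs.simple_mul_simple_cancel_left] at h1
    have := cs.length_wordProd_le r
    simp at h1
    omega

/-- The denominator. -/
noncomputable def DD (n : ℕ) : Polynomial ℤ :=
  (qInt n) ^ n * ∏ i ∈ Finset.Icc 1 (n - 1), (qInt i * qInt (2 * n - i)) ^ i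

lemma qInt_eval (m : ℕ) (q : ℤ) : (qInt m).eval q * (q - 1) = q ^ m - 1 := by
  unfold qInt
  rw [Polynomial.eval_finsetSum]
  simp only [Polynomial.eval_pow, Polynomial.eval_X]
  exact geom_sum_mul q m

lemma qFact_eval (N : ℕ) (q : ℤ) : (qFact N).eval q * (q - 1) ^ N =
    ∏ l ∈ Finset.range N, (q ^ (l + 1) - 1) := by
  unfold qFact
  induction N with
  | zero => simp
  | succ N ih =>
    rw [Finset.prod_range_succ, Finset.prod_range_succ, ← ih, ← qInt_eval, Polynomial.eval_mul]
    ring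

lemma sum_sq (n : ℕ) : n + ∑ i ∈ Finset.Icc 1 (n - 1), 2 * i = n ^ 2 := by
  induction n with
  | zero => simp
  | succ n ih =>
    rcases n with _ | n
    · simp
    · rw [show n + 1 + 1 - 1 = n + 1 by omega, Finset.sum_Icc_succ_top (by omega)]
      rw [show n + 1 - 1 = n by omega] at ih
      nlinarith

lemma DD_eval (n : ℕ) (q : ℤ) : (DD n).eval q * (q - 1) ^ (n ^ 2) =
    (q ^ n - 1) ^ n * ∏ i ∈ Finset.Icc 1 (n - 1), ((q ^ i - 1) * (q ^ (2 * n - i) - 1)) ^ i := by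
  have h1 : ∏ i ∈ Finset.Icc 1 (n - 1), ((q ^ i - 1) * (q ^ (2 * n - i) - 1)) ^ i =
      (∏ i ∈ Finset.Icc 1 (n - 1), ((qInt i).eval q * (qInt (2 * n - i)).eval q) ^ i) *
        (q - 1) ^ (∑ i ∈ Finset.Icc 1 (n - 1), 2 * i) := by
    rw [← Finset.prod_pow_eq_pow_sum, ← Finset.prod_mul_distrib]
    apply Finset.prod_congr rfl
    intro i _
    rw [← qInt_eval, ← qInt_eval, pow_mul, ← mul_pow]
    congr 1
    ring
  have h2 : (q - 1) ^ (n ^ 2) = (q - 1) ^ n * (q - 1) ^ (∑ i ∈ Finset.Icc 1 (n - 1), 2 * i) := by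
    rw [← pow_add, sum_sq]
  rw [h1, h2, ← qInt_eval, DD, Polynomial.eval_mul, Polynomial.eval_pow, Polynomial.eval_prod]
  simp only [Polynomial.eval_mul, Polynomial.eval_pow]
  rw [mul_pow]
  ring

lemma qInt_succ (m : ℕ) : (qInt (m + 1)).Monic := by
  unfold qInt
  exact Polynomial.monic_geom_sum_X (by omega)

lemma DD_monic (n : ℕ) : (DD n).Monic := by
  unfold DD
  apply Polynomial.Monic.mul
  · rcases n with _ | n
    · simp
    · exact (qInt_succ n).pow _
  · apply Polynomial.monic_prod_of_monic
    intro i hi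
    rw [Finset.mem_Icc] at hi
    apply Polynomial.Monic.pow
    apply Polynomial.Monic.mul
    · obtain ⟨k, rfl⟩ : ∃ k, i = k + 1 := ⟨i - 1, by omega⟩
      exact qInt_succ k
    · obtain ⟨k, hk⟩ : ∃ k, 2 * n - i = k + 1 := ⟨2 * n - i - 1, by omega⟩
      rw [hk]
      exact qInt_succ k

lemma qInt_cop (m : ℕ) : IsCoprime (Polynomial.X : Polynomial ℤ) (qInt (m + 1)) := by
  unfold qInt
  rw [Finset.sum_range_succ']
  simp only [pow_succ, ← Finset.sum_mul]
  refine ⟨-(∑ i ∈ Finset.range m, Polynomial.X ^ i), 1, ?_⟩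
  ring

lemma DD_cop (n : ℕ) : IsCoprime (Polynomial.X : Polynomial ℤ) (DD n) := by
  unfold DD
  apply IsCoprime.mul_right
  · rcases n with _ | n
    · simpa using isCoprime_one_right
    · exact (qInt_cop n).pow_right
  · apply IsCoprime.prod_right
    intro i hi
    rw [Finset.mem_Icc] at hi
    apply IsCoprime.pow_right
    apply IsCoprime.mul_right
    · obtain ⟨k, rfl⟩ : ∃ k, i = k + 1 := ⟨i - 1, by omega⟩
      exact qInt_cop k
    · obtain ⟨k, hk⟩ : ∃ k, 2 * n - i = k + 1 := ⟨2 * n - i - 1, by omega⟩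
      rw [hk]
      exact qInt_cop k

lemma final_div (n k : ℕ) (P : Polynomial ℤ)
    (h : P * DD n = Polynomial.X ^ k * qFact (n ^ 2)) : P = Polynomial.X ^ k * qHookSquare n := by
  have hd : DD n ∣ qFact (n ^ 2) := by
    have : DD n ∣ Polynomial.X ^ k * qFact (n ^ 2) := ⟨P, by rw [← h, mul_comm]⟩
    exact (DD_cop n).symm.pow_right.dvd_of_dvd_mul_left this
  obtain ⟨G, hG⟩ := hd
  have h2 : qHookSquare n = G := by
    show qFact (n ^ 2) /ₘ DD n = G
    rw [hG, Polynomial.mul_divByMonic_cancel_left _ (DD_monic n)]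
  rw [h2]
  apply mul_right_cancel₀ (DD_monic n).ne_zero
  rw [h, hG]
  ring

lemma map_lift {n : ℕ} (ω : List (Fin n)) : (ω.map (fun i => n - (i : ℕ)) : List ℕ) =
    List.map (fun i : Fin n => n - (i : ℕ)) ω := by
  induction ω with
  | nil => rfl
  | cons x ω ih => simpa using ih

theorem main_B {W : Type*} [Group W] (n : ℕ)
    (cs : CoxeterSystem (CoxeterMatrix.B n) W) (w0 : W)
    (hw0 : ∀ u : W, cs.length u ≤ cs.length w0) :
    ∑ᶠ ω ∈ {ω : List (Fin n) | cs.IsReduced ω ∧ cs.wordProd ω = w0},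
        (Polynomial.X : Polynomial ℤ) ^ majW (ω.map (fun i => n - (i : ℕ))) =
      Polynomial.X ^ (n * n.choose 2) * qHookSquare n := by
  classical
  obtain ⟨h1, h2, h3, h4⟩ := w0_facts cs w0 hw0
  have hred : ∀ ω, (cs.IsReduced ω ∧ cs.wordProd ω = w0) ↔ (ω.length = n ^ 2 ∧ cs.wordProd ω = w0) := by
    intro ω
    apply and_congr_left
    intro h
    unfold CoxeterSystem.IsReduced
    rw [h, h1, eq_comm]
  have hset : {ω : List (Fin n) | cs.IsReduced ω ∧ cs.wordProd ω = w0} =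
      ((WS n (n ^ 2)).filter (fun ω => cs.wordProd ω = w0) : Finset (List (Fin n))) := by
    ext ω
    rw [Finset.coe_filter, Set.mem_ofPred_eq, Set.mem_ofPred_eq, mem_WS, hred]
  rw [hset, finsum_mem_coe_finset]
  have hrev : ∑ ω ∈ (WS n (n ^ 2)).filter (fun ω => cs.wordProd ω = w0),
        (Polynomial.X : Polynomial ℤ) ^ majW (ω.map (fun i => n - (i : ℕ))) =
      ∑ ω ∈ (WS n (n ^ 2)).filter (fun ω => cs.wordProd ω = w0), Polynomial.X ^ MM ω := by
    have hm : ∀ ω ∈ (WS n (n ^ 2)).filter (fun ω => cs.wordProd ω = w0),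
        ω.reverse ∈ (WS n (n ^ 2)).filter (fun ω => cs.wordProd ω = w0) := by
      intro ω hω
      rw [Finset.mem_filter, mem_WS] at hω ⊢
      rw [List.length_reverse, cs.wordProd_reverse, hω.2, h3]
      exact ⟨hω.1, rfl⟩
    refine Finset.sum_nbij' List.reverse List.reverse hm hm (fun _ _ => List.reverse_reverse _)
      (fun _ _ => List.reverse_reverse _) ?_
    intro ω hω
    have h5 := hm ω hω
    rw [Finset.mem_filter, mem_WS] at h5
    rw [MM_eq _ (chain_of_reduced cs _ ((hred _).2 h5).1), List.reverse_reverse, map_lift]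
  rw [hrev]
  apply final_div
  apply Polynomial.eq_of_infinite_eval_eq
  apply Set.Infinite.mono (s := Set.Ici (2 : ℤ)) _ (Set.Ici_infinite 2)
  intro q hq
  have hq2 : 2 ≤ q := hq
  rw [Set.mem_ofPred_eq]
  have hq1 : (q - 1) ^ (n ^ 2) ≠ 0 := pow_ne_zero _ (by omega)
  apply mul_right_cancel₀ hq1
  have hqq : (2 : ℚ) ≤ (q : ℚ) := by exact_mod_cast hq2
  have key := sum_q cs w0 hw0 (q : ℚ) (by linarith) (by
    intro k
    have := one_lt_pow₀ (show (1 : ℚ) < q by linarith) (show k + 1 ≠ 0 by omega)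
    linarith)
  unfold fa at key
  have key2 : (∑ ω ∈ (WS n (n ^ 2)).filter (fun ω => cs.wordProd ω = w0), q ^ MM ω) *
      ((q ^ n - 1) ^ n * ∏ i ∈ Finset.Icc 1 (n - 1), ((q ^ i - 1) * (q ^ (2 * n - i) - 1)) ^ i) =
      q ^ (n * n.choose 2) * ∏ l ∈ Finset.range (n ^ 2), (q ^ (l + 1) - 1) := by
    exact_mod_cast key
  rw [← DD_eval, ← qFact_eval] at key2
  rw [Polynomial.eval_mul, Polynomial.eval_mul, Polynomial.eval_pow, Polynomial.eval_X,
    Polynomial.eval_finsetSum]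
  simp only [Polynomial.eval_pow, Polynomial.eval_X]
  rw [mul_assoc, mul_assoc, key2]

end BW

/-- (Petersen–Serrano, Theorem 5.2.)  The major index generating function for the set
`R(w₀)` of reduced words for the longest element of the Coxeter group of type `Bₙ` equals,
up to the shift `q^(n·C(n,2))`, the `q`-analogue of the hook length formula for the `n × n`
square Young diagram:
`∑_(w ∈ R(w₀)) q^(maj w) = q^(n·C(n,2)) · [n²]_q! / ([n]_q^n ∏_(i=1)^(n-1) ([i]_q [2n-i]_q)^i)`.
(Generators are indexed by `Fin n` as in Mathlib's `CoxeterMatrix.Bₙ`, whose `4`-bond joins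
the indices `n-1` and `n-2`; the subscript of an index `i` is thus `n - i`, and the major
index of a reduced word is computed on its word of subscripts.) -/
theorem major_index_generating_function_of_reduced_words
    {W : Type*} [Group W] (n : ℕ)
    (cs : CoxeterSystem (CoxeterMatrix.Bₙ n) W) (w0 : W)
    (hw0 : ∀ u : W, cs.length u ≤ cs.length w0) :
    ∑ᶠ ω ∈ {ω : List (Fin n) | cs.IsReduced ω ∧ cs.wordProd ω = w0},
        (Polynomial.X : Polynomial ℤ) ^ majW (ω.map (fun i => n - (i : ℕ))) =
      Polynomial.X ^ (n * n.choose 2) * qHookSquare n := by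
  exact BW.main_B n cs w0 hw0
end
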